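/- For all integers r ≥ 4 and t with 2 ≤ t ≤ r−1, the limit of n^{-t} f^{(r)}(n; 4r-3t, 4) as n tends to infinity exists and equals 1 / (t! · C(r,t)), where C(r,t) denotes the binomial coefficient r choose t. -/

import Mathlib

open Finset Filter

/-- An `r`-graph is `(s,k)`-free if it has no `k` distinct edges spanning at most `s` vertices. -/
def IsFree {V : Type*} [DecidableEq V] (G : Finset (Finset V)) (s k : ℕ) : Prop :=
  ¬ ∃ S ⊆ G, S.card = k ∧ (S.sup id).card ≤ s

/-- `exNum r n s k` is the maximum number of edges of an `(s,k)`-free `r`-uniform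
hypergraph on `n` vertices, i.e. `f^{(r)}(n; s, k)`. -/
noncomputable def exNum (r n s k : ℕ) : ℕ :=
  sSup {m : ℕ | ∃ G : Finset (Finset (Fin n)),
    (∀ e ∈ G, e.card = r) ∧ IsFree G s k ∧ G.card = m}

section UpperBound

variable {V : Type*} [DecidableEq V]

/-- Deleting the members of a maximal disjoint subfamily destroys every configuration
satisfying `P`, provided edges of disjoint configurations meet in few vertices. -/
theorem exists_subset_avoiding [Fintype V] (G : Finset (Finset V)) (P : Finset (Finset V) → Prop)
    (c s : ℕ) (hcard : ∀ S ⊆ G, P S → S.card = c) (hc : 0 < c) (hs : ∀ e ∈ G, s ≤ e.card)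
    (hP : ∀ S ⊆ G, ∀ S' ⊆ G, P S → P S' → Disjoint S S' →
      ∀ e ∈ S, ∀ e' ∈ S', (e ∩ e').card < s) :
    ∃ H ⊆ G, G.card ≤ H.card + c * (Fintype.card V).choose s ∧ ∀ S ⊆ H, ¬ P S := by
  classical
  let F : Finset (Finset (Finset (Finset V))) := (G.powerset.powerset).filter
    (fun C => (∀ S ∈ C, P S) ∧ ∀ S ∈ C, ∀ S' ∈ C, S ≠ S' → Disjoint S S')
  have hF : F.Nonempty := ⟨∅, by simp [F]⟩
  obtain ⟨C, hC, hmax⟩ := F.exists_max_image card hF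
  have hC' := hC
  simp only [F, mem_filter, mem_powerset] at hC
  obtain ⟨hCG, hCP, hCd⟩ := hC
  have hSG : ∀ S ∈ C, S ⊆ G := fun S hS => mem_powerset.1 (hCG hS)
  have key : ∀ S ∈ C, ∃ X : Finset V, X.card = s ∧ ∃ e ∈ S, X ⊆ e := by
    intro S hS
    have : S.Nonempty := by rw [← card_pos, hcard S (hSG S hS) (hCP S hS)]; exact hc
    obtain ⟨e, he⟩ := this
    obtain ⟨X, hX, hXc⟩ := exists_subset_card_eq (hs e (hSG S hS he))
    exact ⟨X, hXc, e, he, hX⟩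
  choose! X hXc hX using key
  have hCcard : C.card ≤ (Fintype.card V).choose s := by
    rw [← card_univ, ← card_powersetCard]
    refine card_le_card_of_injOn X (fun S hS => by simp [mem_powersetCard, hXc S hS]) ?_
    intro S hS S' hS' h
    by_contra hne
    obtain ⟨e, he, hXe⟩ := hX S hS
    obtain ⟨e', he', hXe'⟩ := hX S' hS'
    have h1 := hP S (hSG S hS) S' (hSG S' hS') (hCP S hS) (hCP S' hS') (hCd S hS S' hS' hne)
      e he e' he'
    have h2 : X S ⊆ e ∩ e' := subset_inter hXe (by rw [h]; exact hXe')
    have h3 := card_le_card h2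
    rw [hXc S hS] at h3
    omega
  refine ⟨G \ C.biUnion id, sdiff_subset, ?_, ?_⟩
  · have h1 : (C.biUnion id).card ≤ C.card * c :=
      card_biUnion_le_card_mul _ _ _ (fun S hS => (hcard S (hSG S hS) (hCP S hS)).le)
    have h2 := le_card_sdiff (C.biUnion id) G
    have h3 : C.card * c ≤ c * (Fintype.card V).choose s := by
      rw [mul_comm]; exact Nat.mul_le_mul_left _ hCcard
    omega
  · intro S hS hPS
    have hSG' : S ⊆ G := hS.trans sdiff_subset
    have hdis : ∀ S' ∈ C, Disjoint S S' := by
      intro S' hS'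
      rw [disjoint_left]
      intro e he he'
      have := hS he
      simp only [Finset.mem_sdiff, mem_biUnion, id, not_exists, not_and] at this
      exact this.2 S' hS' he'
    have hnot : S ∉ C := by
      intro h
      have := hdis S h
      rw [disjoint_self] at this
      have h0 := hcard S hSG' hPS
      rw [this] at h0
      simp at h0
      omega
    have hin : insert S C ∈ F := by
      simp only [F, mem_filter, mem_powerset]
      refine ⟨?_, ?_, ?_⟩
      · intro S' hS'
        rcases mem_insert.1 hS' with rfl | h
        · exact mem_powerset.2 hSG'
        · exact hCG h
      · intro S' hS'
        rcases mem_insert.1 hS' with rfl | h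
        · exact hPS
        · exact hCP _ h
      · intro S₁ h₁ S₂ h₂ hne
        rcases mem_insert.1 h₁ with e₁ | h₁ <;> rcases mem_insert.1 h₂ with e₂ | h₂
        · exact absurd (e₁.trans e₂.symm) hne
        · rw [e₁]; exact hdis _ h₂
        · rw [e₂]; exact (hdis _ h₁).symm
        · exact hCd _ h₁ _ h₂ hne
    have := hmax _ hin
    rw [card_insert_of_notMem hnot] at this
    omega

/-- Two `t`-sets crossing between the sides of a pair of edges which meet in `t` vertices. -/
theorem exists_two_crossing (t d : ℕ) (ht : 2 ≤ t) (hd : 1 ≤ d) (hr : 4 ≤ t + d)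
    (e f : Finset V) (he : e.card = t + d) (hf : f.card = t + d) (hef : (e ∩ f).card = t) :
    ∃ X Y : Finset V, X ≠ Y ∧ ∀ Z, Z = X ∨ Z = Y → Z.card = t ∧ Z ⊆ e ∪ f ∧
      (Z ∩ (e \ f)).Nonempty ∧ (Z ∩ (f \ e)).Nonempty := by
  have hA : (e \ f).card = d := by
    have := card_sdiff_add_card_inter e f; omega
  have hB : (f \ e).card = d := by
    have := card_sdiff_add_card_inter f e; rw [inter_comm] at this; omega
  obtain ⟨a, ha⟩ : (e \ f).Nonempty := by rw [← card_pos]; omega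
  obtain ⟨b, hb⟩ : (f \ e).Nonempty := by rw [← card_pos]; omega
  simp only [Finset.mem_sdiff] at ha hb
  have hab : a ≠ b := by rintro rfl; exact ha.2 hb.1
  by_cases ht3 : 3 ≤ t
  · have hI : t - 2 < (e ∩ f).card := by omega
    obtain ⟨I₀, hI₀, hI₀c⟩ := exists_subset_card_eq (show t - 1 ≤ (e ∩ f).card by omega)
    obtain ⟨x, hx, y, hy, hxy⟩ := one_lt_card.1 (show 1 < I₀.card by omega)
    have hsub : ∀ z ∈ I₀, z ∈ e ∧ z ∈ f := fun z hz => mem_inter.1 (hI₀ hz)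
    have hgen : ∀ z ∈ I₀, (insert a (insert b (I₀.erase z))).card = t ∧
        insert a (insert b (I₀.erase z)) ⊆ e ∪ f ∧
        (insert a (insert b (I₀.erase z)) ∩ (e \ f)).Nonempty ∧
        (insert a (insert b (I₀.erase z)) ∩ (f \ e)).Nonempty := by
      intro z hz
      refine ⟨?_, ?_, ⟨a, by simp [ha]⟩, ⟨b, by simp [hb]⟩⟩
      · rw [card_insert_of_notMem, card_insert_of_notMem, card_erase_of_mem hz]
        · omega
        · intro h; exact hb.2 (hsub b (mem_of_mem_erase h)).1
        · intro h
          rcases mem_insert.1 h with h | h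
          · exact hab h
          · exact ha.2 (hsub a (mem_of_mem_erase h)).2
      · intro w hw
        simp only [mem_insert] at hw
        rcases hw with rfl | rfl | hw
        · simp [ha]
        · simp [hb]
        · exact mem_union_left _ (hsub w (mem_of_mem_erase hw)).1
    refine ⟨insert a (insert b (I₀.erase x)), insert a (insert b (I₀.erase y)), ?_, ?_⟩
    · intro h
      have hyx : y ∈ insert a (insert b (I₀.erase x)) := by simp [hy, hxy.symm]
      rw [h] at hyx
      simp only [mem_insert, mem_erase, ne_eq, not_true_eq_false, false_and, or_false] at hyx
      rcases hyx with rfl | rfl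
      · exact ha.2 (hsub _ hy).2
      · exact hb.2 (hsub _ hy).1
    · rintro Z (rfl | rfl)
      · exact hgen x hx
      · exact hgen y hy
  · have ht2 : t = 2 := by omega
    obtain ⟨b', hb', hbb⟩ := exists_mem_ne (show 1 < (f \ e).card by omega) b
    simp only [Finset.mem_sdiff] at hb'
    have hab' : a ≠ b' := by rintro rfl; exact ha.2 hb'.1
    have hgen : ∀ z, z ∈ f ∧ z ∉ e → (({a, z} : Finset V)).card = t ∧ ({a, z} : Finset V) ⊆ e ∪ f ∧
        (({a, z} : Finset V) ∩ (e \ f)).Nonempty ∧ (({a, z} : Finset V) ∩ (f \ e)).Nonempty := by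
      intro z hz
      have haz : a ≠ z := by rintro rfl; exact ha.2 hz.1
      refine ⟨by rw [card_pair haz, ht2], ?_, ⟨a, by simp [ha]⟩, ⟨z, by simp [hz]⟩⟩
      intro w hw
      simp only [mem_insert, mem_singleton] at hw
      rcases hw with rfl | rfl
      · simp [ha]
      · simp [hz]
    refine ⟨{a, b}, {a, b'}, ?_, ?_⟩
    · intro h
      have : b ∈ ({a, b'} : Finset V) := by rw [← h]; simp
      simp only [mem_insert, mem_singleton] at this
      rcases this with h | h
      · exact hab h.symm
      · exact hbb h.symm
    · rintro Z (rfl | rfl)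
      · exact hgen b hb
      · exact hgen b' hb'

theorem card_union_three_le (e f g : Finset V) (a b c : ℕ) (hef : (e ∪ f).card ≤ a)
    (hg : g.card = b) (h : c ≤ (g ∩ (e ∪ f)).card) : (e ∪ f ∪ g).card + c ≤ a + b := by
  have := card_union_add_card_inter (e ∪ f) g
  rw [inter_comm] at this
  omega

set_option maxHeartbeats 1000000 in
/-- The number of edges of a `(t+4d,4)`-free `(t+d)`-graph in which pairs of edges meet in at most
`t` vertices and triples of edges span at least `t+3d` vertices. -/
theorem card_mul_choose_le_of_sparse [Fintype V] (t d : ℕ) (ht : 2 ≤ t) (hd : 1 ≤ d)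
    (hr : 4 ≤ t + d) (G : Finset (Finset V)) (hG : ∀ e ∈ G, e.card = t + d)
    (hfree : IsFree G (t + 4 * d) 4)
    (h2 : ∀ e ∈ G, ∀ f ∈ G, e ≠ f → (e ∩ f).card ≤ t)
    (h3 : ∀ e ∈ G, ∀ f ∈ G, ∀ g ∈ G, e ≠ f → e ≠ g → f ≠ g → t + 3 * d ≤ (e ∪ f ∪ g).card) :
    G.card * (t + d).choose t ≤ (Fintype.card V).choose t := by
  classical
  have h4 : ∀ e ∈ G, ∀ f ∈ G, ∀ g ∈ G, ∀ k ∈ G, e ≠ f → e ≠ g → e ≠ k → f ≠ g → f ≠ k → g ≠ k →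
      t + 4 * d < (e ∪ f ∪ (g ∪ k)).card := by
    intro e he f hf g hg k hk h1 h2 h3 h4 h5 h6
    by_contra hcon
    refine hfree ⟨{e, f, g, k}, ?_, ?_, ?_⟩
    · intro x hx
      simp only [mem_insert, mem_singleton] at hx
      rcases hx with rfl | rfl | rfl | rfl <;> assumption
    · rw [card_insert_of_notMem, card_insert_of_notMem, card_pair h6] <;> simp [*]
    · have : (({e, f, g, k} : Finset (Finset V)).sup id) = e ∪ f ∪ (g ∪ k) := by
        simp [union_assoc]
      rw [this]; omega
  have hun : ∀ e ∈ G, ∀ f ∈ G, (e ∩ f).card = t → (e ∪ f).card = t + 2 * d := by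
    intro e he f hf h
    have := card_union_add_card_inter e f
    rw [hG e he, hG f hf, h] at this; omega
  let 𝒯 : Finset (Finset V) := powersetCard t univ
  let deg : Finset V → ℕ := fun T => (G.filter (fun e => T ⊆ e)).card
  let U : Finset (Finset V) := 𝒯.filter (fun T => ∀ e ∈ G, ¬ T ⊆ e)
  let prs : Finset (Finset V × Finset V) := (G ×ˢ G).filter
    (fun p => p.1 ≠ p.2 ∧ (p.1 ∩ p.2).card = t)
  let cross : Finset V × Finset V → Finset V → Prop := fun p Z =>
    Z.card = t ∧ Z ⊆ p.1 ∪ p.2 ∧ (Z ∩ (p.1 \ p.2)).Nonempty ∧ (Z ∩ (p.2 \ p.1)).Nonempty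
  have claim1 : ∀ p ∈ prs, ∃ Z ∈ U, cross p Z := by
    rintro ⟨e, f⟩ hp
    simp only [prs, mem_filter, mem_product] at hp
    obtain ⟨⟨he, hf⟩, hne, hef⟩ := hp
    obtain ⟨X, Y, hXY, hZ⟩ := exists_two_crossing t d ht hd hr e f (hG e he) (hG f hf) hef
    by_contra hcon
    push Not at hcon
    have hcov : ∀ Z, Z = X ∨ Z = Y → ∃ g ∈ G, Z ⊆ g ∧ g ≠ e ∧ g ≠ f := by
      intro Z h
      have hz := hZ Z h
      have hnU : Z ∉ U := fun hU => hcon Z hU hz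
      simp only [U, 𝒯, mem_filter, mem_powersetCard_univ, hz.1, true_and, not_forall,
        not_not] at hnU
      obtain ⟨g, hg, hZg⟩ := hnU
      refine ⟨g, hg, hZg, ?_, ?_⟩
      · rintro rfl
        obtain ⟨x, hx⟩ := hz.2.2.2
        simp only [mem_inter, Finset.mem_sdiff] at hx
        exact hx.2.2 (hZg hx.1)
      · rintro rfl
        obtain ⟨x, hx⟩ := hz.2.2.1
        simp only [mem_inter, Finset.mem_sdiff] at hx
        exact hx.2.2 (hZg hx.1)
    obtain ⟨g, hg, hXg, hge, hgf⟩ := hcov X (Or.inl rfl)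
    obtain ⟨k, hk, hYk, hke, hkf⟩ := hcov Y (Or.inr rfl)
    have hX := hZ X (Or.inl rfl)
    have hY := hZ Y (Or.inr rfl)
    have hu := hun e he f hf hef
    have hgX : X ⊆ g ∩ (e ∪ f) := subset_inter hXg hX.2.1
    have hkY : Y ⊆ k ∩ (e ∪ f) := subset_inter hYk hY.2.1
    have hgk : g = k := by
      by_contra hgk
      have := h4 e he f hf g hg k hk hne hge.symm hke.symm hgf.symm hkf.symm hgk
      have a1 := card_union_three_le e f g _ _ t hu.le (hG g hg)
        (by have := card_le_card hgX; omega)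
      have a2 := card_union_three_le (e ∪ f) g k _ _ t le_rfl (hG k hk) (by
        have := card_le_card hkY
        have := card_le_card (inter_subset_inter_left (s := k) (subset_union_left : e ∪ f ⊆ e ∪ f ∪ g))
        omega)
      rw [← union_assoc] at this
      omega
    subst hgk
    have hlt : t < (g ∩ (e ∪ f)).card := by
      have h1 : X ∪ Y ⊆ g ∩ (e ∪ f) := union_subset hgX hkY
      have h2 : X.card < (X ∪ Y).card := by
        apply card_lt_card
        refine ssubset_of_subset_of_ne subset_union_left ?_
        intro h
        have : Y ⊆ X := by rw [h]; exact subset_union_right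
        exact hXY (eq_of_subset_of_card_le this (by omega)).symm
      have := card_le_card h1
      omega
    have b1 := h3 e he f hf g hg hne hge.symm hgf.symm
    have b2 := card_union_three_le e f g _ _ (t + 1) hu.le (hG g hg) hlt
    omega
  have claim2 : ∀ p ∈ prs, ∀ q ∈ prs, ∀ Z, cross p Z → cross q Z →
      q = p ∨ q = p.swap := by
    rintro ⟨e, f⟩ hp ⟨e', f'⟩ hq Z hZp hZq
    simp only [prs, mem_filter, mem_product] at hp hq
    obtain ⟨⟨he, hf⟩, hne, hef⟩ := hp
    obtain ⟨⟨he', hf'⟩, hne', hef'⟩ := hq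
    have hshare : ∀ a ∈ G, ∀ b ∈ G, ∀ c ∈ G, a ≠ b → b ≠ c → a ≠ c →
        (a ∩ b).card = t → (b ∩ c).card = t → Z ⊆ b ∪ c → (Z ∩ (a \ b)).Nonempty → False := by
      intro a ha b hb c hc hab hbc hac h1 h2 hZ hn
      obtain ⟨x, hx⟩ := hn
      simp only [mem_inter, Finset.mem_sdiff] at hx
      have hxc : x ∈ c := by
        have := hZ hx.1
        rw [mem_union] at this
        tauto
      have hlt : t < (c ∩ (a ∪ b)).card := by
        have : insert x (b ∩ c) ⊆ c ∩ (a ∪ b) := by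
          intro y hy
          simp only [mem_insert, mem_inter, mem_union] at hy ⊢
          rcases hy with rfl | hy
          · exact ⟨hxc, Or.inl hx.2.1⟩
          · exact ⟨hy.2, Or.inr hy.1⟩
        have h5 := card_le_card this
        rw [card_insert_of_notMem (by simp [hx.2.2])] at h5
        omega
      have b1 := h3 a ha b hb c hc hab hac hbc
      have b2 := card_union_three_le a b c _ _ (t + 1) (hun a ha b hb h1).le (hG c hc) hlt
      omega
    simp only [cross] at hZp hZq
    by_contra hcon
    simp only [Prod.mk.injEq, Prod.swap_prod_mk, not_or] at hcon
    by_cases c1 : e' = e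
    · subst c1
      have hff : f ≠ f' := fun h => hcon.1 ⟨rfl, h.symm⟩
      exact hshare f hf e' he f' hf' hne.symm hne' hff (by rw [inter_comm]; exact hef) hef'
        hZq.2.1 hZp.2.2.2
    by_cases c2 : e' = f
    · subst c2
      have hff : e ≠ f' := fun h => hcon.2 ⟨rfl, h.symm⟩
      exact hshare e he e' he' f' hf' hne hne' hff hef hef' hZq.2.1 hZp.2.2.1
    by_cases c3 : f' = e
    · subst c3
      exact hshare f hf f' he e' he' hne.symm hne'.symm (fun h => c2 h.symm)
        (by rw [inter_comm]; exact hef) (by rw [inter_comm]; exact hef')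
        (by rw [union_comm]; exact hZq.2.1) hZp.2.2.2
    by_cases c4 : f' = f
    · subst c4
      exact hshare e he f' hf e' he' hne hne'.symm (fun h => c1 h.symm)
        hef (by rw [inter_comm]; exact hef')
        (by rw [union_comm]; exact hZq.2.1) hZp.2.2.1
    have := h4 e he f hf e' he' f' hf' hne (fun h => c1 h.symm) (fun h => c3 h.symm)
      (fun h => c2 h.symm) (fun h => c4 h.symm) hne'
    have a1 := hun e he f hf hef
    have a2 := hun e' he' f' hf' hef'
    have a3 := card_union_add_card_inter (e ∪ f) (e' ∪ f')
    have a4 : Z ⊆ (e ∪ f) ∩ (e' ∪ f') := subset_inter hZp.2.1 hZq.2.1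
    have a5 := card_le_card a4
    omega
  have hPU : prs.card ≤ 2 * U.card := by
    choose! φ hφU hφ using claim1
    refine card_le_mul_card_image_of_maps_to (f := φ) hφU 2 ?_
    intro Z hZ
    by_cases hne : (prs.filter (fun p => φ p = Z)).Nonempty
    · obtain ⟨p, hp⟩ := hne
      rw [mem_filter] at hp
      have : prs.filter (fun p => φ p = Z) ⊆ {p, p.swap} := by
        intro q hq
        rw [mem_filter] at hq
        have h1 := hφ p hp.1
        have h2 := hφ q hq.1
        rw [hp.2] at h1
        rw [hq.2] at h2
        simpa using claim2 p hp.1 q hq.1 Z h1 h2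
      exact (card_le_card this).trans card_le_two
    · rw [not_nonempty_iff_eq_empty] at hne
      rw [hne]; simp
  have hdeg : ∑ T ∈ 𝒯, deg T = G.card * (t + d).choose t := by
    have : ∑ T ∈ 𝒯, deg T = ∑ e ∈ G, (𝒯.filter (fun T => T ⊆ e)).card := by
      simp only [deg]
      exact sum_card_bipartiteAbove_eq_sum_card_bipartiteBelow
        (fun (T : Finset V) (e : Finset V) => T ⊆ e)
    rw [this, card_eq_sum_ones, sum_mul]
    refine sum_congr rfl fun e he => ?_
    rw [one_mul, ← hG e he, ← card_powersetCard]
    congr 1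
    ext T
    simp only [𝒯, mem_filter, mem_powersetCard, subset_univ, true_and]
    tauto
  have hpairs : ∑ T ∈ 𝒯, deg T * (deg T - 1) ≤ prs.card := by
    have e1 : ∀ T ∈ 𝒯, deg T * (deg T - 1) =
        (prs.filter (fun p => T ⊆ p.1 ∧ T ⊆ p.2)).card := by
      intro T hT
      have hTc : T.card = t := by simpa [𝒯] using hT
      have := offDiag_card (G.filter (fun e => T ⊆ e))
      rw [Nat.mul_sub, mul_one, ← this]
      congr 1
      ext ⟨e, f⟩
      simp only [mem_offDiag, mem_filter, prs, mem_product, ne_eq]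
      constructor
      · rintro ⟨⟨he, hTe⟩, ⟨hf, hTf⟩, hne⟩
        refine ⟨⟨⟨he, hf⟩, hne, le_antisymm (h2 e he f hf hne) ?_⟩, hTe, hTf⟩
        rw [← hTc]; exact card_le_card (subset_inter hTe hTf)
      · tauto
    rw [sum_congr rfl e1]
    have : ∑ T ∈ 𝒯, (prs.filter (fun p => T ⊆ p.1 ∧ T ⊆ p.2)).card =
        ∑ p ∈ prs, (𝒯.filter (fun T => T ⊆ p.1 ∧ T ⊆ p.2)).card :=
      sum_card_bipartiteAbove_eq_sum_card_bipartiteBelow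
        (fun T (p : Finset V × Finset V) => T ⊆ p.1 ∧ T ⊆ p.2)
    rw [this, card_eq_sum_ones]
    refine sum_le_sum fun p hp => ?_
    simp only [prs, mem_filter, mem_product] at hp
    have : 𝒯.filter (fun T => T ⊆ p.1 ∧ T ⊆ p.2) ⊆ {p.1 ∩ p.2} := by
      intro T hT
      simp only [𝒯, mem_filter, mem_powersetCard_univ] at hT
      rw [mem_singleton]
      exact eq_of_subset_of_card_le (subset_inter hT.2.1 hT.2.2) (by omega)
    exact (card_le_card this).trans (by simp)
  have hU : U.card + (𝒯.filter (fun T => deg T ≠ 0)).card = (Fintype.card V).choose t := by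
    have : U = 𝒯.filter (fun T => ¬ deg T ≠ 0) := by
      ext T
      simp only [U, mem_filter, deg, not_not, card_eq_zero, filter_eq_empty_iff]
    rw [this, add_comm, card_filter_add_card_filter_not]
    simp [𝒯]
  have hfin : 2 * ∑ T ∈ 𝒯, deg T ≤ 2 * (𝒯.filter (fun T => deg T ≠ 0)).card +
      ∑ T ∈ 𝒯, deg T * (deg T - 1) := by
    rw [card_filter, mul_sum, mul_sum, ← sum_add_distrib]
    refine sum_le_sum fun T _ => ?_
    rcases deg T with _ | _ | k
    · simp
    · simp
    · simp; nlinarith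
  rw [← hdeg, ← hU]
  omega

theorem card_mul_choose_le [Fintype V] (t d : ℕ) (ht : 2 ≤ t) (hd : 1 ≤ d)
    (hr : 4 ≤ t + d) (G : Finset (Finset V)) (hG : ∀ e ∈ G, e.card = t + d)
    (hfree : IsFree G (t + 4 * d) 4) :
    G.card * (t + d).choose t ≤
      (Fintype.card V).choose t + 5 * (Fintype.card V).choose (t - 1) * (t + d).choose t := by
  classical
  have hmono : ∀ H ⊆ G, IsFree H (t + 4 * d) 4 := by
    intro H hH ⟨S, hS, h⟩
    exact hfree ⟨S, hS.trans hH, h⟩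
  have hsub : ∀ S : Finset (Finset V), ∀ e ∈ S, e ⊆ S.sup id := fun S e he => le_sup (f := id) he
  obtain ⟨H, hHG, hHc, hH⟩ := exists_subset_avoiding G
    (fun S => S.card = 3 ∧ (S.sup id).card + 1 ≤ t + 3 * d) 3 (t - 1) (fun S _ h => h.1)
    (by norm_num) (fun e he => by rw [hG e he]; omega) (by
      rintro S hS S' hS' ⟨hS3, hSc⟩ - hdis e he e' he'
      have hn : e' ∉ S := fun h => disjoint_left.1 hdis h he'
      by_contra hcon
      refine hfree ⟨insert e' S, insert_subset (hS' he') hS, by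
        rw [card_insert_of_notMem hn, hS3], ?_⟩
      rw [sup_insert, id, sup_eq_union]
      have h1 := card_union_add_card_inter e' (S.sup id)
      have h2 : (e ∩ e').card ≤ (e' ∩ S.sup id).card := by
        rw [inter_comm]; exact card_le_card (inter_subset_inter_left (hsub S e he))
      have h3 := hG e' (hS' he')
      omega)
  obtain ⟨K, hKH, hKc, hK⟩ := exists_subset_avoiding H
    (fun S => S.card = 2 ∧ (S.sup id).card + 1 ≤ t + 2 * d) 2 (t - 1) (fun S _ h => h.1)
    (by norm_num) (fun e he => by rw [hG e (hHG he)]; omega) (by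
      rintro S hS S' hS' ⟨hS2, hSc⟩ ⟨hS2', hSc'⟩ hdis e he e' he'
      by_contra hcon
      refine hfree ⟨S ∪ S', union_subset (hS.trans hHG) (hS'.trans hHG), by
        rw [card_union_of_disjoint hdis, hS2, hS2'], ?_⟩
      rw [sup_union, sup_eq_union]
      have h1 := card_union_add_card_inter (S.sup id) (S'.sup id)
      have h2 : (e ∩ e').card ≤ (S.sup id ∩ S'.sup id).card :=
        card_le_card (inter_subset_inter (hsub S e he) (hsub S' e' he'))
      omega)
  have hKG := hKH.trans hHG
  have hmain := card_mul_choose_le_of_sparse t d ht hd hr K (fun e he => hG e (hKG he))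
    (hmono K hKG) (by
      intro e he f hf hne
      by_contra hcon
      refine hK {e, f} (by intro x hx; simp at hx; rcases hx with rfl | rfl <;> assumption)
        ⟨card_pair hne, ?_⟩
      have h1 := card_union_add_card_inter e f
      rw [hG e (hKG he), hG f (hKG hf)] at h1
      simp only [sup_insert, sup_singleton, id, sup_eq_union]
      omega) (by
      intro e he f hf g hg h1 h2 h3
      by_contra hcon
      refine hH {e, f, g} (by
        intro x hx; simp at hx; rcases hx with rfl | rfl | rfl <;> exact hKH (by assumption)) ⟨?_, ?_⟩
      · rw [card_insert_of_notMem (by simp [h1, h2]), card_pair h3]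
      · simp only [sup_insert, sup_singleton, id, sup_eq_union]
        rw [← union_assoc]
        omega)
  have hG5 : G.card ≤ K.card + 5 * (Fintype.card V).choose (t - 1) := by omega
  calc G.card * (t + d).choose t
      ≤ (K.card + 5 * (Fintype.card V).choose (t - 1)) * (t + d).choose t :=
        Nat.mul_le_mul_right _ hG5
    _ ≤ _ := by rw [add_mul]; omega

end UpperBound

section Configurations

variable {V : Type*} [DecidableEq V]

/-- The set of vertices spanned by a family of edges. -/
def verts (S : Finset (Finset V)) : Finset V := S.sup id

theorem mem_verts {S : Finset (Finset V)} {x : V} : x ∈ verts S ↔ ∃ e ∈ S, x ∈ e := by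
  simp [verts, Finset.mem_sup]

theorem verts_union (S S' : Finset (Finset V)) : verts (S ∪ S') = verts S ∪ verts S' :=
  sup_union

theorem verts_mono {S S' : Finset (Finset V)} (h : S ⊆ S') : verts S ⊆ verts S' :=
  sup_mono h

theorem subset_verts {S : Finset (Finset V)} {e : Finset V} (h : e ∈ S) : e ⊆ verts S :=
  le_sup (f := id) h

theorem verts_singleton (e : Finset V) : verts {e} = e := sup_singleton

theorem verts_insert (e : Finset V) (S : Finset (Finset V)) :
    verts (insert e S) = e ∪ verts S := sup_insert

/-- A family of two to four edges spanning few vertices. -/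
def Conf (t d : ℕ) (S : Finset (Finset V)) : Prop :=
  (∀ e ∈ S, e.card = t + d) ∧ 2 ≤ S.card ∧ S.card ≤ 4 ∧ (verts S).card ≤ d * S.card + t

/-- A minimal configuration. -/
def MConf (t d : ℕ) (S : Finset (Finset V)) : Prop :=
  Conf t d S ∧ ∀ B, B ⊂ S → ¬ Conf t d B

/-- The number of vertices spanned by a proper nonempty subfamily of a minimal configuration. -/
def Sparse (t d : ℕ) (B : Finset (Finset V)) : Prop :=
  d * B.card + t ≤ (verts B).card ∧ (2 ≤ B.card → d * B.card + t + 1 ≤ (verts B).card)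

variable {t d : ℕ}

theorem sparse_singleton {e : Finset V} (he : e.card = t + d) : Sparse t d {e} := by
  constructor
  · rw [verts_singleton, card_singleton]; omega
  · intro h; simp at h

theorem MConf.sparse {S B : Finset (Finset V)} (hS : MConf t d S) (hB : B ⊂ S)
    (hne : B.Nonempty) : Sparse t d B := by
  have hc : ∀ e ∈ B, e.card = t + d := fun e he => hS.1.1 e (hB.1 he)
  have h2 : 2 ≤ B.card → d * B.card + t + 1 ≤ (verts B).card := by
    intro h
    by_contra hcon
    refine hS.2 B hB ⟨hc, h, ?_, by omega⟩
    have := card_lt_card hB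
    have := hS.1.2.2.1
    omega
  refine ⟨?_, h2⟩
  by_cases h : 2 ≤ B.card
  · have := h2 h; omega
  · have h1 : B.card = 1 := by
      have := hne.card_pos; omega
    obtain ⟨e, rfl⟩ := card_eq_one.1 h1
    exact (sparse_singleton (hc e (mem_singleton_self e))).1

theorem exists_mconf_subset {S : Finset (Finset V)} (hS : Conf t d S) :
    ∃ B ⊆ S, MConf t d B := by
  induction S using Finset.strongInduction with
  | H S ih =>
    by_cases h : ∃ B, B ⊂ S ∧ Conf t d B
    · obtain ⟨B, hB, hC⟩ := h
      obtain ⟨B', hB', hM⟩ := ih B hB hC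
      exact ⟨B', hB'.trans hB.1, hM⟩
    · push Not at h
      exact ⟨S, Subset.rfl, hS, h⟩

/-- No few edges of `R` are dense relative to the vertex set `W`. -/
def Good (t d : ℕ) (W : Finset V) (b : ℕ) (R : Set (Finset V)) : Prop :=
  ∀ F : Finset (Finset V), (∀ f ∈ F, f ∈ R ∧ f.card = t + d) → F.Nonempty → F.card ≤ b →
    d * F.card ≤ (verts F \ W).card

theorem Good.mono {W : Finset V} {b : ℕ} {R R' : Set (Finset V)} (h : Good t d W b R)
    (hR : R' ⊆ R) : Good t d W b R' :=
  fun F hF => h F fun f hf => ⟨hR (hF f hf).1, (hF f hf).2⟩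

/-- The families of edges reached from a starting family by successively adding minimal
configurations contained in `R`. -/
inductive Gen (t d : ℕ) (R : Set (Finset V)) (St : Finset (Finset V) → Prop) :
    ℕ → Finset (Finset V) → Prop
  | start (F : Finset (Finset V)) : St F → Gen t d R St 0 F
  | step (l : ℕ) (F S : Finset (Finset V)) : Gen t d R St l F → MConf t d S → (∀ f ∈ S, f ∈ R) →
      (S ∩ F).Nonempty → Gen t d R St (l + 1) (F ∪ S)

/-- Admissible starting families attached to the vertex set `ρ`. -/
structure IsStart (t d : ℕ) (R : Set (Finset V)) (ρ : Finset V) (F : Finset (Finset V)) :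
    Prop where
  mem : ∀ f ∈ F, f ∈ R ∧ f.card = t + d
  nonempty : F.Nonempty
  card_le : F.card ≤ 3
  sparse : ∀ B ⊆ F, B.Nonempty → Sparse t d B
  card_verts : (verts F \ ρ).card ≤ d * F.card

/-- Families which span as few vertices outside `W` as possible. -/
structure Tight (t d : ℕ) (W : Finset V) (R : Set (Finset V)) (F : Finset (Finset V)) :
    Prop where
  mem : ∀ f ∈ F, f ∈ R ∧ f.card = t + d
  nonempty : F.Nonempty
  card_verts : (verts F \ W).card = d * F.card

variable {W ρ : Finset V} {b : ℕ} {R : Set (Finset V)}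

theorem Tight.inter {F I : Finset (Finset V)} (hG : Good t d W b R) (hF : Tight t d W R F)
    (hI : Tight t d W R I) (hb : F.card + I.card ≤ b) (hne : (F ∩ I).Nonempty) :
    Tight t d W R (F ∩ I) := by
  refine ⟨fun f hf => hF.mem f (mem_inter.1 hf).1, hne, le_antisymm ?_ ?_⟩
  · have h1 := hG (F ∪ I) (fun f hf => (mem_union.1 hf).elim (hF.mem f) (hI.mem f))
      (hF.nonempty.mono subset_union_left) ((card_union_le _ _).trans hb)
    have h2 := card_union_add_card_inter (verts F \ W) (verts I \ W)
    have h3 : verts (F ∪ I) \ W = (verts F \ W) ∪ (verts I \ W) := by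
      rw [verts_union, union_sdiff_distrib]
    have h4 : verts (F ∩ I) \ W ⊆ (verts F \ W) ∩ (verts I \ W) :=
      subset_inter (sdiff_subset_sdiff (verts_mono inter_subset_left) Subset.rfl)
        (sdiff_subset_sdiff (verts_mono inter_subset_right) Subset.rfl)
    have h5 := card_le_card h4
    have h6 := card_union_add_card_inter F I
    rw [h3] at h1
    rw [hF.card_verts, hI.card_verts, ← mul_add, ← h6, mul_add] at h2
    omega
  · exact hG _ (fun f hf => hF.mem f (mem_inter.1 hf).1) hne
      ((card_le_card inter_subset_left).trans (by omega))

theorem Tight.le_card_inter {B : Finset (Finset V)} (hB : Tight t d W R B)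
    (hs : Sparse t d B) :
    t ≤ (verts B ∩ W).card ∧ (2 ≤ B.card → t + 1 ≤ (verts B ∩ W).card) := by
  have h1 := card_sdiff_add_card_inter (verts B) W
  have h2 := hB.card_verts
  have h3 := hs.1
  refine ⟨by omega, fun h => ?_⟩
  have h4 := hs.2 h
  omega

theorem IsStart.tight {F : Finset (Finset V)} (hG : Good t d W b R) (hρ : ρ ⊆ W)
    (hb : 3 ≤ b) (hF : IsStart t d R ρ F) : Tight t d W R F ∧ verts F ∩ W ⊆ ρ := by
  have h1 := hG F hF.mem hF.nonempty (hF.card_le.trans hb)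
  have h2 : verts F \ W ⊆ verts F \ ρ := sdiff_subset_sdiff Subset.rfl hρ
  have h3 := hF.card_verts
  have h4 := card_le_card h2
  refine ⟨⟨hF.mem, hF.nonempty, by omega⟩, ?_⟩
  have h5 := eq_of_subset_of_card_le h2 (by omega)
  intro x hx
  rw [mem_inter] at hx
  by_contra hcon
  have : x ∈ verts F \ W := by rw [h5]; exact Finset.mem_sdiff.2 ⟨hx.1, hcon⟩
  exact (Finset.mem_sdiff.1 this).2 hx.2

/-- The step of adding a minimal configuration meeting a tight family. -/
theorem Tight.union {F S : Finset (Finset V)} (hG : Good t d W b R) (hF : Tight t d W R F)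
    (hS : MConf t d S) (hSR : ∀ f ∈ S, f ∈ R) (hne : (S ∩ F).Nonempty) (hb : F.card + 3 ≤ b) :
    Tight t d W R (F ∪ S) ∧ (F ∪ S).card ≤ F.card + 3 ∧ verts (F ∪ S) ∩ W ⊆ verts F ∩ W := by
  have hmem : ∀ f ∈ F ∪ S, f ∈ R ∧ f.card = t + d := fun f hf =>
    (mem_union.1 hf).elim (hF.mem f) (fun h => ⟨hSR f h, hS.1.1 f h⟩)
  have hc1 : (F ∪ S).card + (S ∩ F).card = F.card + S.card := by
    rw [inter_comm]; exact card_union_add_card_inter F S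
  have hc2 := hne.card_pos
  have hc3 := hS.1.2.2.1
  by_cases hSF : S ⊆ F
  · have : F ∪ S = F := union_eq_left.2 hSF
    rw [this]
    exact ⟨hF, by omega, Subset.rfl⟩
  have hss : S ∩ F ⊂ S := by
    refine ssubset_of_subset_of_ne inter_subset_left fun h => hSF (inter_eq_left.1 h)
  have hsp := (hS.sparse hss hne).1
  have h1 := hG (F ∪ S) hmem (hF.nonempty.mono subset_union_left) (by omega)
  have hvs : verts (S ∩ F) ⊆ verts S := verts_mono inter_subset_left
  have hvF : verts (S ∩ F) ⊆ verts F := verts_mono inter_subset_right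
  have h2 := hS.1.2.2.2
  have h3 : (verts S \ verts F).card + (verts S ∩ verts F).card = (verts S).card :=
    card_sdiff_add_card_inter _ _
  have h4 : (verts (F ∪ S) \ W) ⊆ (verts F \ W) ∪ ((verts S \ verts F) \ W) := by
    intro x hx
    rw [verts_union] at hx
    simp only [Finset.mem_sdiff, mem_union] at hx ⊢
    tauto
  have h5 := (card_le_card h4).trans (card_union_le _ _)
  have h6 := hF.card_verts
  have h7 : (verts (S ∩ F)).card ≤ (verts S ∩ verts F).card :=
    card_le_card (subset_inter hvs hvF)
  have h8 := card_sdiff_add_card_inter (verts S \ verts F) W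
  have h9 : d * (F ∪ S).card + d * (S ∩ F).card = d * F.card + d * S.card := by
    rw [← mul_add, ← mul_add, hc1]
  refine ⟨⟨hmem, hF.nonempty.mono subset_union_left, by omega⟩, by omega, ?_⟩
  have h10 : ((verts S \ verts F) ∩ W).card = 0 := by omega
  rw [card_eq_zero] at h10
  intro x hx
  rw [mem_inter, verts_union, mem_union] at hx
  rw [mem_inter]
  refine ⟨?_, hx.2⟩
  by_contra hcon
  have : x ∈ (verts S \ verts F) ∩ W := by
    simp only [mem_inter, Finset.mem_sdiff]; tauto
  rw [h10] at this
  simp at this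

theorem Gen.tight {St : Finset (Finset V) → Prop} {l : ℕ} {F : Finset (Finset V)}
    (hF : Gen t d R St l F) (hG : Good t d W b R) (hρ : ρ ⊆ W)
    (hSt : ∀ F, St F → IsStart t d R ρ F) (hb : 3 * (l + 1) ≤ b) :
    Tight t d W R F ∧ F.card ≤ 3 * (l + 1) ∧ verts F ∩ W ⊆ ρ := by
  induction hF with
  | start F hF =>
    have := (hSt F hF).tight hG hρ (by omega)
    exact ⟨this.1, by have := (hSt F hF).card_le; omega, this.2⟩
  | step l F S hF hS hSR hne ih =>
    obtain ⟨h1, h2, h3⟩ := ih (by omega)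
    obtain ⟨h4, h5, h6⟩ := h1.union hG hS hSR hne (by omega)
    exact ⟨h4, by omega, h6.trans h3⟩

theorem Gen.disjoint_of {St : Finset (Finset V) → Prop} {l : ℕ} {F I : Finset (Finset V)}
    (hF : Gen t d R St l F) (hG : Good t d W b R) (hρ : ρ ⊆ W)
    (hSt : ∀ F, St F → IsStart t d R ρ F) (hI : Tight t d W R I)
    (hb : 3 * (l + 1) + I.card ≤ b)
    (hX : ∀ l' ≤ l, ∀ F, Gen t d R St l' F → ∀ B ⊆ F ∩ I, Tight t d W R B → Sparse t d B → False) :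
    Disjoint F I := by
  have hFt := hF.tight hG hρ hSt (by omega)
  rw [disjoint_iff_inter_eq_empty, ← not_nonempty_iff_eq_empty]
  intro hne
  have hT := hFt.1.inter hG hI (by omega) hne
  induction hF with
  | start F hF =>
    exact hX 0 le_rfl F (Gen.start F hF) _ Subset.rfl hT
      ((hSt F hF).sparse _ inter_subset_left hne)
  | step l F S hF hS hSR hSF ih =>
    have hFI : F ∩ I = ∅ := by
      rw [← not_nonempty_iff_eq_empty]
      intro h
      have h1 := hF.tight hG hρ hSt (by omega)
      exact ih (by omega) (fun l' hl => hX l' (by omega)) h1 h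
        (h1.1.inter hG hI (by omega) h)
    have h1 : (F ∪ S) ∩ I = S ∩ I := by rw [union_inter_distrib_right, hFI, empty_union]
    have h2 : S ∩ I ⊂ S := by
      refine ssubset_of_subset_of_ne inter_subset_left fun h => ?_
      obtain ⟨x, hx⟩ := hSF
      rw [mem_inter] at hx
      have : x ∈ F ∩ I := mem_inter.2 ⟨hx.2, inter_eq_left.1 h hx.1⟩
      rw [hFI] at this
      simp at this
    refine hX (l + 1) le_rfl _ (Gen.step l F S hF hS hSR hSF) _ Subset.rfl hT ?_
    rw [h1] at hne ⊢
    exact hS.sparse h2 hne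

/-- Families grown from roots which meet in few vertices are disjoint. -/
theorem Gen.disjoint {St St' : Finset (Finset V) → Prop} {ρ' : Finset V} {l l' : ℕ}
    {F I : Finset (Finset V)} (hF : Gen t d R St l F) (hI : Gen t d R St' l' I)
    (hG : Good t d W b R) (hρ : ρ ⊆ W) (hρ' : ρ' ⊆ W)
    (hSt : ∀ F, St F → IsStart t d R ρ F) (hSt' : ∀ F, St' F → IsStart t d R ρ' F)
    (hρρ : (ρ ∩ ρ').card < t) (hb : 3 * (l + 1) + 3 * (l' + 1) ≤ b) : Disjoint F I := by
  obtain ⟨h1, h2, h3⟩ := hI.tight hG hρ' hSt' (by omega)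
  refine hF.disjoint_of hG hρ hSt h1 (by omega) ?_
  intro k hk F hF B hB hBt hBs
  have h4 := (hF.tight hG hρ hSt (by omega)).2.2
  have h5 := (hBt.le_card_inter hBs).1
  have h6 : verts B ∩ W ⊆ ρ ∩ ρ' := by
    intro x hx
    have hx' := mem_inter.1 hx
    refine mem_inter.2 ⟨h4 (mem_inter.2 ⟨verts_mono (hB.trans inter_subset_left) hx'.1, hx'.2⟩),
      h3 (mem_inter.2 ⟨verts_mono (hB.trans inter_subset_right) hx'.1, hx'.2⟩)⟩
  have := card_le_card h6
  omega

theorem MConf.card_inter_lt {S : Finset (Finset V)} (hS : MConf t d S) (h3 : 3 ≤ S.card)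
    {e f : Finset V} (he : e ∈ S) (hf : f ∈ S) (hne : e ≠ f) : (e ∩ f).card < t := by
  have hss : ({e, f} : Finset (Finset V)) ⊂ S := by
    refine ssubset_of_subset_of_ne (by
      intro x hx
      rcases mem_insert.1 hx with rfl | hx
      · exact he
      · rw [mem_singleton.1 hx]; exact hf) fun h => ?_
    rw [← h, card_pair hne] at h3
    omega
  have h := (hS.sparse hss ⟨e, by simp⟩).2 (by rw [card_pair hne])
  rw [verts_insert, verts_singleton, card_pair hne] at h
  have := card_union_add_card_inter e f
  rw [hS.1.1 e he, hS.1.1 f hf] at this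
  omega

/-- Starting families completing the edge `e` to a minimal configuration. -/
def EdgeStart (t d : ℕ) (R : Set (Finset V)) (e : Finset V) (s : ℕ) (F : Finset (Finset V)) : Prop :=
  ∃ S, MConf t d S ∧ e ∈ S ∧ s ≤ S.card ∧ (∀ f ∈ S, f ≠ e → f ∈ R) ∧ F = S.erase e

theorem EdgeStart.isStart {e : Finset V} {s : ℕ} {F : Finset (Finset V)}
    (h : EdgeStart t d R e s F) : IsStart t d R e F := by
  obtain ⟨S, hS, he, -, hR, rfl⟩ := h
  have hc := card_erase_of_mem he
  have h2 := hS.1.2.1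
  have h4 := hS.1.2.2.1
  refine ⟨fun f hf => ?_, ?_, by omega, ?_, ?_⟩
  · have := mem_erase.1 hf
    exact ⟨hR f this.2 this.1, hS.1.1 f this.2⟩
  · rw [← card_pos]; omega
  · intro B hB hne
    exact hS.sparse (Finset.ssubset_of_subset_of_ssubset hB (erase_ssubset he)) hne
  · have h5 : (verts (S.erase e) \ e).card + e.card ≤ (verts S).card := by
      rw [← card_union_of_disjoint sdiff_disjoint]
      apply card_le_card
      exact union_subset (sdiff_subset.trans (verts_mono (erase_subset _ _))) (subset_verts he)
    have h6 := hS.1.2.2.2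
    rw [hS.1.1 e he] at h5
    obtain ⟨k, hk⟩ : ∃ k, S.card = k + 1 := ⟨S.card - 1, by omega⟩
    rw [hc, hk, Nat.add_sub_cancel]
    rw [hk, mul_add] at h6
    omega

/-- Starting families consisting of one edge which meets `e` exactly in `T`. -/
def TraceStart (t d : ℕ) (R : Set (Finset V)) (e T : Finset V) (F : Finset (Finset V)) : Prop :=
  ∃ f ∈ R, f.card = t + d ∧ f ∩ e = T ∧ F = {f}

theorem TraceStart.isStart {e T : Finset V} {F : Finset (Finset V)} (hT : T.card = t)
    (h : TraceStart t d R e T F) : IsStart t d R T F := by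
  obtain ⟨f, hfR, hf, hfe, rfl⟩ := h
  refine ⟨by simp [hfR, hf], by simp, by simp, ?_, ?_⟩
  · intro B hB hne
    rw [hne.subset_singleton_iff.1 hB]
    exact sparse_singleton hf
  · have hTf : T ⊆ f := by rw [← hfe]; exact inter_subset_left
    rw [verts_singleton, card_sdiff_of_subset hTf, card_singleton]
    omega

/-- Edges grown from larger configurations containing `e` meet `e` in fewer than `t` vertices. -/
theorem Gen.card_inter_lt {e : Finset V} {l : ℕ} {F : Finset (Finset V)}
    (hF : Gen t d R (EdgeStart t d R e 3) l F) (hG : Good t d e b R) (hb : 3 * (l + 2) ≤ b) :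
    ∀ g ∈ F, (g ∩ e).card < t := by
  induction hF with
  | start F hF =>
    obtain ⟨S, hS, he, h3, -, rfl⟩ := hF
    intro g hg
    have := mem_erase.1 hg
    exact hS.card_inter_lt h3 this.2 he this.1
  | step l F S hF hS hSR hne ih =>
    intro g hg
    by_cases hgF : g ∈ F
    · exact ih (by omega) g hgF
    have hgS : g ∈ S := (mem_union.1 hg).resolve_left hgF
    by_contra hcon
    push Not at hcon
    obtain ⟨h1, h2, h3⟩ := hF.tight (ρ := e) hG Subset.rfl (fun F h => h.isStart) (by omega)
    obtain ⟨u1, u2, u3⟩ := h1.union hG hS hSR hne (by omega)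
    have hgc := hS.1.1 g hgS
    have hg1 := hG {g} (by simpa using ⟨hSR g hgS, hgc⟩) (by simp) (by simp; omega)
    rw [verts_singleton, card_singleton, mul_one] at hg1
    have hg2 := card_sdiff_add_card_inter g e
    have hgn : g ∉ S ∩ F := fun h => hgF (mem_inter.1 h).2
    have hDS : insert g (S ∩ F) ⊆ S := insert_subset hgS inter_subset_left
    have hSc : (F ∪ S).card + (S ∩ F).card = F.card + S.card := by
      rw [inter_comm]; exact card_union_add_card_inter F S
    have hSd : d * (F ∪ S).card + d * (S ∩ F).card = d * F.card + d * S.card := by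
      rw [← mul_add, ← mul_add, hSc]
    have hDc : (insert g (S ∩ F)).card = (S ∩ F).card + 1 := card_insert_of_notMem hgn
    have hS4 := hS.1.2.2.2
    have hp := hne.card_pos
    by_cases hD : insert g (S ∩ F) = S
    · have hsub : verts F ∩ g ⊆ g ∩ e := by
        intro x hx
        rw [mem_inter] at hx
        rw [mem_inter]
        refine ⟨hx.2, ?_⟩
        by_contra hxe
        have e1 : verts (F ∪ S) \ e ⊆ (verts F \ e) ∪ (g \ e).erase x := by
          intro y hy
          rw [← hD, verts_union, verts_insert] at hy
          simp only [Finset.mem_sdiff, mem_union, mem_erase] at hy ⊢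
          by_cases hyx : y = x
          · subst hyx; exact Or.inl ⟨hx.1, hxe⟩
          · rcases hy.1 with h | h | h
            · exact Or.inl ⟨h, hy.2⟩
            · exact Or.inr ⟨hyx, h, hy.2⟩
            · exact Or.inl ⟨verts_mono inter_subset_right h, hy.2⟩
        have e2 := (card_le_card e1).trans (card_union_le _ _)
        rw [card_erase_of_mem (Finset.mem_sdiff.2 ⟨hx.2, hxe⟩), u1.card_verts, h1.card_verts] at e2
        have e3 : S.card = (S ∩ F).card + 1 := by rw [← hDc, hD]
        have e4 : (F ∪ S).card = F.card + 1 := by omega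
        rw [e4, mul_add, mul_one] at e2
        have : 0 < (g \ e).card := card_pos.2 ⟨x, Finset.mem_sdiff.2 ⟨hx.2, hxe⟩⟩
        omega
      have hss : S ∩ F ⊂ S := ssubset_of_subset_of_ne inter_subset_left
        fun h => hgn (by rw [h]; exact hgS)
      have hsp := hS.sparse hss hne
      have e3 : S.card = (S ∩ F).card + 1 := by rw [← hDc, hD]
      have e5 := card_union_add_card_inter g (verts (S ∩ F))
      rw [← verts_insert, hD, hgc] at e5
      rw [e3, mul_add, mul_one] at hS4
      have e6 : g ∩ verts (S ∩ F) ⊆ g ∩ e := by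
        intro x hx
        rw [mem_inter] at hx
        exact hsub (mem_inter.2 ⟨verts_mono inter_subset_right hx.2, hx.1⟩)
      have e7 := card_le_card e6
      have e8 := hsp.1
      have e9 : (S ∩ F).card = 1 := by
        by_contra hne1
        have := hsp.2 (by omega)
        omega
      obtain ⟨s, hs⟩ := card_eq_one.1 e9
      have hsF : s ∈ F := (mem_inter.1 (by rw [hs]; simp : s ∈ S ∩ F)).2
      have e10 := eq_of_subset_of_card_le e6 (by omega)
      have e11 : g ∩ e ⊆ s ∩ e := by
        rw [← e10, hs, verts_singleton]
        intro x hx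
        have := e6 (by rw [hs, verts_singleton]; exact hx)
        exact mem_inter.2 ⟨(mem_inter.1 hx).2, (mem_inter.1 this).2⟩
      have e12 := card_le_card e11
      have e13 := ih (by omega) s hsF
      omega
    · have hss : insert g (S ∩ F) ⊂ S := ssubset_of_subset_of_ne hDS hD
      have hsp := (hS.sparse hss ⟨g, by simp⟩).2 (by omega)
      have e1 : verts (F ∪ S) \ e ⊆
          (verts F \ e) ∪ (g \ e) ∪ (verts S \ verts (insert g (S ∩ F))) := by
        intro x hx
        rw [verts_union] at hx
        simp only [Finset.mem_sdiff, mem_union, verts_insert, not_or] at hx ⊢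
        have : x ∈ verts (S ∩ F) → x ∈ verts F := fun h => verts_mono inter_subset_right h
        tauto
      have e2 := (card_le_card e1).trans
        ((card_union_le _ _).trans (Nat.add_le_add_right (card_union_le _ _) _))
      rw [card_sdiff_of_subset (verts_mono hDS), u1.card_verts, h1.card_verts] at e2
      have e3 := card_le_card (verts_mono hDS)
      rw [hDc, mul_add, mul_one] at hsp
      omega

theorem Gen.disjoint_trace {e T : Finset V} {l l' : ℕ} {F I : Finset (Finset V)}
    (hF : Gen t d R (EdgeStart t d R e 3) l F) (hI : Gen t d R (TraceStart t d R e T) l' I)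
    (hG : Good t d e b R) (hTe : T ⊆ e) (hT : T.card = t)
    (hb : 3 * (l + 2) + 3 * (l' + 1) ≤ b) : Disjoint F I := by
  obtain ⟨h1, h2, h3⟩ := hI.tight hG hTe (fun F h => h.isStart hT) (by omega)
  refine hF.disjoint_of (ρ := e) hG Subset.rfl (fun F h => h.isStart) h1 (by omega) ?_
  intro k hk F hF B hB hBt hBs
  have h5 := hBt.le_card_inter hBs
  have h6 : verts B ∩ e ⊆ T :=
    (inter_subset_inter_right (verts_mono (hB.trans inter_subset_right))).trans h3
  have h7 := card_le_card h6
  have h8 : B.card = 1 := by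
    have := hBt.nonempty.card_pos
    by_contra hne
    have := h5.2 (by omega)
    omega
  obtain ⟨g, rfl⟩ := card_eq_one.1 h8
  rw [verts_singleton] at h5
  have := hF.card_inter_lt hG (by omega) g ((mem_inter.1 (hB (mem_singleton_self g))).1)
  omega

/-- A minimal configuration through an edge grown from the root `ρ ∈ S₀` cannot involve other
edges of the minimal configuration `S₀`. -/
theorem Tight.not_mconf {S₀ S F : Finset (Finset V)} (hS₀ : MConf t d S₀)
    (hG : Good t d (verts S₀) b R) (hR : ∀ f ∈ S₀, f ∉ R) (hρ : ρ ∈ S₀)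
    (hF : Tight t d (verts S₀) R F) (hFρ : verts F ∩ verts S₀ ⊆ ρ) (hb : F.card + 4 ≤ b)
    (hS : MConf t d S) (hSR : ∀ f ∈ S, f ∈ R ∨ f ∈ S₀) (hSF : (S ∩ F).Nonempty) (hρS : ρ ∉ S)
    (hD : (S ∩ S₀).Nonempty) (hDρ : insert ρ (S ∩ S₀) ≠ S₀) : False := by
  have hFS₀ : Disjoint F S₀ := by
    rw [disjoint_left]; intro f hf hf'; exact hR f hf' (hF.mem f hf).1
  have hAD : Disjoint (S ∩ F) (S ∩ S₀) :=
    disjoint_of_subset_left inter_subset_right (disjoint_of_subset_right inter_subset_right hFS₀)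
  have hADc := card_union_of_disjoint hAD
  have hp1 := hSF.card_pos
  have hp2 := hD.card_pos
  have hS4 := hS.1.2.2.2
  by_cases hN : (S \ (F ∪ S₀)).Nonempty
  · have hADS : (S ∩ F) ∪ (S ∩ S₀) ⊂ S := by
      refine ssubset_of_subset_of_ne (union_subset inter_subset_left inter_subset_left) fun h => ?_
      obtain ⟨x, hx⟩ := hN
      rw [Finset.mem_sdiff] at hx
      have hx' := hx.1
      rw [← h, mem_union, mem_inter, mem_inter] at hx'
      exact hx.2 (mem_union.2 (by tauto))
    have hsp := (hS.sparse hADS (hSF.mono subset_union_left)).2 (by omega)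
    have hSe : S.card = ((S ∩ F) ∪ (S ∩ S₀)).card + (S \ (F ∪ S₀)).card := by
      rw [← inter_union_distrib_left, add_comm]
      exact (card_sdiff_add_card_inter _ _).symm
    have hFN : Disjoint F (S \ (F ∪ S₀)) := by
      rw [disjoint_left]; intro f hf hf'
      rw [Finset.mem_sdiff, mem_union] at hf'
      tauto
    have h1 := hG (F ∪ (S \ (F ∪ S₀))) (by
      intro f hf
      rcases mem_union.1 hf with h | h
      · exact hF.mem f h
      · rw [Finset.mem_sdiff, mem_union] at h
        exact ⟨(hSR f h.1).resolve_right (fun h' => h.2 (Or.inr h')), hS.1.1 f h.1⟩)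
      (hF.nonempty.mono subset_union_left) (by
        rw [card_union_of_disjoint hFN]
        have := card_le_card (sdiff_subset : S \ (F ∪ S₀) ⊆ S)
        have := hS.1.2.2.1
        omega)
    have h2 : verts (F ∪ (S \ (F ∪ S₀))) \ verts S₀ ⊆
        (verts F \ verts S₀) ∪ (verts S \ verts ((S ∩ F) ∪ (S ∩ S₀))) := by
      intro x hx
      rw [verts_union] at hx
      rw [verts_union]
      simp only [Finset.mem_sdiff, mem_union, not_or] at hx ⊢
      have a1 : x ∈ verts (S ∩ F) → x ∈ verts F := fun h => verts_mono inter_subset_right h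
      have a2 : x ∈ verts (S ∩ S₀) → x ∈ verts S₀ := fun h => verts_mono inter_subset_right h
      have a3 : x ∈ verts (S \ (F ∪ S₀)) → x ∈ verts S := fun h => verts_mono sdiff_subset h
      tauto
    have h3 := (card_le_card h2).trans (card_union_le _ _)
    rw [card_sdiff_of_subset (verts_mono hADS.1), hF.card_verts] at h3
    rw [card_union_of_disjoint hFN, mul_add] at h1
    rw [hSe, mul_add] at hS4
    have := card_le_card (verts_mono hADS.1)
    omega
  · rw [not_nonempty_iff_eq_empty, sdiff_eq_empty_iff_subset] at hN
    have hSe : S = (S ∩ F) ∪ (S ∩ S₀) := by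
      rw [← inter_union_distrib_left]; exact (inter_eq_left.2 hN).symm
    have hAS : S ∩ F ⊂ S := by
      refine ssubset_of_subset_of_ne inter_subset_left fun h => ?_
      obtain ⟨x, hx⟩ := hD
      rw [mem_inter] at hx
      exact disjoint_left.1 hFS₀ (inter_eq_left.1 h hx.1) hx.2
    have h1 := (hS.sparse hAS hSF).1
    have h2 := card_union_add_card_inter (verts (S ∩ F)) (verts (S ∩ S₀))
    rw [← verts_union, ← hSe] at h2
    have hSc : S.card = (S ∩ F).card + (S ∩ S₀).card := by rw [← hADc, ← hSe]
    have h3 : verts (S ∩ F) ∩ verts (S ∩ S₀) ⊆ ρ ∩ verts (S ∩ S₀) := by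
      intro x hx
      rw [mem_inter] at hx
      exact mem_inter.2 ⟨hFρ (mem_inter.2 ⟨verts_mono inter_subset_right hx.1,
        verts_mono inter_subset_right hx.2⟩), hx.2⟩
    have h4 := card_le_card h3
    have hρn : ρ ∉ S ∩ S₀ := fun h => hρS (mem_inter.1 h).1
    have hss : insert ρ (S ∩ S₀) ⊂ S₀ :=
      ssubset_of_subset_of_ne (insert_subset hρ inter_subset_right) hDρ
    have hDc := card_insert_of_notMem hρn
    have h5 := (hS₀.sparse hss ⟨ρ, by simp⟩).2 (by omega)
    rw [verts_insert, hDc, mul_add, mul_one] at h5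
    have h6 := card_union_add_card_inter ρ (verts (S ∩ S₀))
    have h7 := hS₀.1.1 ρ hρ
    rw [hSc, mul_add] at hS4
    omega

end Configurations

section Rounds

variable {V : Type*} [DecidableEq V]

/-- The edges accepted during the first `i` rounds, where an edge `e` is proposed in round `m e`
and rejected if it completes a minimal configuration. -/
def Accepted (t d : ℕ) (m : Finset V → ℕ) : ℕ → Finset V → Prop
  | 0, _ => False
  | i + 1, e => Accepted t d m i e ∨ (e.card = t + d ∧ m e = i ∧
      ¬ ∃ S, MConf t d S ∧ e ∈ S ∧ ∀ f ∈ S, f ≠ e → Accepted t d m i f ∨ m f = i)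

/-- The edge `e` cannot be accepted in round `i`. -/
def Blocked (t d : ℕ) (m : Finset V → ℕ) (i : ℕ) (e : Finset V) : Prop :=
  ∃ S, MConf t d S ∧ e ∈ S ∧ ∀ f ∈ S, f ≠ e → Accepted t d m i f ∨ m f = i

variable {t d : ℕ} {m m' : Finset V → ℕ}

theorem acc_succ {i : ℕ} {e : Finset V} :
    Accepted t d m (i + 1) e ↔ Accepted t d m i e ∨ (e.card = t + d ∧ m e = i ∧ ¬ Blocked t d m i e) :=
  Iff.rfl

theorem acc_iff {i : ℕ} {e : Finset V} :
    Accepted t d m i e ↔ e.card = t + d ∧ m e < i ∧ ¬ Blocked t d m (m e) e := by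
  induction i with
  | zero => simp [Accepted]
  | succ i ih =>
    rw [acc_succ, ih]
    constructor
    · rintro (⟨h1, h2, h3⟩ | ⟨h1, h2, h3⟩)
      · exact ⟨h1, by omega, h3⟩
      · exact ⟨h1, by omega, by rwa [h2]⟩
    · rintro ⟨h1, h2, h3⟩
      by_cases h : m e = i
      · exact Or.inr ⟨h1, h, by rwa [h] at h3⟩
      · exact Or.inl ⟨h1, by omega, h3⟩

theorem Accepted.lt {i : ℕ} {e : Finset V} (h : Accepted t d m i e) : m e < i := (acc_iff.1 h).2.1

theorem Accepted.card {i : ℕ} {e : Finset V} (h : Accepted t d m i e) : e.card = t + d := (acc_iff.1 h).1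

theorem Accepted.mono {i j : ℕ} {e : Finset V} (h : Accepted t d m i e) (hij : i ≤ j) : Accepted t d m j e := by
  rw [acc_iff] at h ⊢
  exact ⟨h.1, by omega, h.2.2⟩

theorem Accepted.of_lt {i j : ℕ} {e : Finset V} (h : Accepted t d m i e) (hj : m e < j) : Accepted t d m j e := by
  rw [acc_iff] at h ⊢
  exact ⟨h.1, hj, h.2.2⟩

theorem not_forall_acc_of_mconf {i : ℕ} {S : Finset (Finset V)} (hS : MConf t d S) :
    ¬ ∀ f ∈ S, Accepted t d m i f := by
  intro h
  have hne : S.Nonempty := by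
    rw [← card_pos]; have := hS.1.2.1; omega
  obtain ⟨e, he, hmax⟩ := S.exists_max_image m hne
  refine (acc_iff.1 (h e he)).2.2 ⟨S, hS, he, fun f hf _ => ?_⟩
  rcases (hmax f hf).lt_or_eq with h1 | h1
  · exact Or.inl ((h f hf).of_lt h1)
  · exact Or.inr h1

theorem acc_congr {i : ℕ} (h : ∀ f, m f < i ∨ m' f < i → m f = m' f) (e : Finset V) :
    Accepted t d m i e ↔ Accepted t d m' i e := by
  induction i generalizing e with
  | zero => simp [Accepted]
  | succ i ih =>
    have ih' := fun e => ih (fun f hf => h f (by omega)) e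
    have hm : ∀ f, m f = i ↔ m' f = i := by
      intro f
      constructor
      · intro hf; rw [← h f (by omega), hf]
      · intro hf; rw [h f (by omega), hf]
    simp only [acc_succ, Blocked, ih', hm]

/-- Marks in which the edges of `S` are never proposed. -/
def mute (K : ℕ) (S : Finset (Finset V)) (m : Finset V → ℕ) (f : Finset V) : ℕ :=
  if f ∈ S then K else m f

theorem mute_of_mem {K : ℕ} {S : Finset (Finset V)} {f : Finset V} (h : f ∈ S) :
    mute K S m f = K := if_pos h

theorem mute_of_notMem {K : ℕ} {S : Finset (Finset V)} {f : Finset V} (h : f ∉ S) :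
    mute K S m f = m f := if_neg h

theorem mute_congr {K : ℕ} {S : Finset (Finset V)} (h : ∀ f, f ∉ S → m f = m' f) :
    mute K S m = mute K S m' := by
  funext f
  by_cases hf : f ∈ S
  · rw [mute_of_mem hf, mute_of_mem hf]
  · rw [mute_of_notMem hf, mute_of_notMem hf, h f hf]

theorem acc_mute {K i : ℕ} {S : Finset (Finset V)} (hi : i ≤ K) (hS : ∀ f ∈ S, i ≤ m f)
    (e : Finset V) : Accepted t d (mute K S m) i e ↔ Accepted t d m i e := by
  apply acc_congr
  intro f hf
  by_cases h : f ∈ S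
  · rw [mute_of_mem h] at hf ⊢
    have := hS f h
    omega
  · exact mute_of_notMem h

theorem blk_congr {i : ℕ} {e : Finset V}
    (h : ∀ f, f ≠ e → m f ≤ i ∨ m' f ≤ i → m f = m' f) (h1 : i ≤ m e) (h2 : i ≤ m' e) :
    Blocked t d m i e ↔ Blocked t d m' i e := by
  have hA : ∀ f, Accepted t d m i f ↔ Accepted t d m' i f := by
    apply acc_congr
    intro f hf
    refine h f ?_ (by omega)
    rintro rfl
    omega
  have hm : ∀ f, f ≠ e → (m f = i ↔ m' f = i) := by
    intro f hne
    constructor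
    · intro hf; rw [← h f hne (by omega), hf]
    · intro hf; rw [h f hne (by omega), hf]
  constructor
  · rintro ⟨S, hS, he, h⟩
    refine ⟨S, hS, he, fun f hf hne => ?_⟩
    rw [← hA, ← hm f hne]
    exact h f hf hne
  · rintro ⟨S, hS, he, h⟩
    refine ⟨S, hS, he, fun f hf hne => ?_⟩
    rw [hA, hm f hne]
    exact h f hf hne

theorem blk_mute_self {K i : ℕ} {e : Finset V} (hi : i < K) (h : i ≤ m e) :
    Blocked t d (mute K {e} m) i e ↔ Blocked t d m i e := by
  apply blk_congr
  · intro f hf _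
    exact mute_of_notMem (by simpa using hf)
  · rw [mute_of_mem (mem_singleton_self e)]; omega
  · exact h

theorem acc_succ_iff {K i : ℕ} {e : Finset V} (hi : i < K) :
    Accepted t d m (i + 1) e ↔ Accepted t d m i e ∨
      (e.card = t + d ∧ m e = i ∧ ¬ Blocked t d (mute K {e} m) i e) := by
  rw [acc_succ]
  apply or_congr_right
  apply and_congr_right
  intro _
  apply and_congr_right
  intro h
  rw [blk_mute_self hi h.ge]

/-- The outcome of the process at edges reached in few steps depends only on the marks of edges
reached in few steps. -/
theorem acc_congr_of_gen {R : Set (Finset V)} {St : Finset (Finset V) → Prop} {K : ℕ}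
    (hm : ∀ f, m f < K → f ∈ R) (hm' : ∀ f, m' f < K → f ∈ R)
    (h : ∀ l ≤ K, ∀ F, Gen t d R St l F → ∀ f ∈ F, m f = m' f) (i : ℕ) :
    ∀ l F, l + i ≤ K → Gen t d R St l F → ∀ e ∈ F, (Accepted t d m i e ↔ Accepted t d m' i e) := by
  induction i with
  | zero => intros; simp [Accepted]
  | succ i ih =>
    intro l F hl hF e he
    have hme := h l (by omega) F hF e he
    have key : m e = i → ∀ S, MConf t d S → e ∈ S → (∀ f ∈ S, f ∈ R) → ∀ f ∈ S,
        (Accepted t d m i f ∨ m f = i ↔ Accepted t d m' i f ∨ m' f = i) := by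
      intro _ S hS heS hSR f hf
      have hG := Gen.step l F S hF hS hSR ⟨e, mem_inter.2 ⟨heS, he⟩⟩
      rw [ih (l + 1) _ (by omega) hG f (mem_union_right _ hf),
        h (l + 1) (by omega) _ hG f (mem_union_right _ hf)]
    rw [acc_succ, acc_succ, ih l F (by omega) hF e he, hme]
    apply or_congr_right
    apply and_congr_right
    intro _
    apply and_congr_right
    intro hi
    rw [not_iff_not]
    have key' := key (by omega)
    constructor
    · rintro ⟨S, hS, heS, hf⟩
      have hSR : ∀ f ∈ S, f ∈ R := by
        intro f hfS
        by_cases hne : f = e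
        · subst hne; exact hm _ (by omega)
        · rcases hf f hfS hne with h1 | h1
          · exact hm _ (by have := h1.lt; omega)
          · exact hm _ (by omega)
      exact ⟨S, hS, heS, fun f hfS hne => (key' S hS heS hSR f hfS).1 (hf f hfS hne)⟩
    · rintro ⟨S, hS, heS, hf⟩
      have hSR : ∀ f ∈ S, f ∈ R := by
        intro f hfS
        by_cases hne : f = e
        · subst hne; exact hm _ (by omega)
        · rcases hf f hfS hne with h1 | h1
          · exact hm' _ (by have := h1.lt; omega)
          · exact hm' _ (by omega)
      exact ⟨S, hS, heS, fun f hfS hne => (key' S hS heS hSR f hfS).2 (hf f hfS hne)⟩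

/-- Making the edges of a minimal configuration `S₀` available again does not influence the
process at edges grown from a root `ρ ∈ S₀`. -/
theorem acc_congr_of_mconf {R : Set (Finset V)} {S₀ : Finset (Finset V)} {ρ h : Finset V}
    {K b j s : ℕ} (hS₀ : MConf t d S₀) (hG : Good t d (verts S₀) b R) (hb : 3 * (K + 1) + 4 ≤ b)
    (hR : ∀ f ∈ S₀, f ∉ R) (hm : ∀ f, m f < K → f ∈ R) (hmm : ∀ f, f ∉ S₀ → m f = m' f)
    (hρ : ρ ∈ S₀) (hh : h ∈ S₀) (hρh : ρ ≠ h) (hjK : j ≤ K) (hjρ : j ≤ m' ρ) (hjh : j ≤ m' h)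
    (i : ℕ) : ∀ l F, i ≤ j → l + i ≤ K → Gen t d R (EdgeStart t d R ρ s) l F → ∀ c ∈ F,
      (Accepted t d m i c ↔ Accepted t d m' i c) := by
  induction i with
  | zero => intros; simp [Accepted]
  | succ i ih =>
    intro l F hij hl hF c hc
    obtain ⟨h1, h2, h3⟩ := hF.tight (b := b) (ρ := ρ) hG (subset_verts hρ)
      (fun F h => h.isStart) (by omega)
    have hcR := (h1.mem c hc).1
    have hmc : m c = m' c := hmm c fun h => hR c h hcR
    have key : ∀ S, MConf t d S → c ∈ S → (∀ f ∈ S, f ∈ R) → ∀ f ∈ S,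
        (Accepted t d m i f ∨ m f = i ↔ Accepted t d m' i f ∨ m' f = i) := by
      intro S hS hcS hSR f hf
      have hG := Gen.step l F S hF hS hSR ⟨c, mem_inter.2 ⟨hcS, hc⟩⟩
      rw [ih (l + 1) _ (by omega) (by omega) hG f (mem_union_right _ hf),
        hmm f fun h => hR f h (hSR f hf)]
    rw [acc_succ, acc_succ, ih l F (by omega) (by omega) hF c hc, hmc]
    apply or_congr_right
    apply and_congr_right
    intro _
    apply and_congr_right
    intro hi
    rw [not_iff_not]
    constructor
    · rintro ⟨S, hS, hcS, hf⟩
      have hSR : ∀ f ∈ S, f ∈ R := by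
        intro f hfS
        by_cases hne : f = c
        · subst hne; exact hcR
        · rcases hf f hfS hne with h1 | h1
          · exact hm _ (by have := h1.lt; omega)
          · exact hm _ (by omega)
      exact ⟨S, hS, hcS, fun f hfS hne => (key S hS hcS hSR f hfS).1 (hf f hfS hne)⟩
    · rintro ⟨S, hS, hcS, hf⟩
      have hlt : ∀ f ∈ S, m' f ≤ i := by
        intro f hfS
        by_cases hne : f = c
        · subst hne; omega
        · rcases hf f hfS hne with h1 | h1
          · exact h1.lt.le
          · exact h1.le
      have hSR' : ∀ f ∈ S, f ∈ R ∨ f ∈ S₀ := by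
        intro f hfS
        by_cases hfS₀ : f ∈ S₀
        · exact Or.inr hfS₀
        · left
          apply hm
          rw [hmm f hfS₀]
          have := hlt f hfS
          omega
      have hSR : ∀ f ∈ S, f ∈ R := by
        by_contra hcon
        push Not at hcon
        obtain ⟨f, hfS, hfR⟩ := hcon
        refine h1.not_mconf hS₀ hG hR hρ h3 (by omega) hS hSR' ⟨c, mem_inter.2 ⟨hcS, hc⟩⟩ ?_
          ⟨f, mem_inter.2 ⟨hfS, (hSR' f hfS).resolve_left hfR⟩⟩ ?_
        · intro h
          have := hlt ρ h
          omega
        · intro heq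
          have : h ∈ insert ρ (S ∩ S₀) := by rw [heq]; exact hh
          rcases mem_insert.1 this with h' | h'
          · exact hρh h'.symm
          · have := hlt h (mem_inter.1 h').1
            omega
      exact ⟨S, hS, hcS, fun f hfS hne => (key S hS hcS hSR f hfS).2 (hf f hfS hne)⟩

/-- The edge `e` completes a minimal configuration with at least `s` edges, the other edges of
which have been accepted during the first `i` rounds. -/
def Threat (t d s : ℕ) (m : Finset V → ℕ) (i : ℕ) (e : Finset V) : Prop :=
  ∃ S, MConf t d S ∧ e ∈ S ∧ s ≤ S.card ∧ ∀ f ∈ S, f ≠ e → Accepted t d m i f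

theorem blk_congr_of_gen {R : Set (Finset V)} {K i : ℕ} {e : Finset V}
    (hm : ∀ f, m f < K → f ∈ R) (hm' : ∀ f, m' f < K → f ∈ R) (hi : i < K)
    (h : ∀ l ≤ K, ∀ F, Gen t d R (EdgeStart t d R e 2) l F → ∀ f ∈ F, m f = m' f) :
    Blocked t d m i e ↔ Blocked t d m' i e := by
  have key : ∀ S, MConf t d S → e ∈ S → (∀ f ∈ S, f ≠ e → f ∈ R) → ∀ f ∈ S, f ≠ e →
      (Accepted t d m i f ∨ m f = i ↔ Accepted t d m' i f ∨ m' f = i) := by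
    intro S hS heS hSR f hf hne
    have hG := Gen.start (t := t) (d := d) (R := R) (St := EdgeStart t d R e 2) (S.erase e)
      ⟨S, hS, heS, hS.1.2.1, hSR, rfl⟩
    have hfe := mem_erase.2 ⟨hne, hf⟩
    rw [acc_congr_of_gen hm hm' h i 0 _ (by omega) hG f hfe, h 0 (by omega) _ hG f hfe]
  have aux : ∀ {m₀ : Finset V → ℕ}, (∀ f, m₀ f < K → f ∈ R) → ∀ f,
      Accepted t d m₀ i f ∨ m₀ f = i → f ∈ R := by
    rintro m₀ h₀ f (h1 | h1)
    · exact h₀ _ (by have := h1.lt; omega)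
    · exact h₀ _ (by omega)
  constructor
  · rintro ⟨S, hS, heS, hf⟩
    exact ⟨S, hS, heS, fun f hfS hne => (key S hS heS
      (fun f hf' hne => aux hm f (hf f hf' hne)) f hfS hne).1 (hf f hfS hne)⟩
  · rintro ⟨S, hS, heS, hf⟩
    exact ⟨S, hS, heS, fun f hfS hne => (key S hS heS
      (fun f hf' hne => aux hm' f (hf f hf' hne)) f hfS hne).2 (hf f hfS hne)⟩

theorem thr_congr_of_gen {R : Set (Finset V)} {K i s : ℕ} {e : Finset V}
    (hm : ∀ f, m f < K → f ∈ R) (hm' : ∀ f, m' f < K → f ∈ R) (hi : i ≤ K)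
    (h : ∀ l ≤ K, ∀ F, Gen t d R (EdgeStart t d R e s) l F → ∀ f ∈ F, m f = m' f) :
    Threat t d s m i e ↔ Threat t d s m' i e := by
  have key : ∀ S, MConf t d S → e ∈ S → s ≤ S.card → (∀ f ∈ S, f ≠ e → f ∈ R) → ∀ f ∈ S, f ≠ e →
      (Accepted t d m i f ↔ Accepted t d m' i f) := by
    intro S hS heS hs hSR f hf hne
    have hG := Gen.start (t := t) (d := d) (R := R) (St := EdgeStart t d R e s) (S.erase e)
      ⟨S, hS, heS, hs, hSR, rfl⟩
    exact acc_congr_of_gen hm hm' h i 0 _ (by omega) hG f (mem_erase.2 ⟨hne, hf⟩)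
  have aux : ∀ {m₀ : Finset V → ℕ}, (∀ f, m₀ f < K → f ∈ R) → ∀ f, Accepted t d m₀ i f → f ∈ R := by
    intro m₀ h₀ f h1
    exact h₀ _ (by have := h1.lt; omega)
  constructor
  · rintro ⟨S, hS, heS, hs, hf⟩
    exact ⟨S, hS, heS, hs, fun f hfS hne => (key S hS heS hs
      (fun f hf' hne => aux hm f (hf f hf' hne)) f hfS hne).1 (hf f hfS hne)⟩
  · rintro ⟨S, hS, heS, hs, hf⟩
    exact ⟨S, hS, heS, hs, fun f hfS hne => (key S hS heS hs
      (fun f hf' hne => aux hm' f (hf f hf' hne)) f hfS hne).2 (hf f hfS hne)⟩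

/-- An edge meeting `e` exactly in `T` has been accepted during the first `i` rounds. -/
def Covered (t d : ℕ) (m : Finset V → ℕ) (i : ℕ) (e T : Finset V) : Prop :=
  ∃ f, f ∩ e = T ∧ Accepted t d m i f

theorem cov_congr_of_gen {R : Set (Finset V)} {K i : ℕ} {e T : Finset V}
    (hm : ∀ f, m f < K → f ∈ R) (hm' : ∀ f, m' f < K → f ∈ R) (hi : i ≤ K)
    (h : ∀ l ≤ K, ∀ F, Gen t d R (TraceStart t d R e T) l F → ∀ f ∈ F, m f = m' f) :
    Covered t d m i e T ↔ Covered t d m' i e T := by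
  have key : ∀ f, f ∈ R → f.card = t + d → f ∩ e = T → (Accepted t d m i f ↔ Accepted t d m' i f) := by
    intro f hf hfc hfe
    have hG := Gen.start (t := t) (d := d) (R := R) (St := TraceStart t d R e T) {f}
      ⟨f, hf, hfc, hfe, rfl⟩
    exact acc_congr_of_gen hm hm' h i 0 _ (by omega) hG f (mem_singleton_self f)
  constructor
  · rintro ⟨f, hfe, hf⟩
    exact ⟨f, hfe, (key f (hm f (by have := hf.lt; omega)) hf.card hfe).1 hf⟩
  · rintro ⟨f, hfe, hf⟩
    exact ⟨f, hfe, (key f (hm' f (by have := hf.lt; omega)) hf.card hfe).2 hf⟩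

/-- Restoring the marks of the edges of `S₀` preserves blocked edges of `S₀`. -/
theorem blk_of_mconf {R : Set (Finset V)} {S₀ : Finset (Finset V)} {ρ h : Finset V}
    {K b j : ℕ} (hS₀ : MConf t d S₀) (hG : Good t d (verts S₀) b R) (hb : 3 * (K + 1) + 4 ≤ b)
    (hR : ∀ f ∈ S₀, f ∉ R) (hm : ∀ f, m f < K → f ∈ R) (hmm : ∀ f, f ∉ S₀ → m f = m' f)
    (hρ : ρ ∈ S₀) (hh : h ∈ S₀) (hρh : ρ ≠ h) (hjK : j < K) (hjρ : j ≤ m' ρ) (hjh : j ≤ m' h)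
    (hB : Blocked t d m j ρ) : Blocked t d m' j ρ := by
  obtain ⟨S, hS, hρS, hf⟩ := hB
  have hSR : ∀ f ∈ S, f ≠ ρ → f ∈ R := by
    intro f hfS hne
    rcases hf f hfS hne with h1 | h1
    · exact hm _ (by have := h1.lt; omega)
    · exact hm _ (by omega)
  refine ⟨S, hS, hρS, fun f hfS hne => ?_⟩
  have hGen := Gen.start (t := t) (d := d) (R := R) (St := EdgeStart t d R ρ 2) (S.erase ρ)
      ⟨S, hS, hρS, hS.1.2.1, hSR, rfl⟩
  rw [← acc_congr_of_mconf hS₀ hG hb hR hm hmm hρ hh hρh hjK.le hjρ hjh j 0 _ le_rfl (by omega)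
    hGen f (mem_erase.2 ⟨hne, hfS⟩), ← hmm f fun h => hR f h (hSR f hfS hne)]
  exact hf f hfS hne

theorem thr_of_mconf {R : Set (Finset V)} {S₀ : Finset (Finset V)} {ρ h : Finset V}
    {K b j s : ℕ} (hS₀ : MConf t d S₀) (hG : Good t d (verts S₀) b R) (hb : 3 * (K + 1) + 4 ≤ b)
    (hR : ∀ f ∈ S₀, f ∉ R) (hm : ∀ f, m f < K → f ∈ R) (hmm : ∀ f, f ∉ S₀ → m f = m' f)
    (hρ : ρ ∈ S₀) (hh : h ∈ S₀) (hρh : ρ ≠ h) (hjK : j ≤ K) (hjρ : j ≤ m' ρ) (hjh : j ≤ m' h)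
    (hB : Threat t d s m j ρ) : Threat t d s m' j ρ := by
  obtain ⟨S, hS, hρS, hs, hf⟩ := hB
  have hSR : ∀ f ∈ S, f ≠ ρ → f ∈ R := by
    intro f hfS hne
    exact hm _ (by have := (hf f hfS hne).lt; omega)
  refine ⟨S, hS, hρS, hs, fun f hfS hne => ?_⟩
  have hGen := Gen.start (t := t) (d := d) (R := R) (St := EdgeStart t d R ρ s) (S.erase ρ)
      ⟨S, hS, hρS, hs, hSR, rfl⟩
  rw [← acc_congr_of_mconf hS₀ hG hb hR hm hmm hρ hh hρh hjK hjρ hjh j 0 _ le_rfl (by omega)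
    hGen f (mem_erase.2 ⟨hne, hfS⟩)]
  exact hf f hfS hne

end Rounds

section FiniteProbability

variable {Ω Ω' : Type*} [Fintype Ω] [Fintype Ω']

/-- The average of a function on a finite type. -/
noncomputable def avg (f : Ω → ℝ) : ℝ := (∑ x, f x) / Fintype.card Ω

open Classical in
/-- The probability of an event under the uniform distribution on a finite type. -/
noncomputable def prob (p : Ω → Prop) : ℝ := avg fun x => if p x then 1 else 0

theorem avg_mono {f g : Ω → ℝ} (h : ∀ x, f x ≤ g x) : avg f ≤ avg g :=
  div_le_div_of_nonneg_right (sum_le_sum fun x _ => h x) (Nat.cast_nonneg _)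

theorem avg_nonneg {f : Ω → ℝ} (h : ∀ x, 0 ≤ f x) : 0 ≤ avg f :=
  div_nonneg (sum_nonneg fun x _ => h x) (Nat.cast_nonneg _)

theorem avg_add (f g : Ω → ℝ) : avg (fun x => f x + g x) = avg f + avg g := by
  simp only [avg, sum_add_distrib, add_div]

theorem avg_mul_left (c : ℝ) (f : Ω → ℝ) : avg (fun x => c * f x) = c * avg f := by
  simp only [avg, ← mul_sum, mul_div_assoc]

theorem avg_mul_right (c : ℝ) (f : Ω → ℝ) : avg (fun x => f x * c) = avg f * c := by
  simp only [mul_comm _ c, avg_mul_left]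

theorem avg_sum {κ : Type*} (s : Finset κ) (f : κ → Ω → ℝ) :
    avg (fun x => ∑ k ∈ s, f k x) = ∑ k ∈ s, avg (f k) := by
  simp only [avg, sum_div]
  rw [sum_comm]

theorem avg_const [Nonempty Ω] (c : ℝ) : avg (fun _ : Ω => c) = c := by
  have : (Fintype.card Ω : ℝ) ≠ 0 := by exact_mod_cast Fintype.card_ne_zero
  simp only [avg, sum_const, nsmul_eq_mul, card_univ]
  field_simp

theorem avg_equiv (σ : Ω ≃ Ω') (f : Ω' → ℝ) : avg (fun x => f (σ x)) = avg f := by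
  simp only [avg]
  rw [Fintype.card_congr σ, Equiv.sum_comp σ f]

theorem avg_prod (f : Ω × Ω' → ℝ) : avg f = avg fun x => avg fun y => f (x, y) := by
  simp only [avg, Fintype.sum_prod_type, Fintype.card_prod, ← sum_div, Nat.cast_mul]
  rw [div_div, mul_comm (Fintype.card Ω' : ℝ)]

theorem exists_avg_le [Nonempty Ω] (f : Ω → ℝ) : ∃ x, avg f ≤ f x := by
  by_contra h
  push Not at h
  have h1 : ∑ x, f x < ∑ _x : Ω, avg f := sum_lt_sum_of_nonempty univ_nonempty fun x _ => h x
  have h2 : (0 : ℝ) < Fintype.card Ω := by exact_mod_cast Fintype.card_pos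
  rw [sum_const, nsmul_eq_mul, card_univ, avg, mul_div_cancel₀ _ h2.ne'] at h1
  exact lt_irrefl _ h1

theorem prob_nonneg (p : Ω → Prop) : 0 ≤ prob p :=
  avg_nonneg fun x => by split_ifs <;> norm_num

theorem prob_mono {p q : Ω → Prop} (h : ∀ x, p x → q x) : prob p ≤ prob q := by
  refine avg_mono fun x => ?_
  by_cases hp : p x
  · simp [hp, h x hp]
  · simp only [hp, if_false]; split_ifs <;> norm_num

theorem prob_congr {p q : Ω → Prop} (h : ∀ x, p x ↔ q x) : prob p = prob q := by
  rw [show p = q from funext fun x => propext (h x)]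

theorem prob_true [Nonempty Ω] : prob (fun _ : Ω => True) = 1 := by
  simp [prob, avg_const]

theorem prob_false : prob (fun _ : Ω => False) = 0 := by
  simp [prob, avg]

theorem prob_le_one (p : Ω → Prop) : prob p ≤ 1 := by
  cases isEmpty_or_nonempty Ω
  · simp [prob, avg]
  · rw [← prob_true (Ω := Ω)]
    exact prob_mono fun _ _ => trivial

theorem prob_or_le (p q : Ω → Prop) : prob (fun x => p x ∨ q x) ≤ prob p + prob q := by
  simp only [prob]
  rw [← avg_add]
  refine avg_mono fun x => ?_
  by_cases hp : p x <;> by_cases hq : q x <;> simp [hp, hq]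

theorem prob_le_add {p q r : Ω → Prop} (h : ∀ x, p x → q x ∨ r x) : prob p ≤ prob q + prob r :=
  (prob_mono h).trans (prob_or_le q r)

theorem prob_or_of_disjoint {p q : Ω → Prop} (h : ∀ x, p x → ¬ q x) :
    prob (fun x => p x ∨ q x) = prob p + prob q := by
  simp only [prob]
  rw [← avg_add]
  congr 1
  funext x
  by_cases hp : p x
  · have := h x hp
    by_cases hq : q x
    · exact absurd hq this
    · simp [hp, hq]
  · by_cases hq : q x <;> simp [hp, hq]

theorem prob_and_add_and_not (p q : Ω → Prop) :
    prob (fun x => p x ∧ q x) + prob (fun x => p x ∧ ¬ q x) = prob p := by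
  rw [← prob_or_of_disjoint (by tauto)]
  exact prob_congr (by tauto)

theorem prob_not [Nonempty Ω] (p : Ω → Prop) : prob (fun x => ¬ p x) = 1 - prob p := by
  have := prob_and_add_and_not (fun _ : Ω => True) p
  simp only [true_and, prob_true] at this
  linarith

theorem prob_exists_le {κ : Type*} (s : Finset κ) (p : κ → Ω → Prop) :
    prob (fun x => ∃ k ∈ s, p k x) ≤ ∑ k ∈ s, prob (p k) := by
  classical
  induction s using Finset.induction_on with
  | empty => simp [prob_false]
  | insert a s ha ih =>
    rw [sum_insert ha]
    refine (prob_le_add (q := p a) (r := fun x => ∃ k ∈ s, p k x) ?_).trans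
      (by linarith)
    rintro x ⟨k, hk, h⟩
    rcases mem_insert.1 hk with rfl | hk
    · exact Or.inl h
    · exact Or.inr ⟨k, hk, h⟩

theorem prob_exists_of_disjoint {κ : Type*} (s : Finset κ) (p : κ → Ω → Prop)
    (h : ∀ k ∈ s, ∀ l ∈ s, k ≠ l → ∀ x, p k x → ¬ p l x) :
    prob (fun x => ∃ k ∈ s, p k x) = ∑ k ∈ s, prob (p k) := by
  classical
  induction s using Finset.induction_on with
  | empty => simp [prob_false]
  | insert a s ha ih =>
    rw [sum_insert ha, ← ih fun k hk l hl => h k (mem_insert_of_mem hk) l (mem_insert_of_mem hl),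
      ← prob_or_of_disjoint]
    · exact prob_congr fun x => by simp
    · rintro x hx ⟨k, hk, hkx⟩
      exact h a (mem_insert_self _ _) k (mem_insert_of_mem hk) (fun e => ha (e ▸ hk)) x hx hkx

theorem prob_equiv (σ : Ω ≃ Ω') (p : Ω' → Prop) : prob (fun x => p (σ x)) = prob p := by
  classical exact avg_equiv σ (fun x => if p x then 1 else 0)

theorem prob_prod (p : Ω × Ω' → Prop) : prob p = avg fun x => prob fun y => p (x, y) :=
  avg_prod _

theorem prob_prod_and (p : Ω → Prop) (q : Ω' → Prop) :
    prob (fun x : Ω × Ω' => p x.1 ∧ q x.2) = prob p * prob q := by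
  rw [prob_prod]
  simp only [prob]
  rw [← avg_mul_right]
  congr 1
  funext x
  by_cases h : p x
  · rw [if_pos h, one_mul]
    congr 1
    funext y
    by_cases hq : q y <;> simp [h, hq]
  · simp [h, avg]

theorem prob_fst [Nonempty Ω'] (p : Ω → Prop) : prob (fun x : Ω × Ω' => p x.1) = prob p := by
  have := prob_prod_and (Ω' := Ω') p fun _ => True
  simpa [prob_true] using this

theorem avg_prob_comm (p : Ω → Ω' → Prop) :
    avg (fun x => prob fun y => p x y) = avg fun y => prob fun x => p x y := by
  rw [← prob_prod (fun z : Ω × Ω' => p z.1 z.2), ← prob_prod (fun z : Ω' × Ω => p z.2 z.1)]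
  exact prob_equiv (Equiv.prodComm Ω Ω') (fun z : Ω' × Ω => p z.2 z.1)

variable {ι X : Type*} [Fintype ι] [DecidableEq ι] [Fintype X]

theorem avg_pi_prod [Nonempty X] (F : Finset ι) (h : ι → X → ℝ) :
    avg (fun a : ι → X => ∏ g ∈ F, h g (a g)) = ∏ g ∈ F, avg (h g) := by
  have h1 := Finset.prod_univ_sum (fun _ : ι => (univ : Finset X))
    (fun g x => if g ∈ F then h g x else 1)
  have hX : (Fintype.card X : ℝ) ≠ 0 := by exact_mod_cast Fintype.card_ne_zero
  have h2 : ∀ a : ι → X, ∏ g, (if g ∈ F then h g (a g) else 1) = ∏ g ∈ F, h g (a g) := by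
    intro a
    rw [prod_ite_mem, univ_inter]
  rw [Fintype.piFinset_univ] at h1
  simp only [h2] at h1
  have h4 : (Fintype.card (ι → X) : ℝ) = (Fintype.card X : ℝ) ^ Fintype.card ι := by
    rw [Fintype.card_fun, Nat.cast_pow]
  simp only [avg, ← h1, h4]
  have h3 : ∏ g : ι, ∑ x : X, (if g ∈ F then h g x else 1) =
      ∏ g : ι, ((if g ∈ F then (∑ x, h g x) / Fintype.card X else 1) * Fintype.card X) := by
    refine prod_congr rfl fun g _ => ?_
    split_ifs
    · field_simp
    · simp
  rw [h3, prod_mul_distrib, prod_const, card_univ, mul_div_assoc, div_self (pow_ne_zero _ hX),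
    mul_one, prod_ite_mem, univ_inter]

theorem prob_pi_forall [Nonempty X] (F : Finset ι) (p : ι → X → Prop) :
    prob (fun a : ι → X => ∀ g ∈ F, p g (a g)) = ∏ g ∈ F, prob (p g) := by
  classical
  simp only [prob]
  rw [← avg_pi_prod]
  congr 1
  funext a
  by_cases h : ∀ g ∈ F, p g (a g)
  · rw [if_pos h]
    exact (prod_eq_one fun g hg => if_pos (h g hg)).symm
  · rw [if_neg h]
    push Not at h
    obtain ⟨g, hg, hn⟩ := h
    exact (prod_eq_zero hg (if_neg hn)).symm

/-- Exchanging the coordinates in `F` of two functions. -/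
def exchange (F : Finset ι) : ((ι → X) × (ι → X)) ≃ ((ι → X) × (ι → X)) where
  toFun x := (F.piecewise x.2 x.1, F.piecewise x.1 x.2)
  invFun x := (F.piecewise x.2 x.1, F.piecewise x.1 x.2)
  left_inv x := by
    ext i <;> by_cases h : i ∈ F <;> simp [h]
  right_inv x := by
    ext i <;> by_cases h : i ∈ F <;> simp [h]

/-- Resampling the coordinates in `F`. -/
theorem prob_eq_avg_piecewise [Nonempty X] (F : Finset ι) (p : (ι → X) → Prop) :
    prob p = avg fun a => prob fun x => p (F.piecewise a x) := by
  have h1 := prob_equiv (exchange F) (fun z : (ι → X) × (ι → X) => p z.1)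
  rw [prob_fst] at h1
  rw [← h1, prob_prod, avg_prob_comm]
  rfl

/-- Conditions on the coordinates in `F` are independent of events which do not depend on
them. -/
theorem prob_pi_forall_and [Nonempty X] (F : Finset ι) (q : ι → X → Prop) (p : (ι → X) → Prop)
    (hp : ∀ a x, p (F.piecewise a x) ↔ p x) :
    prob (fun x => (∀ g ∈ F, q g (x g)) ∧ p x) = (∏ g ∈ F, prob (q g)) * prob p := by
  classical
  rw [prob_eq_avg_piecewise F, ← prob_pi_forall F q]
  conv_rhs => rw [prob]
  rw [← avg_mul_right]
  congr 1
  funext a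
  have : ∀ x : ι → X, (∀ g ∈ F, q g (F.piecewise a x g)) ↔ ∀ g ∈ F, q g (a g) := by
    intro x
    refine forall₂_congr fun g hg => ?_
    rw [piecewise_eq_of_mem _ _ _ hg]
  simp only [this, hp]
  by_cases h : ∀ g ∈ F, q g (a g)
  · simp only [if_pos h, one_mul]
    exact prob_congr fun x => and_iff_right h
  · simp only [if_neg h, zero_mul]
    rw [← prob_false (Ω := ι → X)]
    exact prob_congr fun x => by tauto

theorem prob_eq_card_div [DecidableEq X] (x₀ : X) :
    prob (fun x : X => x = x₀) = 1 / Fintype.card X := by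
  have : ∑ x : X, (if x = x₀ then (1 : ℝ) else 0) = 1 := by simp
  rw [← this]
  simp only [prob, avg]
  congr 1
  refine sum_congr rfl fun x _ => ?_
  by_cases h : x = x₀ <;> simp [h]

theorem prob_fin_eq {N : ℕ} {i : ℕ} (hi : i < N) :
    prob (fun x : Fin N => (x : ℕ) = i) = 1 / N := by
  have := prob_eq_card_div (⟨i, hi⟩ : Fin N)
  rw [Fintype.card_fin] at this
  rw [← this]
  exact prob_congr fun x => by rw [Fin.ext_iff]

theorem prob_fin_eq_le {N : ℕ} (i : ℕ) : prob (fun x : Fin N => (x : ℕ) = i) ≤ 1 / N := by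
  by_cases hi : i < N
  · exact (prob_fin_eq hi).le
  · refine (prob_mono (q := fun _ : Fin N => False) fun x hx => hi (lt_of_eq_of_lt (Eq.symm hx) (Fin.is_lt x))).trans ?_
    rw [prob_false]
    positivity

theorem prob_fin_lt_le {N : ℕ} (i : ℕ) : prob (fun x : Fin N => (x : ℕ) < i) ≤ i / N := by
  have h1 : prob (fun x : Fin N => (x : ℕ) < i) ≤
      prob (fun x : Fin N => ∃ k ∈ range i, (x : ℕ) = k) :=
    prob_mono fun x hx => ⟨x, mem_range.2 hx, rfl⟩
  refine h1.trans ((prob_exists_le _ _).trans ((sum_le_sum fun k _ => prob_fin_eq_le k).trans ?_))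
  rw [sum_const, card_range, nsmul_eq_mul]
  exact le_of_eq (by ring)

end FiniteProbability

section Independence

variable {ι : Type*} {N : ℕ}

/-- The coordinates whose value is less than `K`. -/
def active (K : ℕ) (x : ι → Fin N) : Set ι := {i | (x i : ℕ) < K}

/-- The event `p` is determined by the coordinates in `c R`, where `R` is any set containing all
active coordinates. -/
def IsLocal (K : ℕ) (c : Set ι → Set ι) (p : (ι → Fin N) → Prop) : Prop :=
  ∀ x y R, active K x ⊆ R → active K y ⊆ R → (∀ i ∈ c R, x i = y i) → (p x ↔ p y)

theorem IsLocal.forall {κ : Type*} {K : ℕ} {J : Finset κ} {c : κ → Set ι → Set ι}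
    {p : κ → (ι → Fin N) → Prop} (h : ∀ j ∈ J, IsLocal K (c j) (p j)) :
    IsLocal K (fun R => {i | ∃ j ∈ J, i ∈ c j R}) (fun x => ∀ j ∈ J, p j x) := by
  intro x y R hx hy hxy
  exact forall₂_congr fun j hj => h j hj x y R hx hy fun i hi => hxy i ⟨j, hj, hi⟩

theorem IsLocal.not {K : ℕ} {c : Set ι → Set ι} {p : (ι → Fin N) → Prop} (h : IsLocal K c p) :
    IsLocal K c (fun x => ¬ p x) :=
  fun x y R hx hy hxy => not_congr (h x y R hx hy hxy)

/-- The coordinates which are active in one of two points. -/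
def jointActive (K : ℕ) (z : (ι → Fin N) × (ι → Fin N)) : Set ι := active K z.1 ∪ active K z.2

open Classical in
/-- Exchanging the coordinates of two points in a set depending on the jointly active
coordinates. -/
noncomputable def clusterSwap (K : ℕ) (c : Set ι → Set ι) (z : (ι → Fin N) × (ι → Fin N)) :
    (ι → Fin N) × (ι → Fin N) :=
  (fun i => if i ∈ c (jointActive K z) then z.2 i else z.1 i,
    fun i => if i ∈ c (jointActive K z) then z.1 i else z.2 i)

theorem clusterSwap_of_mem {K : ℕ} {c : Set ι → Set ι} {z : (ι → Fin N) × (ι → Fin N)} {i : ι}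
    (h : i ∈ c (jointActive K z)) :
    (clusterSwap K c z).1 i = z.2 i ∧ (clusterSwap K c z).2 i = z.1 i :=
  ⟨if_pos h, if_pos h⟩

theorem clusterSwap_of_notMem {K : ℕ} {c : Set ι → Set ι} {z : (ι → Fin N) × (ι → Fin N)} {i : ι}
    (h : i ∉ c (jointActive K z)) :
    (clusterSwap K c z).1 i = z.1 i ∧ (clusterSwap K c z).2 i = z.2 i :=
  ⟨if_neg h, if_neg h⟩

theorem jointActive_clusterSwap (K : ℕ) (c : Set ι → Set ι) (z : (ι → Fin N) × (ι → Fin N)) :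
    jointActive K (clusterSwap K c z) = jointActive K z := by
  ext i
  show ((clusterSwap K c z).1 i : ℕ) < K ∨ ((clusterSwap K c z).2 i : ℕ) < K ↔
    (z.1 i : ℕ) < K ∨ (z.2 i : ℕ) < K
  by_cases h : i ∈ c (jointActive K z)
  · rw [(clusterSwap_of_mem h).1, (clusterSwap_of_mem h).2, or_comm]
  · rw [(clusterSwap_of_notMem h).1, (clusterSwap_of_notMem h).2]

theorem clusterSwap_involutive (K : ℕ) (c : Set ι → Set ι) :
    Function.Involutive (clusterSwap (N := N) K c) := by
  intro z
  have h := jointActive_clusterSwap K c z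
  have key : ∀ i, (clusterSwap K c (clusterSwap K c z)).1 i = z.1 i ∧
      (clusterSwap K c (clusterSwap K c z)).2 i = z.2 i := by
    intro i
    by_cases hi : i ∈ c (jointActive K z)
    · have h1 := clusterSwap_of_mem (z := clusterSwap K c z) (by rwa [h])
      have h2 := clusterSwap_of_mem hi
      exact ⟨h1.1.trans h2.2, h1.2.trans h2.1⟩
    · have h1 := clusterSwap_of_notMem (z := clusterSwap K c z) (by rwa [h])
      have h2 := clusterSwap_of_notMem hi
      exact ⟨h1.1.trans h2.1, h1.2.trans h2.2⟩
  exact Prod.ext (funext fun i => (key i).1) (funext fun i => (key i).2)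

variable [Fintype ι] [DecidableEq ι] [NeZero N]

theorem abs_prob_and_sub_le {K : ℕ} {c c' : Set ι → Set ι} {p q : (ι → Fin N) → Prop}
    (hp : IsLocal K c p) (hq : IsLocal K c' q) {G : Set ι → Prop}
    (hG : ∀ R, G R → Disjoint (c R) (c' R)) :
    |prob (fun x => p x ∧ q x) - prob p * prob q| ≤
      prob fun z : (ι → Fin N) × (ι → Fin N) => ¬ G (jointActive K z) := by
  set σ : ((ι → Fin N) × (ι → Fin N)) ≃ ((ι → Fin N) × (ι → Fin N)) :=
    (clusterSwap_involutive (N := N) K c').toPerm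
  have h1 : prob (fun x => p x ∧ q x) =
      prob fun z : (ι → Fin N) × (ι → Fin N) => p (σ z).1 ∧ q (σ z).1 := by
    rw [prob_equiv σ fun z : (ι → Fin N) × (ι → Fin N) => p z.1 ∧ q z.1]
    exact (prob_fst (Ω' := ι → Fin N) fun x => p x ∧ q x).symm
  have key : ∀ z : (ι → Fin N) × (ι → Fin N), G (jointActive K z) →
      ((p (σ z).1 ∧ q (σ z).1) ↔ (p z.1 ∧ q z.2)) := by
    intro z hz
    have hs : active K (σ z).1 ⊆ jointActive K z := by
      rw [← jointActive_clusterSwap K c' z]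
      exact Set.subset_union_left
    refine and_congr ?_ ?_
    · refine hp _ _ (jointActive K z) hs Set.subset_union_left fun i hi => ?_
      exact if_neg (Set.disjoint_left.1 (hG _ hz) hi)
    · refine hq _ _ (jointActive K z) hs Set.subset_union_right fun i hi => ?_
      exact if_pos hi
  rw [h1, ← prob_prod_and p q, abs_sub_le_iff]
  constructor
  · rw [sub_le_iff_le_add']
    refine prob_le_add fun z hz => ?_
    by_cases h : G (jointActive K z)
    · exact Or.inl ((key z h).1 hz)
    · exact Or.inr h
  · rw [sub_le_iff_le_add']
    refine prob_le_add fun z hz => ?_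
    by_cases h : G (jointActive K z)
    · exact Or.inl ((key z h).2 hz)
    · exact Or.inr h

theorem abs_prob_forall_sub_prod_le {κ : Type*} {K : ℕ} (J : Finset κ) {c : κ → Set ι → Set ι}
    {p : κ → (ι → Fin N) → Prop} (h : ∀ j ∈ J, IsLocal K (c j) (p j)) {G : Set ι → Prop}
    (hG : ∀ R, G R → ∀ j ∈ J, ∀ k ∈ J, j ≠ k → Disjoint (c j R) (c k R)) :
    |prob (fun x => ∀ j ∈ J, p j x) - ∏ j ∈ J, prob (p j)| ≤
      J.card * prob fun z : (ι → Fin N) × (ι → Fin N) => ¬ G (jointActive K z) := by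
  classical
  induction J using Finset.induction_on with
  | empty => simp [prob_true]
  | insert a J ha ih =>
    set β := prob fun z : (ι → Fin N) × (ι → Fin N) => ¬ G (jointActive K z)
    have h1 := ih (fun j hj => h j (mem_insert_of_mem hj))
      (fun R hR j hj k hk => hG R hR j (mem_insert_of_mem hj) k (mem_insert_of_mem hk))
    have h2 := abs_prob_and_sub_le (h a (mem_insert_self _ _))
      (IsLocal.forall fun j hj => h j (mem_insert_of_mem hj)) (G := G) (fun R hR => by
        rw [Set.disjoint_left]
        rintro i hi ⟨j, hj, hij⟩
        exact Set.disjoint_left.1 (hG R hR a (mem_insert_self _ _) j (mem_insert_of_mem hj)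
          (fun e => ha (e ▸ hj))) hi hij)
    have h3 : prob (fun x => ∀ j ∈ insert a J, p j x) =
        prob (fun x => p a x ∧ ∀ j ∈ J, p j x) := prob_congr fun x => forall_mem_insert _ _ _
    rw [prod_insert ha, card_insert_of_notMem ha, h3]
    have h4 : |prob (p a) * prob (fun x => ∀ j ∈ J, p j x) - prob (p a) * ∏ j ∈ J, prob (p j)| ≤
        J.card * β := by
      rw [← mul_sub, abs_mul, abs_of_nonneg (prob_nonneg _)]
      exact (mul_le_of_le_one_left (abs_nonneg _) (prob_le_one _)).trans h1
    refine (abs_sub_le _ (prob (p a) * prob (fun x => ∀ j ∈ J, p j x)) _).trans ?_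
    push_cast
    linarith

end Independence

section Clusters

variable {V : Type*} [DecidableEq V] {t d N : ℕ}

/-- The edges reached in at most `K` steps. -/
def cluster (t d K : ℕ) (St : Set (Finset V) → Finset (Finset V) → Prop) (R : Set (Finset V)) :
    Set (Finset V) :=
  {f | ∃ l ≤ K, ∃ F, Gen t d R (St R) l F ∧ f ∈ F}

/-- The marks of a point with the edges of `S` muted. -/
def marks (K : ℕ) (S : Finset (Finset V)) (x : Finset V → Fin N) : Finset V → ℕ :=
  mute K S fun f => x f

theorem marks_lt {K : ℕ} {S : Finset (Finset V)} {x : Finset V → Fin N} {R : Set (Finset V)}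
    (h : active K x ⊆ R) (f : Finset V) (hf : marks K S x f < K) : f ∈ R := by
  refine h ?_
  by_cases hS : f ∈ S
  · rw [marks, mute_of_mem hS] at hf; omega
  · rw [marks, mute_of_notMem hS] at hf; exact hf

theorem marks_eq {K : ℕ} {S : Finset (Finset V)} {x y : Finset V → Fin N} {f : Finset V}
    (h : x f = y f) : marks K S x f = marks K S y f := by
  simp only [marks, mute, h]

theorem isLocal_blocked {K i : ℕ} (S : Finset (Finset V)) (e : Finset V) (hi : i < K) :
    IsLocal (N := N) K (cluster t d K fun R => EdgeStart t d R e 2)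
      (fun x => Blocked t d (marks K S x) i e) := by
  intro x y R hx hy hxy
  refine blk_congr_of_gen (marks_lt hx) (marks_lt hy) hi fun l hl F hF f hf => marks_eq ?_
  exact hxy f ⟨l, hl, F, hF, hf⟩

theorem isLocal_threat {K i s : ℕ} (S : Finset (Finset V)) (e : Finset V) (hi : i ≤ K) :
    IsLocal (N := N) K (cluster t d K fun R => EdgeStart t d R e s)
      (fun x => Threat t d s (marks K S x) i e) := by
  intro x y R hx hy hxy
  refine thr_congr_of_gen (marks_lt hx) (marks_lt hy) hi fun l hl F hF f hf => marks_eq ?_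
  exact hxy f ⟨l, hl, F, hF, hf⟩

theorem isLocal_covered {K i : ℕ} (S : Finset (Finset V)) (e T : Finset V) (hi : i ≤ K) :
    IsLocal (N := N) K (cluster t d K fun R => TraceStart t d R e T)
      (fun x => Covered t d (marks K S x) i e T) := by
  intro x y R hx hy hxy
  refine cov_congr_of_gen (marks_lt hx) (marks_lt hy) hi fun l hl F hF f hf => marks_eq ?_
  exact hxy f ⟨l, hl, F, hF, hf⟩

theorem disjoint_cluster {K : ℕ} {W ρ ρ' : Finset V} {R : Set (Finset V)}
    {St St' : Set (Finset V) → Finset (Finset V) → Prop}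
    (hG : Good t d W (6 * (K + 2)) R) (hρ : ρ ⊆ W) (hρ' : ρ' ⊆ W)
    (hSt : ∀ F, St R F → IsStart t d R ρ F) (hSt' : ∀ F, St' R F → IsStart t d R ρ' F)
    (hρρ : (ρ ∩ ρ').card < t) : Disjoint (cluster t d K St R) (cluster t d K St' R) := by
  rw [Set.disjoint_left]
  rintro f ⟨l, hl, F, hF, hf⟩ ⟨l', hl', F', hF', hf'⟩
  exact disjoint_left.1 (hF.disjoint hF' hG hρ hρ' hSt hSt' hρρ (by omega)) hf hf'

theorem disjoint_cluster_trace {K : ℕ} {e T : Finset V} {R : Set (Finset V)}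
    (hG : Good t d e (6 * (K + 2)) R) (hTe : T ⊆ e) (hT : T.card = t) :
    Disjoint (cluster t d K (fun R => EdgeStart t d R e 3) R)
      (cluster t d K (fun R => TraceStart t d R e T) R) := by
  rw [Set.disjoint_left]
  rintro f ⟨l, hl, F, hF, hf⟩ ⟨l', hl', F', hF', hf'⟩
  exact disjoint_left.1 (hF.disjoint_trace hF' hG hTe hT (by omega)) hf hf'

end Clusters

section Counting

variable {V : Type*} [DecidableEq V] [Fintype V]

theorem card_filter_card_le [Nonempty V] (v : ℕ) :
    (univ.filter fun U : Finset V => U.card ≤ v).card ≤ (v + 1) * Fintype.card V ^ v := by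
  have h1 : (univ.filter fun U : Finset V => U.card ≤ v) ⊆
      (range (v + 1)).biUnion fun k => powersetCard k univ := by
    intro U hU
    rw [mem_filter] at hU
    exact mem_biUnion.2 ⟨U.card, mem_range.2 (by omega),
      mem_powersetCard.2 ⟨subset_univ _, rfl⟩⟩
  refine (card_le_card h1).trans ((card_biUnion_le_card_mul _ _ (Fintype.card V ^ v) ?_).trans
    (by rw [card_range]))
  intro k hk
  rw [card_powersetCard, card_univ]
  exact (Nat.choose_le_pow _ _).trans
    (Nat.pow_le_pow_right Fintype.card_pos (Nat.lt_succ_iff.1 (mem_range.1 hk)))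

/-- The number of families spanning few vertices outside a fixed set. -/
theorem card_filter_verts_le [Nonempty V] (W : Finset V) (v : ℕ) :
    (univ.filter fun F : Finset (Finset V) => (verts F \ W).card ≤ v).card ≤
      (v + 1) * Fintype.card V ^ v * 2 ^ 2 ^ (W.card + v) := by
  have h1 : (univ.filter fun F : Finset (Finset V) => (verts F \ W).card ≤ v) ⊆
      (univ.filter fun U : Finset V => U.card ≤ v).biUnion fun U => (W ∪ U).powerset.powerset := by
    intro F hF
    rw [mem_filter] at hF
    refine mem_biUnion.2 ⟨verts F \ W, mem_filter.2 ⟨mem_univ _, hF.2⟩, ?_⟩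
    rw [mem_powerset]
    intro f hf
    rw [mem_powerset, union_sdiff_self_eq_union]
    exact (subset_verts hf).trans subset_union_right
  refine (card_le_card h1).trans ((card_biUnion_le_card_mul _ _ (2 ^ 2 ^ (W.card + v)) ?_).trans
    (Nat.mul_le_mul_right _ (card_filter_card_le v)))
  intro U hU
  rw [card_powerset, card_powerset]
  refine Nat.pow_le_pow_right two_pos (Nat.pow_le_pow_right two_pos ?_)
  exact (card_union_le _ _).trans (Nat.add_le_add_left (mem_filter.1 hU).2 _)

theorem card_mconf_le [Nonempty V] {t d : ℕ} (e : Finset V) (he : e.card = t + d) (s : ℕ)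
    (I : Finset (Finset (Finset V))) (hI : ∀ S ∈ I, MConf t d S ∧ e ∈ S ∧ S.card = s + 1) :
    I.card ≤
      (d * s + 1) * Fintype.card V ^ (d * s) * 2 ^ 2 ^ (t + d + d * s) := by
  rw [← he]
  refine (card_le_card ?_).trans (card_filter_verts_le e (d * s))
  intro S hS
  obtain ⟨hS, heS, hs⟩ := hI S hS
  refine mem_filter.2 ⟨mem_univ _, ?_⟩
  rw [card_sdiff_of_subset (subset_verts heS)]
  have := hS.1.2.2.2
  rw [hs, mul_add] at this
  omega

variable {N : ℕ} [NeZero N]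

theorem prob_forall_active_le (K : ℕ) (F : Finset (Finset V)) :
    prob (fun x : Finset V → Fin N => ∀ f ∈ F, f ∈ active K x) ≤ ((K : ℝ) / N) ^ F.card := by
  have := prob_pi_forall F fun (_ : Finset V) (a : Fin N) => (a : ℕ) < K
  refine (le_of_eq this).trans ?_
  rw [prod_const]
  exact pow_le_pow_left₀ (prob_nonneg _) (prob_fin_lt_le K) _

theorem prob_forall_jointActive_le (K : ℕ) (F : Finset (Finset V)) :
    prob (fun z : (Finset V → Fin N) × (Finset V → Fin N) => ∀ f ∈ F, f ∈ jointActive K z) ≤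
      (2 * K / N : ℝ) ^ F.card := by
  have h1 : prob (fun z : (Finset V → Fin N) × (Finset V → Fin N) =>
      ∀ f ∈ F, f ∈ jointActive K z) ≤ prob (fun z : (Finset V → Fin N) × (Finset V → Fin N) =>
        ∃ F' ∈ F.powerset, (∀ f ∈ F', f ∈ active K z.1) ∧ ∀ f ∈ F \ F', f ∈ active K z.2) := by
    classical
    refine prob_mono fun z hz => ⟨F.filter fun f => f ∈ active K z.1,
      mem_powerset.2 (filter_subset _ _), fun f hf => (mem_filter.1 hf).2, fun f hf => ?_⟩
    rw [Finset.mem_sdiff, mem_filter, not_and] at hf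
    exact (hz f hf.1).resolve_left (hf.2 hf.1)
  refine h1.trans ((prob_exists_le _ _).trans ?_)
  have h2 : ∀ F' ∈ F.powerset, prob (fun z : (Finset V → Fin N) × (Finset V → Fin N) =>
      (∀ f ∈ F', f ∈ active K z.1) ∧ ∀ f ∈ F \ F', f ∈ active K z.2) ≤
        ((K : ℝ) / N) ^ F.card := by
    intro F' hF'
    rw [prob_prod_and (fun x : Finset V → Fin N => ∀ f ∈ F', f ∈ active K x)
      fun x : Finset V → Fin N => ∀ f ∈ F \ F', f ∈ active K x]
    rw [← card_sdiff_add_card_eq_card (mem_powerset.1 hF'), add_comm, pow_add]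
    exact mul_le_mul (prob_forall_active_le K F') (prob_forall_active_le K _) (prob_nonneg _)
      (by positivity)
  refine (sum_le_sum h2).trans (le_of_eq ?_)
  rw [sum_const, card_powerset, nsmul_eq_mul, mul_div_assoc, mul_pow]
  push_cast
  rfl

/-- The jointly active edges are sparse with high probability. -/
theorem exists_prob_not_good_le (t d w b K : ℕ) : ∃ C : ℝ, 0 ≤ C ∧
    ∀ (n N : ℕ) [NeZero n] [NeZero N], n ^ d ≤ N → ∀ W : Finset (Fin n), W.card ≤ w →
      prob (fun z : (Finset (Fin n) → Fin N) × (Finset (Fin n) → Fin N) =>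
        ¬ Good t d W b (jointActive K z)) ≤ C / n := by
  set A : ℕ → ℝ := fun s => (2 * K : ℝ) ^ s * ((d * s + 1) * 2 ^ 2 ^ (w + d * s))
  refine ⟨∑ s ∈ range (b + 1), A s, sum_nonneg fun s _ => by positivity, ?_⟩
  intro n N hn hN hNn W hW
  have hn0 : (0 : ℝ) < n := by exact_mod_cast Nat.pos_of_ne_zero hn.out
  have hN0 : (0 : ℝ) < N := by exact_mod_cast Nat.pos_of_ne_zero hN.out
  set I : ℕ → Finset (Finset (Finset (Fin n))) := fun s =>
    univ.filter fun F => F.card = s ∧ (verts F \ W).card + 1 ≤ d * s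
  have h1 : prob (fun z : (Finset (Fin n) → Fin N) × (Finset (Fin n) → Fin N) =>
        ¬ Good t d W b (jointActive K z)) ≤
      prob (fun z : (Finset (Fin n) → Fin N) × (Finset (Fin n) → Fin N) =>
        ∃ s ∈ range (b + 1), ∃ F ∈ I s, ∀ f ∈ F, f ∈ jointActive K z) := by
    refine prob_mono fun z hz => ?_
    simp only [Good] at hz
    push Not at hz
    obtain ⟨F, hF, hne, hb, hlt⟩ := hz
    exact ⟨F.card, mem_range.2 (by omega), F, mem_filter.2 ⟨mem_univ _, rfl, hlt⟩,
      fun f hf => (hF f hf).1⟩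
  refine h1.trans ((prob_exists_le _ _).trans ?_)
  rw [sum_div]
  refine sum_le_sum fun s _ => ?_
  refine (prob_exists_le _ _).trans ?_
  have h2 : ∀ F ∈ I s, prob (fun z : (Finset (Fin n) → Fin N) × (Finset (Fin n) → Fin N) =>
      ∀ f ∈ F, f ∈ jointActive K z) ≤ (2 * K / n ^ d : ℝ) ^ s := by
    intro F hF
    refine (prob_forall_jointActive_le K F).trans ?_
    rw [(mem_filter.1 hF).2.1]
    refine pow_le_pow_left₀ (by positivity) ?_ _
    exact div_le_div_of_nonneg_left (by positivity) (by positivity) (by exact_mod_cast hNn)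
  refine (sum_le_sum h2).trans ?_
  rw [sum_const, nsmul_eq_mul]
  rcases Nat.eq_zero_or_pos (d * s) with h0 | hpos
  · have : I s = ∅ := by
      refine filter_eq_empty_iff.2 ?_
      rintro F - ⟨-, h⟩
      omega
    rw [this]
    simp only [card_empty, Nat.cast_zero, zero_mul]
    positivity
  · have h3 : (I s).card ≤ (d * s - 1 + 1) * n ^ (d * s - 1) * 2 ^ 2 ^ (W.card + (d * s - 1)) := by
      have := card_filter_verts_le W (d * s - 1)
      rw [Fintype.card_fin] at this
      refine (card_le_card ?_).trans this
      intro F hF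
      have := (mem_filter.1 hF).2.2
      exact mem_filter.2 ⟨mem_univ _, by omega⟩
    have h4 : (I s).card ≤ (d * s + 1) * n ^ (d * s - 1) * 2 ^ 2 ^ (w + d * s) := by
      refine h3.trans (Nat.mul_le_mul (Nat.mul_le_mul_right _ (by omega)) ?_)
      exact Nat.pow_le_pow_right two_pos (Nat.pow_le_pow_right two_pos (by omega))
    have h5 : ((I s).card : ℝ) ≤ (d * s + 1) * n ^ (d * s - 1) * 2 ^ 2 ^ (w + d * s) := by
      exact_mod_cast h4
    refine (mul_le_mul_of_nonneg_right h5 (by positivity)).trans (le_of_eq ?_)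
    obtain ⟨v, hv⟩ : ∃ v, d * s = v + 1 := ⟨d * s - 1, by omega⟩
    simp only [A]
    rw [div_pow, ← pow_mul, hv, Nat.add_sub_cancel, pow_succ]
    field_simp

end Counting

section Symmetry

variable {V : Type*} [DecidableEq V] {t d : ℕ}

theorem verts_finsetCongr (σ : Equiv.Perm V) (S : Finset (Finset V)) :
    verts (σ.finsetCongr.finsetCongr S) = σ.finsetCongr (verts S) := by
  ext x
  simp only [mem_verts, Equiv.finsetCongr_apply, Finset.mem_map, Equiv.coe_toEmbedding]
  constructor
  · rintro ⟨_, ⟨e, he, rfl⟩, hx⟩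
    obtain ⟨y, hy, rfl⟩ := Finset.mem_map.1 hx
    exact ⟨y, ⟨e, he, hy⟩, rfl⟩
  · rintro ⟨y, ⟨e, he, hy⟩, rfl⟩
    exact ⟨_, ⟨e, he, rfl⟩, Finset.mem_map.2 ⟨y, hy, rfl⟩⟩

theorem Conf.finsetCongr (σ : Equiv.Perm V) {S : Finset (Finset V)} (h : Conf t d S) :
    Conf t d (σ.finsetCongr.finsetCongr S) := by
  have hc : (σ.finsetCongr.finsetCongr S).card = S.card := by simp
  have hv : (verts (σ.finsetCongr.finsetCongr S)).card = (verts S).card := by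
    rw [verts_finsetCongr]; simp
  refine ⟨?_, by rw [hc]; exact h.2.1, by rw [hc]; exact h.2.2.1, by rw [hc, hv]; exact h.2.2.2⟩
  intro e he
  rw [Equiv.finsetCongr_apply, Finset.mem_map] at he
  obtain ⟨f, hf, rfl⟩ := he
  simp [h.1 f hf]

theorem MConf.finsetCongr (σ : Equiv.Perm V) {S : Finset (Finset V)} (h : MConf t d S) :
    MConf t d (σ.finsetCongr.finsetCongr S) := by
  refine ⟨h.1.finsetCongr σ, fun B hB hC => ?_⟩
  refine h.2 (σ.symm.finsetCongr.finsetCongr B) ?_ (hC.finsetCongr σ.symm)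
  have h1 : S = σ.symm.finsetCongr.finsetCongr (σ.finsetCongr.finsetCongr S) :=
    (σ.finsetCongr.finsetCongr.symm_apply_apply S).symm
  rw [h1]
  simp only [Equiv.finsetCongr_apply] at hB ⊢
  exact Finset.map_ssubset_map.2 hB

theorem mconf_finsetCongr (σ : Equiv.Perm V) (S : Finset (Finset V)) :
    MConf t d S ↔ MConf t d (σ.finsetCongr.finsetCongr S) := by
  refine ⟨fun h => h.finsetCongr σ, fun h => ?_⟩
  have := h.finsetCongr σ.symm
  exact (σ.finsetCongr.finsetCongr.symm_apply_apply S) ▸ this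

theorem acc_finsetCongr (σ : Equiv.Perm V) (m : Finset V → ℕ) (i : ℕ) (e : Finset V) :
    Accepted t d (fun f => m (σ.finsetCongr f)) i e ↔ Accepted t d m i (σ.finsetCongr e) := by
  induction i generalizing e with
  | zero => simp [Accepted]
  | succ i ih =>
    rw [acc_succ, acc_succ, ih]
    have hc : (σ.finsetCongr e).card = e.card := by simp
    rw [hc]
    refine or_congr_right (and_congr_right fun _ => and_congr_right fun _ => not_congr ?_)
    refine σ.finsetCongr.finsetCongr.exists_congr fun S => ?_
    refine and_congr (mconf_finsetCongr σ S) (and_congr ?_ ?_)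
    · rw [Equiv.finsetCongr_apply σ.finsetCongr, Finset.mem_map]
      constructor
      · exact fun he => ⟨e, he, rfl⟩
      · rintro ⟨f, hf, hfe⟩
        rwa [← σ.finsetCongr.injective hfe]
    · rw [Equiv.finsetCongr_apply σ.finsetCongr]
      simp only [Finset.mem_map, Equiv.coe_toEmbedding, forall_exists_index, and_imp,
        forall_apply_eq_imp_iff₂, ne_eq, EmbeddingLike.apply_eq_iff_eq]
      exact forall₂_congr fun f _ => imp_congr_right fun _ => or_congr_left (ih f)

theorem exists_perm_finsetCongr [Fintype V] {e f : Finset V} (h : e.card = f.card) :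
    ∃ σ : Equiv.Perm V, σ.finsetCongr e = f := by
  set τ : {x // x ∈ e} ≃ {x // x ∈ f} := Finset.equivOfCardEq h
  refine ⟨τ.extendSubtype, ?_⟩
  refine eq_of_subset_of_card_le ?_ (by simp [h])
  intro x hx
  rw [Equiv.finsetCongr_apply, Finset.mem_map] at hx
  obtain ⟨y, hy, rfl⟩ := hx
  exact τ.extendSubtype_mem y hy

/-- Distinct accepted edges do not share `t` vertices. -/
theorem Accepted.eq_of_subset {i : ℕ} {e f : Finset V} {m : Finset V → ℕ} {T : Finset V} (hf : Accepted t d m i f)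
    (he : Accepted t d m i e) (hT : T.card = t) (hTf : T ⊆ f) (hTe : T ⊆ e) : f = e := by
  by_contra hne
  have hC : Conf t d {f, e} := by
    refine ⟨?_, by rw [card_pair hne], by rw [card_pair hne]; omega, ?_⟩
    · intro g hg
      rcases mem_insert.1 hg with rfl | hg
      · exact hf.card
      · rw [mem_singleton.1 hg]; exact he.card
    · rw [verts_insert, verts_singleton, card_pair hne]
      have h1 := card_union_add_card_inter f e
      have h2 := card_le_card (subset_inter hTf hTe)
      rw [hf.card, he.card] at h1
      omega
  obtain ⟨B, hB, hM⟩ := exists_mconf_subset hC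
  refine not_forall_acc_of_mconf (m := m) (i := i) hM fun g hg => ?_
  rcases mem_insert.1 (hB hg) with rfl | hg
  · exact hf
  · rw [mem_singleton.1 hg]; exact he

end Symmetry

section Quantities

variable {V : Type*} [DecidableEq V] [Fintype V]

/-- The probability that the edge `e` is accepted during the first `i` rounds. -/
noncomputable def accProb (t d N i : ℕ) (e : Finset V) : ℝ :=
  prob fun x : Finset V → Fin N => Accepted t d (fun f => x f) i e

/-- The probability that the edge `e` is not blocked in round `i`. -/
noncomputable def freeProb (t d K N i : ℕ) (e : Finset V) : ℝ :=
  prob fun x : Finset V → Fin N => ¬ Blocked t d (marks K {e} x) i e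

/-- The probability that the edge `e` does not complete a configuration of at least three
edges in round `i`. -/
noncomputable def safeProb (t d K N i : ℕ) (e : Finset V) : ℝ :=
  prob fun x : Finset V → Fin N => ¬ Threat t d 3 (marks K {e} x) i e

variable {t d K N i : ℕ} {e f : Finset V}

theorem accProb_nonneg : 0 ≤ accProb t d N i e := prob_nonneg _

theorem accProb_zero : accProb t d N 0 e = 0 := prob_false

theorem accProb_eq (h : e.card = f.card) : accProb t d N i e = accProb t d N i f := by
  obtain ⟨σ, rfl⟩ := exists_perm_finsetCongr h
  rw [accProb, ← prob_equiv (Equiv.arrowCongr σ.finsetCongr.symm (Equiv.refl (Fin N)))]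
  refine prob_congr fun x => ?_
  rw [← acc_finsetCongr]
  rfl

theorem accProb_succ (hN : 0 < N) (he : e.card = t + d) (hi : i < K) (hK : K ≤ N) :
    accProb t d N (i + 1) e = accProb t d N i e + freeProb t d K N i e / N := by
  have : NeZero N := ⟨hN.ne'⟩
  have h1 : prob (fun x : Finset V → Fin N => (x e : ℕ) = i ∧ ¬ Blocked t d (marks K {e} x) i e) =
      freeProb t d K N i e / N := by
    have := prob_pi_forall_and {e} (fun _ (a : Fin N) => (a : ℕ) = i)
      (fun x : Finset V → Fin N => ¬ Blocked t d (marks K {e} x) i e) (fun a x => by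
        rw [show marks K {e} (piecewise {e} a x) = marks K {e} x from
          mute_congr fun f hf => by rw [piecewise_eq_of_notMem _ _ _ hf]])
    rw [prod_singleton, prob_fin_eq (by omega)] at this
    rw [freeProb, div_eq_inv_mul, ← one_div, ← this]
    exact prob_congr fun x => by simp
  rw [← h1, accProb, accProb, ← prob_or_of_disjoint]
  · refine prob_congr fun x => ?_
    rw [acc_succ_iff hi]
    simp only [he, true_and]
    rfl
  · intro x h hx
    have := h.lt
    omega

theorem accProb_mono {j : ℕ} (h : i ≤ j) : accProb t d N i e ≤ accProb t d N j e :=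
  prob_mono fun _ hx => hx.mono h

theorem accProb_eq_sum (hN : 0 < N) (he : e.card = t + d) (hi : i ≤ K) (hK : K ≤ N) :
    accProb t d N i e = ∑ j ∈ range i, freeProb t d K N j e / N := by
  induction i with
  | zero => simp [accProb_zero]
  | succ i ih => rw [accProb_succ hN he (by omega) hK, ih (by omega), sum_range_succ]

/-- The edges containing `T`. -/
def starEdges (t d : ℕ) (T : Finset V) : Finset (Finset V) :=
  (powersetCard (t + d) univ).filter fun f => T ⊆ f

theorem card_starEdges {T : Finset V} (hT : T.card = t) :
    (starEdges t d T).card = (Fintype.card V - t).choose d := by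
  have h1 : (starEdges t d T).card = (powersetCard d (univ \ T)).card := by
    refine card_bij' (fun f _ => f \ T) (fun g _ => g ∪ T) ?_ ?_ ?_ ?_
    · intro f hf
      rw [starEdges, mem_filter, mem_powersetCard] at hf
      rw [mem_powersetCard, card_sdiff_of_subset hf.2, hf.1.2, hT]
      exact ⟨sdiff_subset_sdiff (subset_univ _) Subset.rfl, by omega⟩
    · intro g hg
      rw [mem_powersetCard] at hg
      have : Disjoint g T := disjoint_of_subset_left hg.1 sdiff_disjoint
      rw [starEdges, mem_filter, mem_powersetCard, card_union_of_disjoint this, hT, hg.2]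
      exact ⟨⟨subset_univ _, add_comm _ _⟩, subset_union_right⟩
    · intro f hf
      rw [starEdges, mem_filter] at hf
      exact sdiff_union_of_subset hf.2
    · intro g hg
      rw [mem_powersetCard] at hg
      have : Disjoint g T := disjoint_of_subset_left hg.1 sdiff_disjoint
      rw [union_sdiff_right, sdiff_eq_self_of_disjoint this]
  rw [h1, card_powersetCard, card_sdiff_of_subset (subset_univ _), hT, card_univ]

theorem sum_starEdges_accProb {T : Finset V} (hT : T.card = t) (he : e.card = t + d) :
    ∑ f ∈ starEdges t d T, accProb t d N i f =
      (Fintype.card V - t).choose d * accProb t d N i e := by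
  rw [← card_starEdges hT, ← nsmul_eq_mul, ← sum_const]
  refine sum_congr rfl fun f hf => accProb_eq ?_
  rw [he]
  exact (mem_powersetCard.1 (mem_filter.1 hf).1).2

theorem choose_mul_accProb_le (he : e.card = t + d) :
    (Fintype.card V - t).choose d * accProb t d N i e ≤ 1 := by
  obtain ⟨T, hTe, hT⟩ := exists_subset_card_eq (show t ≤ e.card by omega)
  rw [← sum_starEdges_accProb hT he]
  unfold accProb
  rw [← prob_exists_of_disjoint]
  · exact prob_le_one _
  · intro f hf g hg hne x h1 h2
    exact hne (h1.eq_of_subset h2 hT (mem_filter.1 hf).2 (mem_filter.1 hg).2)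

theorem prob_active_le [NeZero N] (e : Finset V) :
    prob (fun x : Finset V → Fin N => (x e : ℕ) < K) ≤ K / N := by
  have := prob_forall_active_le (N := N) K {e}
  simpa [active] using this

theorem prob_exists_active_le [NeZero N] (S : Finset (Finset V)) :
    prob (fun x : Finset V → Fin N => ∃ e ∈ S, (x e : ℕ) < K) ≤ S.card * (K / N) := by
  refine (prob_exists_le _ _).trans ((sum_le_sum fun e _ => prob_active_le e).trans ?_)
  rw [sum_const, nsmul_eq_mul]

theorem prob_not_covered_ge [NeZero N] {T : Finset V} (hT : T.card = t)
    (he : e.card = t + d) (hi : i ≤ K) :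
    1 - (Fintype.card V - t).choose d * accProb t d N i e - K / N ≤
      prob fun x : Finset V → Fin N => ¬ Covered t d (marks K {e} x) i e T := by
  rw [prob_not]
  have h1 : prob (fun x : Finset V → Fin N => Covered t d (marks K {e} x) i e T) ≤
      prob (fun x : Finset V → Fin N => ∃ f ∈ starEdges t d T, Accepted t d (fun f => x f) i f) +
      prob (fun x : Finset V → Fin N => (x e : ℕ) < K) := by
    refine prob_le_add ?_
    rintro x ⟨f, hf, hA⟩
    by_cases hx : (x e : ℕ) < K
    · exact Or.inr hx
    · refine Or.inl ⟨f, mem_filter.2 ⟨mem_powersetCard.2 ⟨subset_univ _, hA.card⟩, ?_⟩, ?_⟩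
      · rw [← hf]; exact inter_subset_left
      · refine (acc_mute hi ?_ f).1 hA
        intro g hg
        rw [mem_singleton.1 hg]
        omega
  have h2 := (prob_exists_le (starEdges t d T)
    fun f (x : Finset V → Fin N) => Accepted t d (fun f => x f) i f)
  have h3 := sum_starEdges_accProb (N := N) (i := i) hT he
  unfold accProb at h3 ⊢
  have h4 := prob_active_le (K := K) (N := N) e
  linarith

end Quantities

theorem prod_le_prod_add_card_mul {κ : Type*} (J : Finset κ) {f g : κ → ℝ} {η : ℝ}
    (hf : ∀ j ∈ J, 0 ≤ f j ∧ f j ≤ 1) (hg : ∀ j ∈ J, 0 ≤ g j ∧ g j ≤ 1) (hη : 0 ≤ η)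
    (h : ∀ j ∈ J, f j ≤ g j + η) : ∏ j ∈ J, f j ≤ ∏ j ∈ J, g j + J.card * η := by
  classical
  induction J using Finset.induction_on with
  | empty => simp
  | insert a J ha ih =>
    have h1 := ih (fun j hj => hf j (mem_insert_of_mem hj)) (fun j hj => hg j (mem_insert_of_mem hj))
      (fun j hj => h j (mem_insert_of_mem hj))
    have h2 := h a (mem_insert_self _ _)
    have h3 := hg a (mem_insert_self _ _)
    have h4 : ∏ j ∈ J, f j ≤ 1 := prod_le_one (fun j hj => (hf j (mem_insert_of_mem hj)).1)
      fun j hj => (hf j (mem_insert_of_mem hj)).2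
    have h5 : 0 ≤ ∏ j ∈ J, f j := prod_nonneg fun j hj => (hf j (mem_insert_of_mem hj)).1
    rw [prod_insert ha, prod_insert ha, card_insert_of_notMem ha]
    push_cast
    have h6 : f a * ∏ j ∈ J, f j ≤ (g a + η) * ∏ j ∈ J, f j := mul_le_mul_of_nonneg_right h2 h5
    have h7 : g a * ∏ j ∈ J, f j ≤ g a * (∏ j ∈ J, g j + J.card * η) :=
      mul_le_mul_of_nonneg_left h1 h3.1
    have h8 : η * ∏ j ∈ J, f j ≤ η := mul_le_of_le_one_right hη h4
    have h9 : g a * (J.card * η) ≤ J.card * η := mul_le_of_le_one_left (by positivity) h3.2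
    nlinarith

section Completion

variable {V : Type*} [DecidableEq V] {t d K N i s : ℕ} {e f h : Finset V}
  {S : Finset (Finset V)}

theorem marks_eq_of_lt {j : ℕ} {x : Finset V → Fin N} (he : e ∈ S) (hS : ∀ f ∈ S, K ≤ x f)
    (hj : j < K) (f : Finset V) (hf : marks K S x f ≤ j ∨ marks K {e} x f ≤ j) :
    marks K S x f = marks K {e} x f := by
  by_cases hfS : f ∈ S
  · exfalso
    have h1 : marks K S x f = K := mute_of_mem hfS
    have h2 : K ≤ marks K {e} x f := by
      by_cases hfe : f ∈ ({e} : Finset (Finset V))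
      · exact (mute_of_mem hfe).ge
      · rw [marks, mute_of_notMem hfe]; exact hS f hfS
    omega
  · have hfe : f ∉ ({e} : Finset (Finset V)) := by
      rw [mem_singleton]; rintro rfl; exact hfS he
    rw [marks, marks, mute_of_notMem hfS, mute_of_notMem hfe]

theorem threat_marks_iff {x : Finset V → Fin N} (he : e ∈ S) (hS : ∀ f ∈ S, K ≤ x f)
    (hi : i ≤ K) : Threat t d s (marks K S x) i e ↔ Threat t d s (marks K {e} x) i e := by
  have : ∀ f, Accepted t d (marks K S x) i f ↔ Accepted t d (marks K {e} x) i f := by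
    refine acc_congr fun f hf => ?_
    exact marks_eq_of_lt (j := i - 1) he hS (by omega) f (by omega)
  simp only [Threat, this]

theorem blocked_marks_iff {x : Finset V → Fin N} (he : e ∈ S) (hS : ∀ f ∈ S, K ≤ x f)
    (hi : i < K) : Blocked t d (marks K S x) i e ↔ Blocked t d (marks K {e} x) i e := by
  refine blk_congr (fun f _ hf => marks_eq_of_lt he hS hi f hf) ?_ ?_
  · exact hi.le.trans (mute_of_mem he).ge
  · exact hi.le.trans (mute_of_mem (mem_singleton_self e)).ge

variable [Fintype V] [NeZero N]

theorem prob_not_threat_le (he : e ∈ S) (hi : i ≤ K) :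
    prob (fun x : Finset V → Fin N => ¬ Threat t d 3 (marks K S x) i e) ≤
      safeProb t d K N i e + S.card * (K / N) := by
  refine (prob_le_add (r := fun x : Finset V → Fin N => ∃ f ∈ S, (x f : ℕ) < K) ?_).trans
    (add_le_add_right (prob_exists_active_le S) _)
  intro x hx
  by_cases hS : ∃ f ∈ S, (x f : ℕ) < K
  · exact Or.inr hS
  · push Not at hS
    exact Or.inl (by rwa [← threat_marks_iff he hS hi])

theorem prob_not_blocked_le (he : e ∈ S) (hi : i < K) :
    prob (fun x : Finset V → Fin N => ¬ Blocked t d (marks K S x) i e) ≤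
      freeProb t d K N i e + S.card * (K / N) := by
  refine (prob_le_add (r := fun x : Finset V → Fin N => ∃ f ∈ S, (x f : ℕ) < K) ?_).trans
    (add_le_add_right (prob_exists_active_le S) _)
  intro x hx
  by_cases hS : ∃ f ∈ S, (x f : ℕ) < K
  · exact Or.inr hS
  · push Not at hS
    exact Or.inl (by rwa [← blocked_marks_iff he hS hi])

/-- The minimal configuration `S` is completed up to `e` by the edge `f` in round `i`. -/
def Completes (t d K : ℕ) (S : Finset (Finset V)) (e f : Finset V) (i : ℕ)
    (x : Finset V → Fin N) : Prop :=
  ¬ Threat t d 3 (marks K {e} x) i e ∧ (x f : ℕ) = i ∧ ¬ Blocked t d (marks K {e} x) i f ∧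
    ∀ g ∈ S, g ≠ e → g ≠ f → Accepted t d (marks K {e} x) i g

/-- The probability that the jointly active edges are dense relative to `W`. -/
noncomputable def denseProb (t d K N : ℕ) (W : Finset V) : ℝ :=
  prob fun z : (Finset V → Fin N) × (Finset V → Fin N) =>
    ¬ Good t d W (6 * (K + 2)) (jointActive K z)

theorem prob_not_good_active_le (W : Finset V) :
    prob (fun x : Finset V → Fin N => ¬ Good t d W (6 * (K + 2)) (active K x)) ≤
      denseProb t d K N W := by
  rw [← prob_fst (Ω' := Finset V → Fin N)
    fun x : Finset V → Fin N => ¬ Good t d W (6 * (K + 2)) (active K x)]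
  exact prob_mono fun z hz h => hz (h.mono Set.subset_union_left)

theorem Good.notMem {W : Finset V} {b : ℕ} {R : Set (Finset V)} (hG : Good t d W b R)
    (hd : 1 ≤ d) (hb : 1 ≤ b) (hf : f.card = t + d) (hfW : f ⊆ W) : f ∉ R := by
  intro hR
  have := hG {f} (by simp [hR, hf]) (by simp) (by simpa using hb)
  rw [verts_singleton, sdiff_eq_empty_iff_subset.2 hfW, card_singleton, card_empty] at this
  omega

/-- The event attached to the edge `h` of a configuration completed up to `e`. -/
def Unhindered (t d K : ℕ) (S : Finset (Finset V)) (e : Finset V) (i : ℕ) (a : Finset V → Fin N)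
    (h : Finset V) (x : Finset V → Fin N) : Prop :=
  if h = e then ¬ Threat t d 3 (marks K S x) i e else ¬ Blocked t d (marks K S x) (a h) h

theorem Completes.unhindered (hd : 1 ≤ d) (hS : MConf t d S) (he : e ∈ S) (hf : f ∈ S)
    (hef : e ≠ f) (hi : i < K) {a x : Finset V → Fin N}
    (hG : Good t d (verts S) (6 * (K + 2)) (active K x))
    (hC : Completes t d K S e f i (S.piecewise a x)) (h : Finset V) (hh : h ∈ S) :
    Unhindered t d K S e i a h x := by
  obtain ⟨h1, h2, h3, h4⟩ := hC
  set m' := marks K {e} (S.piecewise a x) with hm'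
  have hx : ∀ g ∈ S, g ≠ e → m' g = a g := by
    intro g hg hge
    rw [hm', marks, mute_of_notMem (by simpa using hge), piecewise_eq_of_mem _ _ _ hg]
  have hme : m' e = K := mute_of_mem (mem_singleton_self e)
  have hmf : m' f = i := by
    rw [hx f hf hef.symm, ← h2, piecewise_eq_of_mem _ _ _ hf]
  have hR : ∀ g ∈ S, g ∉ active K x := fun g hg =>
    hG.notMem hd (by omega) (hS.1.1 g hg) (subset_verts hg)
  have hm : ∀ g, marks K S x g < K → g ∈ active K x := marks_lt Set.Subset.rfl
  have hmm : ∀ g, g ∉ S → marks K S x g = m' g := by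
    intro g hg
    have hge : g ∉ ({e} : Finset (Finset V)) := by
      rw [mem_singleton]; rintro rfl; exact hg he
    rw [hm', marks, marks, mute_of_notMem hg, mute_of_notMem hge, piecewise_eq_of_notMem _ _ _ hg]
  unfold Unhindered
  split_ifs with hhe
  · exact fun hT => h1 (thr_of_mconf hS hG (by omega) hR hm hmm he hf hef hi.le
      (by omega) (by omega) hT)
  · by_cases hhf : h = f
    · subst hhf
      have : (a h : ℕ) = i := by rw [← hx h hh hhe, hmf]
      rw [this]
      exact fun hB => h3 (blk_of_mconf hS hG (by omega) hR hm hmm hf he hef.symm hi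
        (by omega) (by omega) hB)
    · have hA := acc_iff.1 (h4 h hh hhe hhf)
      rw [hx h hh hhe] at hA
      exact fun hB => hA.2.2 (blk_of_mconf hS hG (by omega) hR hm hmm hh hf hhf (by omega)
        (by rw [hx h hh hhe]) (by omega) hB)

theorem isLocal_unhindered (S : Finset (Finset V)) (e : Finset V) (hi : i ≤ K)
    (a : Finset V → Fin N) (h : Finset V) (ha : h ≠ e → (a h : ℕ) < K) :
    IsLocal K (cluster t d K fun R => EdgeStart t d R h (if h = e then 3 else 2))
      (Unhindered (N := N) t d K S e i a h) := by
  unfold Unhindered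
  by_cases hhe : h = e
  · simp only [if_pos hhe]
    subst hhe
    exact (isLocal_threat S h hi).not
  · simp only [if_neg hhe]
    exact (isLocal_blocked S h (ha hhe)).not

/-- The marks allowed for an edge of a configuration completed by `f` in round `i`. -/
def markOk (f : Finset V) (i : ℕ) (h : Finset V) (j : ℕ) : Prop := if h = f then j = i else j < i

theorem prob_completes_piecewise_le (hd : 1 ≤ d) (hS : MConf t d S) (h3 : 3 ≤ S.card) (he : e ∈ S)
    (hf : f ∈ S) (hef : e ≠ f) (hi : i < K) (a : Finset V → Fin N)
    (ha : ∀ h ∈ S.erase e, markOk f i h (a h)) :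
    prob (fun x => Completes t d K S e f i (S.piecewise a x)) ≤
      safeProb t d K N i e * ∏ h ∈ S.erase e, freeProb t d K N (a h) h +
        ((S.card + 1) * denseProb t d K N (verts S) + S.card * (S.card * (K / N))) := by
  have hlt : ∀ h ∈ S, h ≠ e → (a h : ℕ) < K := by
    intro h hh hhe
    have := ha h (mem_erase.2 ⟨hhe, hh⟩)
    unfold markOk at this
    split_ifs at this <;> omega
  have h1 : prob (fun x => Completes t d K S e f i (S.piecewise a x)) ≤
      prob (fun x => ∀ h ∈ S, Unhindered t d K S e i a h x) + denseProb t d K N (verts S) := by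
    refine (prob_le_add fun x hx => ?_).trans
      (add_le_add_right (prob_not_good_active_le (N := N) (verts S)) _)
    by_cases hG : Good t d (verts S) (6 * (K + 2)) (active K x)
    · exact Or.inl fun h hh => hx.unhindered hd hS he hf hef hi hG h hh
    · exact Or.inr hG
  have h2 := abs_prob_forall_sub_prod_le (N := N) S
    (fun h hh => isLocal_unhindered (t := t) (d := d) S e hi.le a h (hlt h hh))
    (G := Good t d (verts S) (6 * (K + 2))) (fun R hR h hh k hk hhk =>
      disjoint_cluster hR (subset_verts hh) (subset_verts hk) (fun F hF => EdgeStart.isStart hF)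
        (fun F hF => EdgeStart.isStart hF) (hS.card_inter_lt h3 hh hk hhk))
  have h4 := (abs_sub_le_iff.1 h2).1
  have h5 : ∏ h ∈ S, prob (Unhindered (N := N) t d K S e i a h) ≤
      ∏ h ∈ S, (if h = e then safeProb t d K N i e else freeProb t d K N (a h) h) +
        S.card * (S.card * (K / N)) := by
    refine prod_le_prod_add_card_mul S (fun h _ => ⟨prob_nonneg _, prob_le_one _⟩) ?_
      (by positivity) ?_
    · intro h _
      split_ifs
      · exact ⟨prob_nonneg _, prob_le_one _⟩
      · exact ⟨prob_nonneg _, prob_le_one _⟩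
    · intro h hh
      unfold Unhindered
      split_ifs with hhe
      · exact prob_not_threat_le he hi.le
      · exact prob_not_blocked_le hh (hlt h hh hhe)
  have h6 : ∏ h ∈ S, (if h = e then safeProb t d K N i e else freeProb t d K N (a h) h) =
      safeProb t d K N i e * ∏ h ∈ S.erase e, freeProb t d K N (a h) h := by
    rw [← mul_prod_erase S _ he, if_pos rfl]
    congr 1
    exact prod_congr rfl fun h hh => if_neg (mem_erase.1 hh).1
  rw [h6] at h5
  change _ ≤ S.card * denseProb t d K N (verts S) at h4
  linarith

end Completion

section Step

theorem avg_fin {N : ℕ} (g : ℕ → ℝ) : avg (fun j : Fin N => g j) = (∑ j ∈ range N, g j) / N := by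
  rw [avg, Fin.sum_univ_eq_sum_range, Fintype.card_fin]

variable {V : Type*} [DecidableEq V] [Fintype V] {t d K N i : ℕ} {e f : Finset V}
  {S : Finset (Finset V)}

open Classical in
theorem prod_avg_markOk (hf : f ∈ S.erase e) (hi : i < N) (g : ℕ → Finset V → ℝ) :
    ∏ h ∈ S.erase e, avg (fun j : Fin N => if markOk f i h j then g j h else 0) =
      g i f / N * ∏ h ∈ (S.erase e).erase f, (∑ j ∈ range i, g j h) / N := by
  rw [← mul_prod_erase _ _ hf]
  congr 1
  · rw [avg_fin fun j => if markOk f i f j then g j f else 0]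
    congr 1
    rw [sum_eq_single i]
    · rw [if_pos]; simp [markOk]
    · intro j _ hj
      rw [if_neg]; simpa [markOk] using hj
    · intro h; exact absurd (mem_range.2 hi) h
  · refine prod_congr rfl fun h hh => ?_
    rw [avg_fin fun j => if markOk f i h j then g j h else 0]
    congr 1
    rw [← sum_filter]
    refine sum_congr ?_ fun _ _ => rfl
    ext j
    have := (mem_erase.1 hh).1
    simp only [markOk, if_neg this, mem_filter, mem_range]
    omega

variable [NeZero N]

theorem prob_completes_le (hd : 1 ≤ d) (hS : MConf t d S) (h3 : 3 ≤ S.card) (he : e ∈ S)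
    (hf : f ∈ S) (hef : e ≠ f) (hi : i < K) (hK : K ≤ N) :
    prob (fun x => Completes (N := N) t d K S e f i x) ≤
      safeProb t d K N i e * ((accProb t d N (i + 1) e - accProb t d N i e) *
        accProb t d N i e ^ (S.card - 2)) + 1 / N * (K / N : ℝ) ^ (S.card - 2) *
        ((S.card + 1) * denseProb t d K N (verts S) + S.card * (S.card * (K / N))) := by
  classical
  have hN : 0 < N := Nat.pos_of_ne_zero (NeZero.ne N)
  set E := (S.card + 1) * denseProb t d K N (verts S) + S.card * (S.card * (K / N) : ℝ)
  have hE : 0 ≤ E := by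
    have : 0 ≤ denseProb t d K N (verts S) := prob_nonneg _
    positivity
  have hfe : f ∈ S.erase e := mem_erase.2 ⟨hef.symm, hf⟩
  have hc : ((S.erase e).erase f).card = S.card - 2 := by
    rw [card_erase_of_mem hfe, card_erase_of_mem he]; omega
  have h1 : ∀ a : Finset V → Fin N, prob (fun x => Completes t d K S e f i (S.piecewise a x)) ≤
      safeProb t d K N i e *
        (∏ h ∈ S.erase e, if markOk f i h (a h) then freeProb t d K N (a h) h else 0) +
      (∏ h ∈ S.erase e, if markOk f i h (a h) then (1 : ℝ) else 0) * E := by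
    intro a
    by_cases ha : ∀ h ∈ S.erase e, markOk f i h (a h)
    · rw [prod_congr rfl fun h hh => if_pos (ha h hh), prod_congr rfl fun h hh => if_pos (ha h hh),
        prod_const_one, one_mul]
      exact prob_completes_piecewise_le hd hS h3 he hf hef hi a ha
    · push Not at ha
      obtain ⟨h, hh, hah⟩ := ha
      rw [prod_eq_zero hh (if_neg hah), prod_eq_zero hh (if_neg hah), mul_zero, zero_mul, add_zero]
      rw [← prob_false (Ω := Finset V → Fin N)]
      refine prob_mono fun x hx => hah ?_
      have hhS := (mem_erase.1 hh).2
      unfold markOk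
      split_ifs with hhf
      · subst hhf
        have := hx.2.1
        rwa [piecewise_eq_of_mem _ _ _ hhS] at this
      · have := (hx.2.2.2 h hhS (mem_erase.1 hh).1 hhf).lt
        rwa [marks, mute_of_notMem (by simpa using (mem_erase.1 hh).1),
          piecewise_eq_of_mem _ _ _ hhS] at this
  rw [prob_eq_avg_piecewise S]
  refine (avg_mono h1).trans ?_
  rw [avg_add, avg_mul_left, avg_mul_right,
    avg_pi_prod (S.erase e) fun h (j : Fin N) => if markOk f i h j then freeProb t d K N j h else 0,
    avg_pi_prod (S.erase e) fun h (j : Fin N) => if markOk f i h j then (1 : ℝ) else 0,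
    prod_avg_markOk hfe (by omega) fun j h => freeProb t d K N j h,
    prod_avg_markOk hfe (by omega) fun _ _ => (1 : ℝ)]
  have hcard : ∀ g ∈ S, g.card = t + d := hS.1.1
  have hp : ∏ h ∈ (S.erase e).erase f, (∑ j ∈ range i, freeProb t d K N j h) / N =
      accProb t d N i e ^ (S.card - 2) := by
    rw [← hc, ← prod_const]
    refine prod_congr rfl fun h hh => ?_
    have hhS : h ∈ S := (mem_erase.1 (mem_erase.1 hh).2).2
    rw [← accProb_eq ((hcard h hhS).trans (hcard e he).symm), accProb_eq_sum hN (hcard h hhS) hi.le hK,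
      Finset.sum_div]
  have hq : freeProb t d K N i f / N = accProb t d N (i + 1) e - accProb t d N i e := by
    rw [accProb_eq ((hcard e he).trans (hcard f hf).symm),
      accProb_eq ((hcard e he).trans (hcard f hf).symm), accProb_succ hN (hcard f hf) hi hK]
    ring
  rw [hp, hq]
  refine add_le_add le_rfl (mul_le_mul_of_nonneg_right ?_ hE)
  refine mul_le_mul_of_nonneg_left ?_ (by positivity)
  rw [← hc, ← prod_const]
  refine prod_le_prod (fun _ _ => by positivity) fun _ _ => ?_
  rw [sum_const, card_range, nsmul_one]
  gcongr

end Step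

section Union

variable {V : Type*} [DecidableEq V] [Fintype V] {t d K N i : ℕ} {e : Finset V} [NeZero N]

theorem prob_forall_lt_and_eq_le {J F : Finset (Finset V)} (hF : F ⊆ J) :
    prob (fun x : Finset V → Fin N => (∀ h ∈ F, (x h : ℕ) = i) ∧ ∀ h ∈ J, (x h : ℕ) < K) ≤
      (1 / N : ℝ) ^ F.card * (K / N : ℝ) ^ (J.card - F.card) := by
  have h1 := prob_pi_forall J fun (h : Finset V) (a : Fin N) =>
    if h ∈ F then (a : ℕ) = i else (a : ℕ) < K
  refine (prob_mono fun x hx => ?_).trans ((le_of_eq h1).trans ?_)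
  · intro h hh
    show if h ∈ F then _ else _
    split_ifs with hhF
    · exact hx.1 h hhF
    · exact hx.2 h hh
  · rw [← prod_sdiff hF, mul_comm, ← card_sdiff_of_subset hF, ← prod_const, ← prod_const]
    refine mul_le_mul ?_ ?_ (prod_nonneg fun _ _ => prob_nonneg _) (by positivity)
    · refine prod_le_prod (fun _ _ => prob_nonneg _) fun h hh => ?_
      simp only [if_pos hh]
      exact prob_fin_eq_le i
    · refine prod_le_prod (fun _ _ => prob_nonneg _) fun h hh => ?_
      simp only [if_neg (Finset.mem_sdiff.1 hh).2]
      exact prob_fin_lt_le K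

open Classical in
/-- The minimal configurations consisting of `e` and `s` further edges. -/
noncomputable def configs (t d : ℕ) (e : Finset V) (s : ℕ) : Finset (Finset (Finset V)) :=
  univ.filter fun S => MConf t d S ∧ e ∈ S ∧ S.card = s + 1

theorem mem_configs {s : ℕ} {S : Finset (Finset V)} :
    S ∈ configs t d e s ↔ MConf t d S ∧ e ∈ S ∧ S.card = s + 1 := by
  classical
  simp [configs]

theorem card_configs_le [Nonempty V] (he : e.card = t + d) {s : ℕ} (hs : s ≤ 3) :
    ((configs t d e s).card : ℝ) ≤
      ((d * 3 + 1) * 2 ^ 2 ^ (t + d + d * 3) : ℕ) * (Fintype.card V : ℝ) ^ (d * s) := by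
  have h1 := card_mconf_le e he s (configs t d e s) fun S hS => mem_configs.1 hS
  have h2 : (d * s + 1) * Fintype.card V ^ (d * s) * 2 ^ 2 ^ (t + d + d * s) ≤
      (d * 3 + 1) * 2 ^ 2 ^ (t + d + d * 3) * Fintype.card V ^ (d * s) := by
    calc _ = (d * s + 1) * 2 ^ 2 ^ (t + d + d * s) * Fintype.card V ^ (d * s) := by ring
      _ ≤ _ := by gcongr <;> norm_num
  exact_mod_cast h1.trans h2

/-- A configuration of `s + 1` edges completed up to `e` in round `i`. -/
def Completed (t d K : ℕ) (S : Finset (Finset V)) (e : Finset V) (i : ℕ)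
    (x : Finset V → Fin N) : Prop :=
  ¬ Threat t d 3 (marks K {e} x) i e ∧
    ∀ f ∈ S, f ≠ e → Accepted t d (marks K {e} x) (i + 1) f

theorem safeProb_le_succ_add :
    safeProb t d K N i e ≤ safeProb t d K N (i + 1) e +
      ∑ s ∈ ({2, 3} : Finset ℕ), ∑ S ∈ configs t d e s,
        prob (fun x => Completed (N := N) t d K S e i x) := by
  refine (prob_le_add (q := fun x : Finset V → Fin N => ¬ Threat t d 3 (marks K {e} x) (i + 1) e)
    (r := fun x => ∃ s ∈ ({2, 3} : Finset ℕ), ∃ S ∈ configs t d e s,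
      Completed (N := N) t d K S e i x) ?_).trans (add_le_add le_rfl ?_)
  · intro x hx
    by_cases h : Threat t d 3 (marks K {e} x) (i + 1) e
    · obtain ⟨S, hS, heS, h3, hacc⟩ := h
      have h4 := hS.1.2.2.1
      exact Or.inr ⟨S.card - 1, by simp only [mem_insert, mem_singleton]; omega, S,
        mem_configs.2 ⟨hS, heS, by omega⟩, hx, hacc⟩
    · exact Or.inl h
  · refine (prob_exists_le _ _).trans (sum_le_sum fun s _ => ?_)
    exact prob_exists_le _ _

theorem prob_completed_le {S : Finset (Finset V)} (hd : 1 ≤ d) (hS : MConf t d S)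
    (h3 : 3 ≤ S.card) (he : e ∈ S) (hi : i < K) (hK : K ≤ N) :
    prob (fun x => Completed (N := N) t d K S e i x) ≤
      3 * (safeProb t d K N i e * ((accProb t d N (i + 1) e - accProb t d N i e) *
        accProb t d N i e ^ (S.card - 2)) + 1 / N * (K / N : ℝ) ^ (S.card - 2) *
        ((S.card + 1) * denseProb t d K N (verts S) + S.card * (S.card * (K / N)))) +
      9 * ((1 / N : ℝ) ^ 2 * (K / N : ℝ) ^ (S.card - 3)) := by
  have h4 := hS.1.2.2.1
  have hce : (S.erase e).card = S.card - 1 := card_erase_of_mem he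
  have hmark : ∀ (x : Finset V → Fin N) f, f ≠ e → marks K {e} x f = x f := fun x f hf =>
    mute_of_notMem (by simpa using hf)
  have hB : 0 ≤ safeProb t d K N i e * ((accProb t d N (i + 1) e - accProb t d N i e) *
        accProb t d N i e ^ (S.card - 2)) + 1 / N * (K / N : ℝ) ^ (S.card - 2) *
        ((S.card + 1) * denseProb t d K N (verts S) + S.card * (S.card * (K / N))) := by
    have h1 : 0 ≤ safeProb t d K N i e := prob_nonneg _
    have h2 : 0 ≤ denseProb t d K N (verts S) := prob_nonneg _
    have h3 : 0 ≤ accProb t d N i e := accProb_nonneg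
    have h4 : accProb t d N i e ≤ accProb t d N (i + 1) e := accProb_mono (by omega)
    have h5 := sub_nonneg.2 h4
    positivity
  refine (prob_le_add (q := fun x : Finset V → Fin N => ∃ f ∈ S.erase e, Completes t d K S e f i x)
    (r := fun x => ∃ P ∈ (S.erase e).offDiag, (∀ h ∈ ({P.1, P.2} : Finset (Finset V)), (x h : ℕ) = i)
      ∧ ∀ h ∈ S.erase e, (x h : ℕ) < K) ?_).trans (add_le_add ?_ ?_)
  · intro x hx
    obtain ⟨hthr, hacc⟩ := hx
    have hlt : ∀ h ∈ S.erase e, (x h : ℕ) < K := by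
      intro h hh
      have := (hacc h (mem_erase.1 hh).2 (mem_erase.1 hh).1).lt
      rw [hmark x h (mem_erase.1 hh).1] at this
      omega
    have hex : ∃ f ∈ S, f ≠ e ∧ ¬ Accepted t d (marks K {e} x) i f := by
      by_contra! hcon
      exact hthr ⟨S, hS, he, h3, hcon⟩
    obtain ⟨f, hf, hfe, hfa⟩ := hex
    have hnew : ∀ g ∈ S, g ≠ e → ¬ Accepted t d (marks K {e} x) i g →
        (x g : ℕ) = i ∧ ¬ Blocked t d (marks K {e} x) i g := by
      intro g hg hge hga
      have := (acc_succ.1 (hacc g hg hge)).resolve_left hga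
      rw [hmark x g hge] at this
      exact this.2
    by_cases hall : ∀ g ∈ S, g ≠ e → g ≠ f → Accepted t d (marks K {e} x) i g
    · exact Or.inl ⟨f, mem_erase.2 ⟨hfe, hf⟩, hthr, (hnew f hf hfe hfa).1, (hnew f hf hfe hfa).2,
        hall⟩
    · push Not at hall
      obtain ⟨g, hg, hge, hgf, hga⟩ := hall
      refine Or.inr ⟨(f, g), mem_offDiag.2 ⟨mem_erase.2 ⟨hfe, hf⟩, mem_erase.2 ⟨hge, hg⟩, hgf.symm⟩,
        ?_, hlt⟩
      intro h hh
      rcases mem_insert.1 hh with rfl | hh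
      · exact (hnew _ hf hfe hfa).1
      · rw [mem_singleton.1 hh]
        exact (hnew _ hg hge hga).1
  · refine (prob_exists_le _ _).trans ((sum_le_card_nsmul _ _ _ fun f hf =>
      prob_completes_le hd hS h3 he (mem_erase.1 hf).2 (mem_erase.1 hf).1.symm hi hK).trans ?_)
    rw [nsmul_eq_mul]
    refine mul_le_mul_of_nonneg_right ?_ hB
    rw [hce]
    exact_mod_cast (by omega : S.card - 1 ≤ 3)
  · refine (prob_exists_le _ _).trans ((sum_le_card_nsmul _ _ ((1 / N : ℝ) ^ 2 *
      (K / N : ℝ) ^ (S.card - 3)) fun P hP => ?_).trans ?_)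
    · obtain ⟨h1, h2, h12⟩ := mem_offDiag.1 hP
      have := prob_forall_lt_and_eq_le (N := N) (i := i) (K := K) (J := S.erase e) (F := {P.1, P.2}) (by
        intro h hh
        rcases mem_insert.1 hh with rfl | hh
        · exact h1
        · rwa [mem_singleton.1 hh])
      rw [card_pair h12, hce] at this
      rwa [show S.card - 3 = S.card - 1 - 2 by omega]
    · rw [nsmul_eq_mul]
      refine mul_le_mul_of_nonneg_right ?_ (by positivity)
      rw [offDiag_card, hce]
      have h5 : S.card - 1 ≤ 3 := by omega
      have h6 : (S.card - 1) * (S.card - 1) ≤ 3 * 3 := Nat.mul_le_mul h5 h5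
      exact_mod_cast (by omega : (S.card - 1) * (S.card - 1) - (S.card - 1) ≤ 9)

/-- One round of the process destroys only a controlled part of the safe event. -/
theorem safeProb_step [Nonempty V] (hd : 1 ≤ d) (he : e.card = t + d) (hi : i < K) (hK : K ≤ N)
    {β : ℝ} (hβ : ∀ W : Finset V, W.card ≤ 4 * (t + d) → denseProb t d K N W ≤ β) :
    safeProb t d K N i e ≤ safeProb t d K N (i + 1) e + ∑ s ∈ ({2, 3} : Finset ℕ),
      (((d * 3 + 1) * 2 ^ 2 ^ (t + d + d * 3) : ℕ) * (Fintype.card V : ℝ) ^ (d * s)) *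
      (3 * (safeProb t d K N i e * ((accProb t d N (i + 1) e - accProb t d N i e) *
        accProb t d N i e ^ (s - 1)) + 1 / N * (K / N : ℝ) ^ (s - 1) *
        (5 * β + 16 * (K / N))) + 9 * ((1 / N : ℝ) ^ 2 * (K / N : ℝ) ^ (s - 2))) := by
  have hβ0 : 0 ≤ β := (prob_nonneg _).trans (hβ ∅ (by simp))
  refine safeProb_le_succ_add.trans (add_le_add le_rfl (sum_le_sum fun s hs => ?_))
  have hs' : s = 2 ∨ s = 3 := by simpa using hs
  have h1 : 0 ≤ safeProb t d K N i e := prob_nonneg _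
  have h3 : 0 ≤ accProb t d N i e := accProb_nonneg
  have h5 := sub_nonneg.2 (accProb_mono (t := t) (d := d) (N := N) (e := e) (show i ≤ i + 1 by omega))
  refine (sum_le_card_nsmul _ _ (3 * (safeProb t d K N i e *
      ((accProb t d N (i + 1) e - accProb t d N i e) *
        accProb t d N i e ^ (s - 1)) + 1 / N * (K / N : ℝ) ^ (s - 1) *
        (5 * β + 16 * (K / N))) + 9 * ((1 / N : ℝ) ^ 2 * (K / N : ℝ) ^ (s - 2))) ?_).trans ?_
  · intro S hS
    obtain ⟨hS, heS, hc⟩ := mem_configs.1 hS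
    refine (prob_completed_le hd hS (by omega) heS hi hK).trans ?_
    rw [hc, show s + 1 - 2 = s - 1 by omega, show s + 1 - 3 = s - 2 by omega]
    have hv : (verts S).card ≤ 4 * (t + d) := by
      have := hS.1.2.2.2
      rw [hc] at this
      have h6 : d * (s + 1) ≤ d * 4 := Nat.mul_le_mul_left _ (by omega)
      omega
    have hD := hβ _ hv
    have hD0 : 0 ≤ denseProb t d K N (verts S) := prob_nonneg _
    have hs4 : ((s + 1 : ℕ) : ℝ) ≤ 4 := by exact_mod_cast (by omega : s + 1 ≤ 4)
    rw [show (16 * (K / N) : ℝ) = 4 * (4 * (K / N)) by ring]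
    gcongr
    linarith
  · rw [nsmul_eq_mul]
    refine mul_le_mul_of_nonneg_right (card_configs_le he (by omega)) ?_
    positivity

end Union

section Free

variable {V : Type*} [DecidableEq V] [Fintype V] {t d K N i : ℕ} {e : Finset V}

/-- The edge `e` together with active edges forms a minimal configuration in which a further edge
has mark `i`. -/
def Tied (t d K : ℕ) (e : Finset V) (i : ℕ) (x : Finset V → Fin N) : Prop :=
  ∃ S, MConf t d S ∧ e ∈ S ∧ ∃ f ∈ S.erase e, (x f : ℕ) = i ∧ ∀ h ∈ S.erase e, (x h : ℕ) < K

theorem prob_tied_le [NeZero N] [Nonempty V] (he : e.card = t + d) :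
    prob (fun x => Tied (N := N) t d K e i x) ≤ ∑ s ∈ ({1, 2, 3} : Finset ℕ),
      (((d * 3 + 1) * 2 ^ 2 ^ (t + d + d * 3) : ℕ) * (Fintype.card V : ℝ) ^ (d * s)) *
      (3 * (1 / N * (K / N : ℝ) ^ (s - 1))) := by
  refine (prob_mono (q := fun x : Finset V → Fin N => ∃ s ∈ ({1, 2, 3} : Finset ℕ),
    ∃ S ∈ configs t d e s, ∃ f ∈ S.erase e, (∀ h ∈ ({f} : Finset (Finset V)), (x h : ℕ) = i) ∧
      ∀ h ∈ S.erase e, (x h : ℕ) < K) ?_).trans ?_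
  · rintro x ⟨S, hS, heS, f, hf, hfi, hlt⟩
    have h2 := hS.1.2.1
    have h4 := hS.1.2.2.1
    exact ⟨S.card - 1, by simp only [mem_insert, mem_singleton]; omega, S,
      mem_configs.2 ⟨hS, heS, by omega⟩, f, hf, by simpa using hfi, hlt⟩
  · refine (prob_exists_le _ _).trans (sum_le_sum fun s hs => ?_)
    have hs' : s = 1 ∨ s = 2 ∨ s = 3 := by simpa using hs
    refine (prob_exists_le _ _).trans ((sum_le_card_nsmul _ _
      (3 * (1 / N * (K / N : ℝ) ^ (s - 1))) fun S hS => ?_).trans ?_)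
    · obtain ⟨hS, heS, hc⟩ := mem_configs.1 hS
      have hce : (S.erase e).card = s := by rw [card_erase_of_mem heS]; omega
      refine (prob_exists_le _ _).trans ((sum_le_card_nsmul _ _
        (1 / N * (K / N : ℝ) ^ (s - 1)) fun f hf => ?_).trans ?_)
      · have := prob_forall_lt_and_eq_le (N := N) (i := i) (K := K) (J := S.erase e) (F := {f})
          (by simpa using hf)
        rwa [card_singleton, pow_one, hce] at this
      · rw [nsmul_eq_mul, hce]
        refine mul_le_mul_of_nonneg_right ?_ (by positivity)
        exact_mod_cast (by omega : s ≤ 3)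
    · rw [nsmul_eq_mul]
      exact mul_le_mul_of_nonneg_right (card_configs_le he (by omega)) (by positivity)

theorem not_blocked_of_not_tied {x : Finset V → Fin N} (he : e.card = t + d) (hi : i < K)
    (hG : Good t d e (6 * (K + 2)) (active K x)) (hthr : ¬ Threat t d 3 (marks K {e} x) i e)
    (hcov : ∀ T ∈ powersetCard t e, ¬ Covered t d (marks K {e} x) i e T)
    (htie : ¬ Tied t d K e i x) : ¬ Blocked t d (marks K {e} x) i e := by
  rintro ⟨S, hS, heS, hf⟩
  have hmark : ∀ f, f ≠ e → marks K {e} x f = x f := fun f hf =>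
    mute_of_notMem (by simpa using hf)
  have hlt : ∀ f ∈ S.erase e, (x f : ℕ) < K := by
    intro f hfS
    rcases hf f (mem_erase.1 hfS).2 (mem_erase.1 hfS).1 with h | h
    · have := h.lt
      rw [hmark f (mem_erase.1 hfS).1] at this
      omega
    · rw [hmark f (mem_erase.1 hfS).1] at h
      omega
  have hacc : ∀ f ∈ S, f ≠ e → Accepted t d (marks K {e} x) i f := by
    intro f hfS hfe
    refine (hf f hfS hfe).resolve_right fun h => htie ?_
    rw [hmark f hfe] at h
    exact ⟨S, hS, heS, f, mem_erase.2 ⟨hfe, hfS⟩, h, hlt⟩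
  by_cases h3 : 3 ≤ S.card
  · exact hthr ⟨S, hS, heS, h3, hacc⟩
  have h2 : S.card = 2 := by have := hS.1.2.1; omega
  obtain ⟨f, hfS⟩ := card_pos.1 (show 0 < (S.erase e).card by rw [card_erase_of_mem heS]; omega)
  have hfe := (mem_erase.1 hfS).1
  have hf' := (mem_erase.1 hfS).2
  have hfc := hS.1.1 f hf'
  have h5 := hG {f} (by intro g hg; rw [mem_singleton.1 hg]; exact ⟨hlt f hfS, hfc⟩) (by simp) (by simp; omega)
  rw [verts_singleton, card_singleton] at h5
  have h6 := card_sdiff_add_card_inter f e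
  have h7 : (f ∪ e).card ≤ (verts S).card := card_le_card (union_subset (subset_verts hf')
    (subset_verts heS))
  have h8 := card_union_add_card_inter f e
  have h9 := hS.1.2.2.2
  rw [h2] at h9
  refine hcov (f ∩ e) (mem_powersetCard.2 ⟨inter_subset_right, by omega⟩) ⟨f, rfl, hacc f hf' hfe⟩

/-- The event attached to `none` is safety, the one attached to a `t`-set is not being covered. -/
def Unspoilt (t d K : ℕ) (e : Finset V) (i : ℕ) (o : Option (Finset V)) (x : Finset V → Fin N) :
    Prop :=
  match o with
  | none => ¬ Threat t d 3 (marks K {e} x) i e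
  | some T => ¬ Covered t d (marks K {e} x) i e T

/-- The starting families attached to `none` and to `t`-sets. -/
def SpoilStart (t d : ℕ) (e : Finset V) (o : Option (Finset V)) (R : Set (Finset V)) :
    Finset (Finset V) → Prop :=
  match o with
  | none => EdgeStart t d R e 3
  | some T => TraceStart t d R e T

theorem prob_unspoilt_ge [NeZero N] (he : e.card = t + d) (hi : i ≤ K)
    (hu : 0 ≤ 1 - (Fintype.card V - t).choose d * accProb t d N i e - K / N) :
    safeProb t d K N i e * (1 - (Fintype.card V - t).choose d * accProb t d N i e - K / N) ^
        (t + d).choose t - ((t + d).choose t + 1) * denseProb t d K N e ≤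
      prob (fun x : Finset V → Fin N =>
        ∀ o ∈ insertNone (powersetCard t e), Unspoilt t d K e i o x) := by
  have h1 := abs_prob_forall_sub_prod_le (N := N) (K := K) (insertNone (powersetCard t e))
    (c := fun o => cluster t d K (SpoilStart t d e o)) (p := Unspoilt t d K e i)
    (G := Good t d e (6 * (K + 2))) ?_ ?_
  · rw [card_insertNone, card_powersetCard, he] at h1
    have h2 := (abs_sub_le_iff.1 h1).2
    have h3 : safeProb t d K N i e * (1 - (Fintype.card V - t).choose d * accProb t d N i e - K / N) ^
        (t + d).choose t ≤ ∏ o ∈ insertNone (powersetCard t e),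
          prob (Unspoilt (N := N) t d K e i o) := by
      rw [prod_insertNone]
      refine mul_le_mul_of_nonneg_left ?_ (prob_nonneg _)
      rw [← he, ← card_powersetCard, ← prod_const]
      refine prod_le_prod (fun _ _ => hu) fun T hT => ?_
      exact prob_not_covered_ge (mem_powersetCard.1 hT).2 he hi
    change _ ≤ _ * denseProb t d K N e at h2
    push_cast at h2
    linarith
  · intro o ho
    match o with
    | none => exact (isLocal_threat {e} e hi).not
    | some T => exact (isLocal_covered {e} e T hi).not
  · intro R hR o ho o' ho' hne
    match o, o' with
    | none, none => exact absurd rfl hne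
    | none, some T =>
      have hT := mem_powersetCard.1 (some_mem_insertNone.1 ho')
      exact disjoint_cluster_trace hR hT.1 hT.2
    | some T, none =>
      have hT := mem_powersetCard.1 (some_mem_insertNone.1 ho)
      exact (disjoint_cluster_trace hR hT.1 hT.2).symm
    | some T, some T' =>
      have hT := mem_powersetCard.1 (some_mem_insertNone.1 ho)
      have hT' := mem_powersetCard.1 (some_mem_insertNone.1 ho')
      refine disjoint_cluster hR hT.1 hT'.1 (fun F hF => TraceStart.isStart hT.2 hF)
        (fun F hF => TraceStart.isStart hT'.2 hF) ?_
      by_contra! hle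
      have h1 := eq_of_subset_of_card_le inter_subset_left (hT.2.trans_le hle)
      have h2 := eq_of_subset_of_card_le inter_subset_right (hT'.2.trans_le hle)
      exact hne (congrArg some (h1.symm.trans h2))

theorem freeProb_ge [NeZero N] [Nonempty V] (he : e.card = t + d) (hi : i < K)
    (hu : 0 ≤ 1 - (Fintype.card V - t).choose d * accProb t d N i e - K / N) :
    safeProb t d K N i e * (1 - (Fintype.card V - t).choose d * accProb t d N i e - K / N) ^
        (t + d).choose t - ((t + d).choose t + 2) * denseProb t d K N e -
      ∑ s ∈ ({1, 2, 3} : Finset ℕ),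
      (((d * 3 + 1) * 2 ^ 2 ^ (t + d + d * 3) : ℕ) * (Fintype.card V : ℝ) ^ (d * s)) *
      (3 * (1 / N * (K / N : ℝ) ^ (s - 1))) ≤ freeProb t d K N i e := by
  have h1 := prob_unspoilt_ge he hi.le hu
  have h2 : prob (fun x : Finset V → Fin N =>
        ∀ o ∈ insertNone (powersetCard t e), Unspoilt t d K e i o x) ≤ freeProb t d K N i e +
      prob (fun x : Finset V → Fin N => ¬ Good t d e (6 * (K + 2)) (active K x) ∨
        Tied (N := N) t d K e i x) := by
    refine prob_le_add fun x hx => ?_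
    by_cases h : ¬ Good t d e (6 * (K + 2)) (active K x) ∨ Tied t d K e i x
    · exact Or.inr h
    · push Not at h
      exact Or.inl (not_blocked_of_not_tied he hi h.1 (hx none none_mem_insertNone)
        (fun T hT => hx (some T) (some_mem_insertNone.2 hT)) h.2)
  have h3 := prob_or_le (fun x : Finset V → Fin N => ¬ Good t d e (6 * (K + 2)) (active K x))
    (Tied (N := N) t d K e i)
  have h4 := prob_not_good_active_le (t := t) (d := d) (K := K) (N := N) e
  have h5 := prob_tied_le (K := K) (N := N) (i := i) he
  linarith

end Free

section Scaled

variable {t d i n M τ : ℕ} {e : Finset (Fin n)}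

/-- A constant bounding the number of minimal configurations through an edge. -/
def configConst (t d : ℕ) : ℕ := (d * 3 + 1) * 2 ^ 2 ^ (t + d + d * 3)

theorem safeProb_step_scaled (hn : 0 < n) (hM : 0 < M) (hτ : 1 ≤ τ) (hd : 1 ≤ d)
    (he : e.card = t + d) (hi : i < τ * M) (hK : τ * M ≤ M * n ^ d) {c β : ℝ} (hc : 1 ≤ c)
    (hP : (n : ℝ) ^ d * accProb t d (M * n ^ d) i e ≤ c)
    (hβ : ∀ W : Finset (Fin n), W.card ≤ 4 * (t + d) →
      denseProb t d (τ * M) (M * n ^ d) W ≤ β) :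
    safeProb t d (τ * M) (M * n ^ d) i e ≤ safeProb t d (τ * M) (M * n ^ d) (i + 1) e +
      6 * configConst t d * c ^ 2 * ((n : ℝ) ^ d * accProb t d (M * n ^ d) (i + 1) e -
        (n : ℝ) ^ d * accProb t d (M * n ^ d) i e) * safeProb t d (τ * M) (M * n ^ d) i e +
      (6 * configConst t d * τ ^ 2 * (5 * β + 16 * τ / n) + 18 * configConst t d * τ / M) / M := by
  have : NeZero (M * n ^ d) := ⟨by positivity⟩
  have : Nonempty (Fin n) := ⟨⟨0, hn⟩⟩
  have h := safeProb_step hd he hi hK hβ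
  have hβ0 : 0 ≤ β := (prob_nonneg _).trans (hβ ∅ (by simp))
  rw [sum_pair (by norm_num)] at h
  change _ ≤ _ + ((configConst t d : ℝ) * _ * _ + (configConst t d : ℝ) * _ * _) at h
  rw [Fintype.card_fin, pow_mul, pow_mul] at h
  have hz : 0 ≤ safeProb t d (τ * M) (M * n ^ d) i e := prob_nonneg _
  have hp : 0 ≤ accProb t d (M * n ^ d) i e := accProb_nonneg
  have hq : 0 ≤ accProb t d (M * n ^ d) (i + 1) e - accProb t d (M * n ^ d) i e :=
    sub_nonneg.2 (accProb_mono (by omega))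
  have hA : (0 : ℝ) ≤ configConst t d := Nat.cast_nonneg _
  have hnD : (n : ℝ) ≤ (n : ℝ) ^ d := le_self_pow₀ (by exact_mod_cast hn) (by omega)
  push_cast at h
  set A := (configConst t d : ℝ)
  set z := safeProb t d (τ * M) (M * n ^ d) i e
  set z' := safeProb t d (τ * M) (M * n ^ d) (i + 1) e
  set p := accProb t d (M * n ^ d) i e
  set p' := accProb t d (M * n ^ d) (i + 1) e
  have hn' : (0 : ℝ) < n := by exact_mod_cast hn
  have hM' : (0 : ℝ) < M := by exact_mod_cast hM
  have hτ' : (1 : ℝ) ≤ τ := by exact_mod_cast hτ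
  set D : ℝ := (n : ℝ) ^ d
  have hD : 0 < D := by positivity
  have h1 : 5 * β + 16 * (τ * M / (M * D)) ≤ 5 * β + 16 * τ / n := by
    have : (τ : ℝ) * M / (M * D) = τ / D := by field_simp
    rw [this, mul_div_assoc]
    gcongr
  set E : ℝ := 5 * β + 16 * (τ * M / (M * D))
  have hE : 0 ≤ E := by positivity
  set E' : ℝ := 5 * β + 16 * τ / n
  have e1 : A * D ^ 2 * (3 * (z * ((p' - p) * p ^ (2 - 1)) + 1 / (M * D) * (τ * M / (M * D)) ^ (2 - 1) *
      E) + 9 * ((1 / (M * D)) ^ 2 * (τ * M / (M * D)) ^ (2 - 2))) =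
      A * (3 * (z * (D * p' - D * p) * (D * p)) + 3 * τ * E / M + 9 / M ^ 2) := by
    norm_num
    field_simp
  have e2 : A * D ^ 3 * (3 * (z * ((p' - p) * p ^ (3 - 1)) + 1 / (M * D) * (τ * M / (M * D)) ^ (3 - 1) *
      E) + 9 * ((1 / (M * D)) ^ 2 * (τ * M / (M * D)) ^ (3 - 2))) =
      A * (3 * (z * (D * p' - D * p) * (D * p) ^ 2) + 3 * τ ^ 2 * E / M + 9 * τ / M ^ 2) := by
    norm_num
    field_simp
  rw [e1, e2] at h
  have hΔ : 0 ≤ z * (D * p' - D * p) := by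
    rw [← mul_sub]; positivity
  have hPn : 0 ≤ D * p := by positivity
  have b1 : z * (D * p' - D * p) * (D * p) ≤ z * (D * p' - D * p) * c ^ 2 :=
    mul_le_mul_of_nonneg_left (by nlinarith) hΔ
  have b2 : z * (D * p' - D * p) * (D * p) ^ 2 ≤ z * (D * p' - D * p) * c ^ 2 :=
    mul_le_mul_of_nonneg_left (by gcongr) hΔ
  have hττ : (τ : ℝ) ≤ τ ^ 2 := by nlinarith
  have b3 : 3 * τ * E / M ≤ 3 * τ ^ 2 * E' / M := by gcongr
  have b4 : 3 * τ ^ 2 * E / M ≤ 3 * τ ^ 2 * E' / M := by gcongr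
  have b5 : (9 : ℝ) / M ^ 2 ≤ 9 * τ / M ^ 2 := by
    gcongr; linarith
  have b6 : A * (3 * (z * (D * p' - D * p) * (D * p)) + 3 * τ * E / M + 9 / M ^ 2) +
      A * (3 * (z * (D * p' - D * p) * (D * p) ^ 2) + 3 * τ ^ 2 * E / M + 9 * τ / M ^ 2) ≤
      A * (3 * (z * (D * p' - D * p) * c ^ 2) + 3 * τ ^ 2 * E' / M + 9 * τ / M ^ 2) +
      A * (3 * (z * (D * p' - D * p) * c ^ 2) + 3 * τ ^ 2 * E' / M + 9 * τ / M ^ 2) := by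
    gcongr
  refine h.trans ((add_le_add le_rfl b6).trans (le_of_eq ?_))
  field_simp
  ring

theorem freeProb_ge_scaled (hn : 0 < n) (hM : 0 < M) (hτ : 1 ≤ τ) (hd : 1 ≤ d)
    (he : e.card = t + d) (hi : i < τ * M) {β ε : ℝ} (hε : 0 ≤ ε) (hτn : (τ : ℝ) / n ≤ ε)
    (hu : 2 * ε ≤ 1 - (n - t).choose d * accProb t d (M * n ^ d) i e)
    (hβ : denseProb t d (τ * M) (M * n ^ d) e ≤ β) :
    safeProb t d (τ * M) (M * n ^ d) i e * ε ^ (t + d).choose t - ((t + d).choose t + 2) * β -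
      9 * configConst t d * τ ^ 2 / M ≤ freeProb t d (τ * M) (M * n ^ d) i e := by
  have : NeZero (M * n ^ d) := ⟨by positivity⟩
  have : Nonempty (Fin n) := ⟨⟨0, hn⟩⟩
  have hnD : (n : ℝ) ≤ (n : ℝ) ^ d := le_self_pow₀ (by exact_mod_cast hn) (by omega)
  have hn' : (0 : ℝ) < n := by exact_mod_cast hn
  have hM' : (0 : ℝ) < M := by exact_mod_cast hM
  have hτ' : (1 : ℝ) ≤ τ := by exact_mod_cast hτ
  have h1 : ((τ * M : ℕ) : ℝ) / (M * n ^ d : ℕ) ≤ ε := by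
    refine le_trans ?_ hτn
    have : ((τ * M : ℕ) : ℝ) / (M * n ^ d : ℕ) = τ / (n : ℝ) ^ d := by
      push_cast; field_simp
    rw [this]
    gcongr
  have h := freeProb_ge (N := M * n ^ d) he hi (by rw [Fintype.card_fin]; linarith)
  change _ - _ - ∑ s ∈ ({1, 2, 3} : Finset ℕ), (configConst t d : ℝ) * _ * _ ≤ _ at h
  rw [sum_insert (by decide), sum_pair (by norm_num)] at h
  rw [Fintype.card_fin, pow_mul, pow_mul, pow_mul] at h
  have hz : 0 ≤ safeProb t d (τ * M) (M * n ^ d) i e := prob_nonneg _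
  have hA : (0 : ℝ) ≤ configConst t d := Nat.cast_nonneg _
  have h2 : safeProb t d (τ * M) (M * n ^ d) i e * ε ^ (t + d).choose t ≤
      safeProb t d (τ * M) (M * n ^ d) i e * (1 - (n - t).choose d * accProb t d (M * n ^ d) i e -
        ((τ * M : ℕ) : ℝ) / (M * n ^ d : ℕ)) ^ (t + d).choose t := by
    gcongr
    linarith
  have h3 : ((t + d).choose t + 2) * denseProb t d (τ * M) (M * n ^ d) e ≤
      ((t + d).choose t + 2) * β := by gcongr
  have hττ : (τ : ℝ) ≤ τ ^ 2 := by nlinarith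
  set A := (configConst t d : ℝ)
  set D : ℝ := (n : ℝ) ^ d with hDdef
  have hD : 0 < D := by positivity
  have hN : ((M * n ^ d : ℕ) : ℝ) = M * D := by push_cast; rfl
  have e1 : A * D ^ 1 * (3 * (1 / ((M * n ^ d : ℕ) : ℝ) * (((τ * M : ℕ) : ℝ) / (M * n ^ d : ℕ)) ^ (1 - 1)))
      = 3 * A * 1 / M := by
    rw [hN]; norm_num; field_simp
  have e2 : A * D ^ 2 * (3 * (1 / ((M * n ^ d : ℕ) : ℝ) * (((τ * M : ℕ) : ℝ) / (M * n ^ d : ℕ)) ^ (2 - 1)))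
      = 3 * A * τ / M := by
    rw [hN]; norm_num; field_simp
  have e3 : A * D ^ 3 * (3 * (1 / ((M * n ^ d : ℕ) : ℝ) * (((τ * M : ℕ) : ℝ) / (M * n ^ d : ℕ)) ^ (3 - 1)))
      = 3 * A * τ ^ 2 / M := by
    rw [hN]; norm_num; field_simp
  rw [e1, e2, e3] at h
  have b1 : 3 * A * 1 / M ≤ 3 * A * τ ^ 2 / M := by gcongr; linarith
  have b2 : 3 * A * τ / M ≤ 3 * A * τ ^ 2 / M := by gcongr
  have b3 : 9 * A * τ ^ 2 / M = 3 * A * τ ^ 2 / M + (3 * A * τ ^ 2 / M + 3 * A * τ ^ 2 / M) := by ring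
  linarith

end Scaled

section Limit

theorem exp_sub_le_of_step {z P : ℕ → ℝ} {K : ℕ} {C δ : ℝ} (hC : 0 ≤ C) (hδ : 0 ≤ δ)
    (hz : z 0 = 1) (hP : P 0 = 0) (hmono : ∀ i < K, P i ≤ P (i + 1))
    (hsmall : ∀ i < K, C * (P (i + 1) - P i) ≤ 1 / 2)
    (hstep : ∀ i < K, z i ≤ z (i + 1) + C * (P (i + 1) - P i) * z i + δ) :
    ∀ i ≤ K, Real.exp (-(2 * C * P i)) - i * δ ≤ z i := by
  intro i
  induction i with
  | zero => intro _; simp [hz, hP]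
  | succ i ih =>
    intro hi
    have h1 := ih (by omega)
    have h2 := hstep i (by omega)
    have h3 := hsmall i (by omega)
    have h4 : 0 ≤ C * (P (i + 1) - P i) := mul_nonneg hC (sub_nonneg.2 (hmono i (by omega)))
    have h5 : Real.exp (-(2 * C * P (i + 1))) =
        Real.exp (-(2 * C * P i)) * Real.exp (-(2 * (C * (P (i + 1) - P i)))) := by
      rw [← Real.exp_add]; congr 1; ring
    set x := C * (P (i + 1) - P i)
    have h6 : Real.exp (-(2 * x)) ≤ 1 - x := by
      rw [Real.exp_neg]
      have := Real.add_one_le_exp (2 * x)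
      refine (inv_anti₀ (by linarith) this).trans ?_
      rw [inv_le_iff_one_le_mul₀ (by linarith)]
      nlinarith
    have h7 := mul_le_mul_of_nonneg_left h6 (Real.exp_pos (-(2 * C * P i))).le
    have h8 := mul_le_mul_of_nonneg_right h1 (show 0 ≤ 1 - x by linarith)
    have h9 : 0 ≤ x * (i * δ) := by positivity
    rw [h5]
    push_cast
    nlinarith

theorem pow_le_mul_choose_sub {t d n : ℕ} (hn : 2 * (t + d) ≤ n) :
    (n : ℝ) ^ d ≤ 2 ^ d * d.factorial * (n - t).choose d := by
  have h1 : (n - t + 1 - d) ^ d ≤ d.factorial * (n - t).choose d := by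
    rw [← Nat.descFactorial_eq_factorial_mul_choose]
    exact Nat.pow_sub_le_descFactorial _ _
  have h2 : n ^ d ≤ 2 ^ d * (n - t + 1 - d) ^ d := by
    rw [← mul_pow]
    exact Nat.pow_le_pow_left (by omega) _
  have h3 : n ^ d ≤ 2 ^ d * d.factorial * (n - t).choose d := by
    rw [mul_assoc]
    exact h2.trans (Nat.mul_le_mul_left _ h1)
  exact_mod_cast h3

theorem eventually_div_le (a : ℝ) {b : ℝ} (hb : 0 < b) : ∀ᶠ n : ℕ in atTop, a / n ≤ b :=
  (tendsto_const_div_atTop_nhds_zero_nat a).eventually_le_const hb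

theorem safeProb_zero {V : Type*} [DecidableEq V] [Fintype V] {t d K N : ℕ} [NeZero N]
    {e : Finset V} : safeProb t d K N 0 e = 1 := by
  rw [safeProb, ← prob_true (Ω := Finset V → Fin N)]
  refine prob_congr fun x => ?_
  simp only [iff_true]
  rintro ⟨S, hS, he, h3, h⟩
  obtain ⟨f, hf⟩ := card_pos.1 (show 0 < (S.erase e).card by rw [card_erase_of_mem he]; omega)
  exact h f (mem_erase.1 hf).2 (mem_erase.1 hf).1

/-- Almost all `t`-sets are covered by accepted edges if sufficiently many rounds are run. -/
theorem exists_le_accProb (t : ℕ) {d : ℕ} (hd : 1 ≤ d) {ε : ℝ} (hε : 0 < ε) :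
    ∃ K M : ℕ, 0 < M ∧ ∀ᶠ n : ℕ in atTop, ∀ e : Finset (Fin n), e.card = t + d →
      1 - ε ≤ (n - t).choose d * accProb t d (M * n ^ d) K e := by
  set A := (configConst t d : ℝ) with hA
  have hA0 : 0 ≤ A := Nat.cast_nonneg _
  set c : ℝ := 2 ^ d * d.factorial with hc
  have hc1 : 1 ≤ c := by
    have : 1 ≤ 2 ^ d * d.factorial := Nat.succ_le_of_lt (by positivity)
    rw [hc]
    exact_mod_cast this
  set C₁ : ℝ := 6 * A * c ^ 2
  have hC₁ : 0 ≤ C₁ := by positivity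
  set c₂ := Real.exp (-(2 * C₁ * c))
  have hc₂ : 0 < c₂ := Real.exp_pos _
  set k := (t + d).choose t
  set κ := c₂ / 4 * (ε / 2) ^ k with hκ
  have hκ0 : 0 < κ := by positivity
  obtain ⟨τ, hτ⟩ := exists_nat_gt (max (c / κ) 1)
  have hτ1 : 1 ≤ τ := by exact_mod_cast (le_max_right _ _).trans hτ.le
  have hτκ : c < τ * κ := (div_lt_iff₀ hκ0).1 ((le_max_left _ _).trans_lt hτ)
  obtain ⟨M, hM, hM1, hM2, hM3⟩ := ((eventually_gt_atTop 0).and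
    ((eventually_div_le C₁ (show (0 : ℝ) < 1 / 2 by norm_num)).and
    ((eventually_div_le (18 * A * τ ^ 2) (show 0 < c₂ / 4 by positivity)).and
    (eventually_div_le (9 * A * τ ^ 2) (show 0 < κ / 2 by positivity))))).exists
  obtain ⟨B, hB, hdense⟩ := exists_prob_not_good_le t d (4 * (t + d)) (6 * (τ * M + 2)) (τ * M)
  refine ⟨τ * M, M, hM, ?_⟩
  filter_upwards [eventually_ge_atTop (2 * (t + d)), eventually_ge_atTop τ,
    eventually_div_le τ (show 0 < ε / 2 by positivity),
    eventually_div_le (6 * A * τ ^ 3 * (5 * B + 16 * τ)) (show 0 < c₂ / 4 by positivity),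
    eventually_div_le ((k + 2) * B) (show 0 < κ / 2 by positivity)] with n hn1 hn2 hn3 hn4 hn5 e he
  have hn : 0 < n := by omega
  have hn' : (0 : ℝ) < n := by exact_mod_cast hn
  have hM' : (0 : ℝ) < M := by exact_mod_cast hM
  have : NeZero n := ⟨hn.ne'⟩
  have : NeZero (M * n ^ d) := ⟨by positivity⟩
  have hK : τ * M ≤ M * n ^ d := by
    rw [mul_comm]
    exact Nat.mul_le_mul_left _ (hn2.trans (Nat.le_self_pow (by omega) n))
  have hβ : ∀ W : Finset (Fin n), W.card ≤ 4 * (t + d) →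
      denseProb t d (τ * M) (M * n ^ d) W ≤ B / n := fun W hW =>
    hdense n (M * n ^ d) (Nat.le_mul_of_pos_left _ hM) W hW
  set P : ℕ → ℝ := fun i => (n : ℝ) ^ d * accProb t d (M * n ^ d) i e
  set z : ℕ → ℝ := fun i => safeProb t d (τ * M) (M * n ^ d) i e
  have hPc : ∀ i, P i ≤ c := by
    intro i
    have h1 := choose_mul_accProb_le (V := Fin n) (N := M * n ^ d) (i := i) he
    rw [Fintype.card_fin] at h1
    calc P i ≤ c * (n - t).choose d * accProb t d (M * n ^ d) i e :=
          mul_le_mul_of_nonneg_right (pow_le_mul_choose_sub hn1) accProb_nonneg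
      _ ≤ c * 1 := by rw [mul_assoc]; gcongr
      _ = c := mul_one c
  have hPsucc : ∀ i < τ * M, P (i + 1) - P i = freeProb t d (τ * M) (M * n ^ d) i e / M := by
    intro i hi
    simp only [P]
    rw [accProb_succ (NeZero.pos _) he hi hK]
    push_cast
    field_simp
    ring
  have hz : ∀ i ≤ τ * M, c₂ / 2 ≤ z i := by
    intro i hi
    set δ := (6 * A * τ ^ 2 * (5 * (B / n) + 16 * τ / n) + 18 * A * τ / M) / M with hδ
    have hδ0 : 0 ≤ δ := by positivity
    have h1 := exp_sub_le_of_step (z := z) (P := P) (K := τ * M) hC₁ hδ0 safeProb_zero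
      (by simp [P, accProb_zero]) (fun i _ => mul_le_mul_of_nonneg_left (accProb_mono (by omega))
        (by positivity)) (fun j hj => ?_) (fun j hj =>
        safeProb_step_scaled hn hM hτ1 hd he hj hK hc1 (hPc j) hβ) i hi
    · have h2 : c₂ ≤ Real.exp (-(2 * C₁ * P i)) :=
        Real.exp_le_exp.2 (neg_le_neg (mul_le_mul_of_nonneg_left (hPc i) (by positivity)))
      have h3 : i * δ ≤ c₂ / 2 := by
        calc i * δ ≤ (τ * M) * δ := by gcongr; exact_mod_cast hi
          _ = 6 * A * τ ^ 3 * (5 * B + 16 * τ) / n + 18 * A * τ ^ 2 / M := by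
            rw [hδ]; field_simp
          _ ≤ c₂ / 4 + c₂ / 4 := add_le_add hn4 hM2
          _ = c₂ / 2 := by ring
      linarith
    · rw [hPsucc j hj]
      refine le_trans ?_ hM1
      rw [mul_div_assoc']
      gcongr
      exact mul_le_of_le_one_right hC₁ (prob_le_one _)
  by_contra! hlt
  have hfree : ∀ i < τ * M, κ ≤ freeProb t d (τ * M) (M * n ^ d) i e := by
    intro i hi
    have hle : ((n - t).choose d : ℝ) * accProb t d (M * n ^ d) i e ≤
        (n - t).choose d * accProb t d (M * n ^ d) (τ * M) e := by
      gcongr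
      exact accProb_mono hi.le
    have h1 := freeProb_ge_scaled hn hM hτ1 hd he hi (show 0 ≤ ε / 2 by positivity) hn3
      (by linarith) (hβ e (by omega))
    have h2 : c₂ / 2 * (ε / 2) ^ k ≤ z i * (ε / 2) ^ k := by
      gcongr
      exact hz i hi.le
    have h3 : ((k : ℝ) + 2) * (B / n) ≤ κ / 2 := by rwa [mul_div_assoc']
    have h4 : c₂ / 2 * (ε / 2) ^ k = 2 * κ := by rw [hκ]; ring
    change z i * (ε / 2) ^ k - (k + 2) * (B / n) - 9 * A * τ ^ 2 / M ≤ _ at h1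
    linarith
  have hsum : ∀ i ≤ τ * M, i * (κ / M) ≤ P i := by
    intro i
    induction i with
    | zero => intro _; simp [P, accProb_zero]
    | succ i ih =>
      intro hi
      have h1 := ih (by omega)
      have h2 := hPsucc i hi
      have h3 : κ / M ≤ freeProb t d (τ * M) (M * n ^ d) i e / M := by
        gcongr
        exact hfree i hi
      push_cast
      linarith
  have h1 := (hsum _ le_rfl).trans (hPc _)
  have h2 : ((τ * M : ℕ) : ℝ) * (κ / M) = τ * κ := by
    push_cast; field_simp
  linarith

end Limit

section Conclusion

theorem exists_free_family (t : ℕ) {d : ℕ} (hd : 1 ≤ d) {ε : ℝ} (hε : 0 < ε) :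
    ∀ᶠ n : ℕ in atTop, ∃ G : Finset (Finset (Fin n)), (∀ e ∈ G, e.card = t + d) ∧
      IsFree G (t + 4 * d) 4 ∧ (1 - ε) * n.choose t ≤ G.card * (t + d).choose t := by
  classical
  obtain ⟨K, M, hM, h⟩ := exists_le_accProb t hd hε
  filter_upwards [h, eventually_ge_atTop (t + d)] with n hn hn1
  have : NeZero (M * n ^ d) := ⟨by
    have : 0 < n := by omega
    positivity⟩
  set E : Finset (Finset (Fin n)) := powersetCard (t + d) univ
  obtain ⟨x, hx⟩ := exists_avg_le fun x : Finset (Fin n) → Fin (M * n ^ d) =>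
    ∑ e ∈ E, if Accepted t d (fun f => x f) K e then (1 : ℝ) else 0
  rw [avg_sum, ← sum_filter, sum_const, nsmul_one] at hx
  have h1 : ∀ e ∈ E, avg (fun x : Finset (Fin n) → Fin (M * n ^ d) =>
      if Accepted t d (fun f => x f) K e then (1 : ℝ) else 0) = accProb t d (M * n ^ d) K e := by
    intro e _
    rw [accProb, prob]
  rw [sum_congr rfl h1] at hx
  refine ⟨E.filter fun e => Accepted t d (fun f => x f) K e, fun e he =>
    (mem_powersetCard.1 (mem_filter.1 he).1).2, ?_, ?_⟩
  · rintro ⟨S, hSG, hS4, hSv⟩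
    have hS : ∀ e ∈ S, e.card = t + d ∧ Accepted t d (fun f => (x f : ℕ)) K e := fun e he =>
      ⟨(mem_powersetCard.1 (mem_filter.1 (hSG he)).1).2, (mem_filter.1 (hSG he)).2⟩
    obtain ⟨B, hB, hBm⟩ := exists_mconf_subset (t := t) (d := d) (S := S)
      ⟨fun e he => (hS e he).1, by omega, by omega, by
        rw [hS4]
        exact hSv.trans (by omega)⟩
    exact not_forall_acc_of_mconf hBm fun f hf => (hS f (hB hf)).2
  · set G := E.filter fun e => Accepted t d (fun f => (x f : ℕ)) K e
    have h2 : (n.choose (t + d) : ℝ) * (1 - ε) ≤ (n - t).choose d * G.card := by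
      calc (n.choose (t + d) : ℝ) * (1 - ε) = ∑ e ∈ E, (1 - ε) := by
            rw [sum_const, card_powersetCard, card_univ, Fintype.card_fin, nsmul_eq_mul]
        _ ≤ ∑ e ∈ E, (n - t).choose d * accProb t d (M * n ^ d) K e :=
            sum_le_sum fun e he => hn e (mem_powersetCard.1 he).2
        _ = (n - t).choose d * ∑ e ∈ E, accProb t d (M * n ^ d) K e := by rw [mul_sum]
        _ ≤ _ := by gcongr
    have h3 : (n.choose (t + d) : ℝ) * (t + d).choose t = n.choose t * (n - t).choose d := by
      have := Nat.choose_mul (n := n) (k := t + d) (s := t) (by omega)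
      rw [Nat.add_sub_cancel_left] at this
      exact_mod_cast this
    have h4 : (0 : ℝ) < (n - t).choose d := by
      exact_mod_cast Nat.choose_pos (by omega : d ≤ n - t)
    refine le_of_mul_le_mul_left ?_ h4
    calc ((n - t).choose d : ℝ) * ((1 - ε) * n.choose t) =
          n.choose (t + d) * (1 - ε) * (t + d).choose t := by linear_combination (ε - 1) * h3
      _ ≤ (n - t).choose d * G.card * (t + d).choose t := by gcongr
      _ = _ := by ring

theorem bddAbove_card_of_isFree (r n s k : ℕ) :
    BddAbove {m : ℕ | ∃ G : Finset (Finset (Fin n)),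
      (∀ e ∈ G, e.card = r) ∧ IsFree G s k ∧ G.card = m} := by
  refine ⟨Fintype.card (Finset (Fin n)), ?_⟩
  rintro m ⟨G, -, -, rfl⟩
  exact card_le_univ G

theorem card_le_exNum {r n s k : ℕ} {G : Finset (Finset (Fin n))} (hG : ∀ e ∈ G, e.card = r)
    (hfree : IsFree G s k) : G.card ≤ exNum r n s k :=
  le_csSup (bddAbove_card_of_isFree r n s k) ⟨G, hG, hfree, rfl⟩

theorem exists_card_eq_exNum (r n s : ℕ) {k : ℕ} (hk : 1 ≤ k) :
    ∃ G : Finset (Finset (Fin n)), (∀ e ∈ G, e.card = r) ∧ IsFree G s k ∧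
      G.card = exNum r n s k := by
  refine Nat.sSup_mem (s := {m : ℕ | ∃ G : Finset (Finset (Fin n)),
    (∀ e ∈ G, e.card = r) ∧ IsFree G s k ∧ G.card = m}) ⟨0, ∅, by simp, ?_, rfl⟩
    (bddAbove_card_of_isFree r n s k)
  rintro ⟨S, hS, hc, -⟩
  rw [subset_empty.1 hS, card_empty] at hc
  omega

theorem tendsto_choose_div_pow (t : ℕ) :
    Tendsto (fun n : ℕ => (n.choose t : ℝ) / (n : ℝ) ^ t) atTop (nhds (1 / t.factorial)) := by
  have h1 : Tendsto (fun n : ℕ => (n : ℝ) * (1 / n : ℝ)) atTop (nhds 1) := by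
    refine tendsto_const_nhds.congr' ?_
    filter_upwards [eventually_gt_atTop 0] with n hn
    have : (0 : ℝ) < n := by exact_mod_cast hn
    field_simp
  have h2 := ProbabilityTheory.tendsto_choose_mul_pow_atTop t h1
  rw [one_pow] at h2
  refine h2.congr fun n => ?_
  rw [one_div, inv_pow, div_eq_mul_inv]

theorem tendsto_choose_pred_div_pow {t : ℕ} (ht : 1 ≤ t) :
    Tendsto (fun n : ℕ => (n.choose (t - 1) : ℝ) / (n : ℝ) ^ t) atTop (nhds 0) := by
  have h := (tendsto_choose_div_pow (t - 1)).mul (tendsto_one_div_atTop_nhds_zero_nat (𝕜 := ℝ))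
  rw [mul_zero] at h
  refine h.congr fun n => ?_
  conv_rhs => rw [← Nat.sub_add_cancel ht, pow_succ, Nat.add_sub_cancel]
  rw [div_mul_div_comm, mul_one]

end Conclusion

/-- For all `r ≥ 4` and `2 ≤ t ≤ r-1`, the limit of `n⁻ᵗ f⁽ʳ⁾(n; 4r-3t, 4)` exists and
equals `1 / (t! C(r,t))`. -/
theorem bes_k_eq_4 (r t : ℕ) (hr : 4 ≤ r) (ht : 2 ≤ t) (htr : t ≤ r - 1) :
    Tendsto (fun n : ℕ => (exNum r n (4 * r - 3 * t) 4 : ℝ) / (n : ℝ) ^ t) atTop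
      (nhds (1 / ((t.factorial : ℝ) * (r.choose t : ℝ)))) := by
  obtain ⟨d, hd, rfl⟩ : ∃ d, 1 ≤ d ∧ r = t + d := ⟨r - t, by omega, by omega⟩
  rw [show 4 * (t + d) - 3 * t = t + 4 * d by omega]
  have hC : (0 : ℝ) < (t + d).choose t := by exact_mod_cast Nat.choose_pos (by omega)
  have hg : Tendsto (fun n : ℕ => (n.choose t : ℝ) / (n : ℝ) ^ t / (t + d).choose t) atTop
      (nhds (1 / ((t.factorial : ℝ) * ((t + d).choose t : ℝ)))) := by
    rw [← div_div]
    exact (tendsto_choose_div_pow t).div_const _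
  have hL : (0 : ℝ) < 1 / ((t.factorial : ℝ) * ((t + d).choose t : ℝ)) := by positivity
  refine tendsto_order.2 ⟨fun a ha => ?_, fun a ha => ?_⟩
  · obtain ⟨ε, hε, haε⟩ : ∃ ε : ℝ, 0 < ε ∧
        a < (1 - ε) * (1 / ((t.factorial : ℝ) * ((t + d).choose t : ℝ))) := by
      set L := 1 / ((t.factorial : ℝ) * ((t + d).choose t : ℝ))
      refine ⟨(L - a) / (2 * L), div_pos (by linarith) (by linarith), ?_⟩
      have : (1 - (L - a) / (2 * L)) * L = L - (L - a) / 2 := by field_simp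
      rw [this]
      linarith
    filter_upwards [(hg.const_mul (1 - ε)).eventually_const_lt haε, exists_free_family t hd hε,
      eventually_gt_atTop 0] with n h1 h2 hn
    obtain ⟨G, hG, hfree, hcard⟩ := h2
    refine h1.trans_le ?_
    have hn' : (0 : ℝ) < (n : ℝ) ^ t := by positivity
    have h3 : (G.card : ℝ) ≤ exNum (t + d) n (t + 4 * d) 4 := by
      exact_mod_cast card_le_exNum hG hfree
    calc (1 - ε) * ((n.choose t : ℝ) / (n : ℝ) ^ t / (t + d).choose t) =
          (1 - ε) * n.choose t / (t + d).choose t / (n : ℝ) ^ t := by field_simp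
      _ ≤ G.card / (n : ℝ) ^ t := by
          gcongr
          rwa [div_le_iff₀ hC]
      _ ≤ _ := by gcongr
  · have hu : Tendsto (fun n : ℕ => (n.choose t : ℝ) / (n : ℝ) ^ t / (t + d).choose t +
        5 * ((n.choose (t - 1) : ℝ) / (n : ℝ) ^ t)) atTop
        (nhds (1 / ((t.factorial : ℝ) * ((t + d).choose t : ℝ)))) := by
      simpa using hg.add ((tendsto_choose_pred_div_pow (by omega : 1 ≤ t)).const_mul 5)
    filter_upwards [hu.eventually_lt_const ha, eventually_gt_atTop 0] with n h1 hn
    refine lt_of_le_of_lt ?_ h1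
    obtain ⟨G, hG, hfree, hcard⟩ := exists_card_eq_exNum (t + d) n (t + 4 * d) (show 1 ≤ 4 by omega)
    have h2 := card_mul_choose_le t d ht hd (by omega) G hG hfree
    rw [hcard, Fintype.card_fin] at h2
    have h3 : (exNum (t + d) n (t + 4 * d) 4 : ℝ) * (t + d).choose t ≤
        n.choose t + 5 * n.choose (t - 1) * (t + d).choose t := by exact_mod_cast h2
    have hn' : (0 : ℝ) < (n : ℝ) ^ t := by positivity
    rw [div_le_iff₀ hn']
    refine le_of_mul_le_mul_right (h3.trans (le_of_eq ?_)) hC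
    field_simp
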